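/- Let Λ be a concealed canonical algebra (in particular a canonical algebra) or a tubular algebra over an algebraically closed field k. The following conditions are equivalent: (a) ftors Λ forms a lattice; (b) ftors Λ forms a join-semilattice; (c) ftors Λ forms a meet-semilattice; (d) Λ has at most 2 simple modules up to isomorphism. -/

import Mathlib

noncomputable section

namespace TorsionLattice


/-! ### Posets: meets and joins (as unique maximal/minimal bounds), semilattices -/

section Posets

variable {P : Type*} [PartialOrder P]

/-- `m` is a maximal element of the subset `S`. -/
def MaximalIn (S : Set P) (m : P) : Prop := m ∈ S ∧ ∀ y ∈ S, m ≤ y → y = m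

/-- `m` is a minimal element of the subset `S`. -/
def MinimalIn (S : Set P) (m : P) : Prop := m ∈ S ∧ ∀ y ∈ S, y ≤ m → y = m

/-- `m` is a meet of `S` : the unique maximal element of the set of lower bounds of `S`. -/
def IsMeetOf (S : Set P) (m : P) : Prop :=
  MaximalIn (lowerBounds S) m ∧ ∀ y, MaximalIn (lowerBounds S) y → y = m

/-- `m` is a join of `S` : the unique minimal element of the set of upper bounds of `S`. -/
def IsJoinOf (S : Set P) (m : P) : Prop :=
  MinimalIn (upperBounds S) m ∧ ∀ y, MinimalIn (upperBounds S) y → y = m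

def HasMeet (S : Set P) : Prop := ∃ m, IsMeetOf S m

def HasJoin (S : Set P) : Prop := ∃ m, IsJoinOf S m

end Posets

/-- Every finite subset has a meet. -/
def IsMeetSemilatticePoset (P : Type*) [PartialOrder P] : Prop :=
  ∀ S : Set P, S.Finite → HasMeet S

/-- Every finite subset has a join. -/
def IsJoinSemilatticePoset (P : Type*) [PartialOrder P] : Prop :=
  ∀ S : Set P, S.Finite → HasJoin S

def IsLatticePoset (P : Type*) [PartialOrder P] : Prop :=
  IsJoinSemilatticePoset P ∧ IsMeetSemilatticePoset P

def IsCompleteMeetSemilatticePoset (P : Type*) [PartialOrder P] : Prop :=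
  ∀ S : Set P, HasMeet S

def IsCompleteJoinSemilatticePoset (P : Type*) [PartialOrder P] : Prop :=
  ∀ S : Set P, HasJoin S

def IsCompleteLatticePoset (P : Type*) [PartialOrder P] : Prop :=
  ∀ S : Set P, HasMeet S ∧ HasJoin S

def PreservesMeets {P Q : Type*} [PartialOrder P] [PartialOrder Q] (f : P → Q) : Prop :=
  ∀ (S : Set P) (m : P), IsMeetOf S m → IsMeetOf (f '' S) (f m)

def PreservesJoins {P Q : Type*} [PartialOrder P] [PartialOrder Q] (f : P → Q) : Prop :=
  ∀ (S : Set P) (m : P), IsJoinOf S m → IsJoinOf (f '' S) (f m)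

/-! ### Torsion classes in `mod Λ`

We model the category `mod Λ` of finite dimensional (equivalently, finitely generated)
`Λ`-modules by the objects of `ModuleCat.{0} Λ` satisfying `Module.Finite Λ`.
Subcategories closed under isomorphisms are modelled as sets of objects. -/

section Torsion

variable (Λ : Type) [Ring Λ]

/-- `0 → X → Y → Z → 0` is a short exact sequence. -/
def IsSES {X Y Z : Type} [AddCommGroup X] [Module Λ X] [AddCommGroup Y] [Module Λ Y]
    [AddCommGroup Z] [Module Λ Z] (f : X →ₗ[Λ] Y) (g : Y →ₗ[Λ] Z) : Prop :=
  Function.Injective f ∧ Function.Surjective g ∧ LinearMap.range f = LinearMap.ker g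

/-- All members of `C` are finite (equivalently, finite dimensional) modules,
i.e. `C` is a subcategory of `mod Λ`. -/
def FinMods (C : Set (ModuleCat.{0} Λ)) : Prop := ∀ X ∈ C, Module.Finite Λ X

/-- `C` is closed under factor modules (in particular under isomorphisms). -/
def QuotClosed (C : Set (ModuleCat.{0} Λ)) : Prop :=
  ∀ X ∈ C, ∀ (Y : ModuleCat.{0} Λ) (f : ↥X →ₗ[Λ] ↥Y), Function.Surjective f → Y ∈ C

/-- `C` is closed under submodules (in particular under isomorphisms). -/
def SubClosed (C : Set (ModuleCat.{0} Λ)) : Prop :=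
  ∀ X ∈ C, ∀ (Y : ModuleCat.{0} Λ) (f : ↥Y →ₗ[Λ] ↥X), Function.Injective f → Y ∈ C

/-- `C` is closed under extensions. -/
def ExtClosed (C : Set (ModuleCat.{0} Λ)) : Prop :=
  ∀ (X Y Z : ModuleCat.{0} Λ) (f : ↥X →ₗ[Λ] ↥Y) (g : ↥Y →ₗ[Λ] ↥Z),
    IsSES Λ f g → X ∈ C → Z ∈ C → Y ∈ C

/-- A torsion class in `mod Λ`: a class of finite dimensional modules closed under
factor modules, isomorphisms and extensions. -/
def IsTorsionClass (C : Set (ModuleCat.{0} Λ)) : Prop :=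
  FinMods Λ C ∧ QuotClosed Λ C ∧ ExtClosed Λ C

/-- A torsionfree class in `mod Λ`: a class of finite dimensional modules closed under
submodules, isomorphisms and extensions. -/
def IsTorsionFreeClass (C : Set (ModuleCat.{0} Λ)) : Prop :=
  FinMods Λ C ∧ SubClosed Λ C ∧ ExtClosed Λ C

/-- `Fac X`: factor modules of finite direct sums of copies of `X`. -/
def Fac (X : ModuleCat.{0} Λ) : Set (ModuleCat.{0} Λ) :=
  {Y | ∃ (n : ℕ) (f : (Fin n → ↥X) →ₗ[Λ] ↥Y), Function.Surjective f}

/-- `C` is of the form `Fac X` for a finite dimensional module `X`; for a torsion class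
this means precisely that `C` is functorially finite in `mod Λ`. -/
def IsFacFinite (C : Set (ModuleCat.{0} Λ)) : Prop :=
  ∃ X : ModuleCat.{0} Λ, Module.Finite Λ X ∧ C = Fac Λ X

/-- A functorially finite torsion class in `mod Λ`. -/
def IsFTorsionClass (C : Set (ModuleCat.{0} Λ)) : Prop :=
  IsTorsionClass Λ C ∧ IsFacFinite Λ C

/-- The poset `tors Λ` of torsion classes, ordered by inclusion. -/
abbrev Tors := {C : Set (ModuleCat.{0} Λ) // IsTorsionClass Λ C}

/-- The poset `torf Λ` of torsionfree classes, ordered by inclusion. -/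
abbrev Torf := {C : Set (ModuleCat.{0} Λ) // IsTorsionFreeClass Λ C}

/-- The poset `ftors Λ` of functorially finite torsion classes, ordered by inclusion. -/
abbrev FTors := {C : Set (ModuleCat.{0} Λ) // IsFTorsionClass Λ C}

/-- `C^⊥ = {X ∈ mod Λ ∣ Hom(C, X) = 0}`. -/
def rperp (C : Set (ModuleCat.{0} Λ)) : Set (ModuleCat.{0} Λ) :=
  {X | Module.Finite Λ X ∧ ∀ T ∈ C, ∀ f : ↥T →ₗ[Λ] ↥X, f = 0}

/-- `^⊥C = {X ∈ mod Λ ∣ Hom(X, C) = 0}`. -/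
def lperp (C : Set (ModuleCat.{0} Λ)) : Set (ModuleCat.{0} Λ) :=
  {X | Module.Finite Λ X ∧ ∀ T ∈ C, ∀ f : ↥X →ₗ[Λ] ↥T, f = 0}

/-- The intersection, inside `mod Λ`, of a family of subcategories of `mod Λ`. -/
def interMod (𝒮 : Set (Set (ModuleCat.{0} Λ))) : Set (ModuleCat.{0} Λ) :=
  {X | Module.Finite Λ X ∧ ∀ C ∈ 𝒮, X ∈ C}

/-- `Hom_Λ(X, Y) = 0`. -/
def HomZero (X Y : ModuleCat.{0} Λ) : Prop := ∀ f : ↥X →ₗ[Λ] ↥Y, f = 0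

/-- `X` is an indecomposable module: it is nonzero and its endomorphism ring has no
nontrivial idempotents. -/
def Indecomp (X : ModuleCat.{0} Λ) : Prop :=
  Nontrivial ↥X ∧ ∀ e : ↥X →ₗ[Λ] ↥X, e ∘ₗ e = e → e = 0 ∨ e = LinearMap.id

/-- `Ext¹_Λ(X, Y) ≠ 0` : there is a non-split short exact sequence `0 → Y → E → X → 0`. -/
def Ext1Nonzero (X Y : ModuleCat.{0} Λ) : Prop :=
  ∃ (E : ModuleCat.{0} Λ) (f : ↥Y →ₗ[Λ] ↥E) (g : ↥E →ₗ[Λ] ↥X),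
    IsSES Λ f g ∧ ¬∃ s : ↥X →ₗ[Λ] ↥E, g ∘ₗ s = LinearMap.id

/-- `X` is rigid : `Ext¹_Λ(X, X) = 0`. -/
def IsRigid (X : ModuleCat.{0} Λ) : Prop := ¬ Ext1Nonzero Λ X X

end Torsion

section Canonical

variable (k : Type) [Field k]

/-- Vertices of the canonical quiver of weight type `p = (p 0, …, p (t-1))`:
a source `0`, a sink `ω`, and `p i - 1` internal vertices on each arm `i`. -/
abbrev CanVert (t : ℕ) (p : Fin t → ℕ) : Type := Unit ⊕ Unit ⊕ (Σ i : Fin t, Fin (p i - 1))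

/-- Arrows of the canonical quiver: arm `i` consists of `p i` consecutive arrows
leading from the source to the sink. -/
abbrev CanArr (t : ℕ) (p : Fin t → ℕ) : Type := Σ i : Fin t, Fin (p i)

def canSource (t : ℕ) (p : Fin t → ℕ) : CanVert t p := Sum.inl ()

def canSink (t : ℕ) (p : Fin t → ℕ) : CanVert t p := Sum.inr (Sum.inl ())

/-- The source vertex of the `j`-th arrow of arm `i`. -/
def arrSrc (t : ℕ) (p : Fin t → ℕ) (i : Fin t) (j : Fin (p i)) : CanVert t p :=
  if h : (j : ℕ) = 0 then canSource t p
  else Sum.inr (Sum.inr ⟨i, ⟨(j : ℕ) - 1, by have := j.isLt; omega⟩⟩)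

/-- The target vertex of the `j`-th arrow of arm `i`. -/
def arrTgt (t : ℕ) (p : Fin t → ℕ) (i : Fin t) (j : Fin (p i)) : CanVert t p :=
  if h : (j : ℕ) + 1 = p i then canSink t p
  else Sum.inr (Sum.inr ⟨i, ⟨(j : ℕ), by have := j.isLt; omega⟩⟩)

/-- Generators (vertices and arrows) for the presentation of the canonical algebra. -/
abbrev CanGen (t : ℕ) (p : Fin t → ℕ) : Type := CanVert t p ⊕ CanArr t p

/-- The composition of all arrows along arm `i`, as a word in the free algebra. -/
def armWord (t : ℕ) (p : Fin t → ℕ) (i : Fin t) : FreeAlgebra k (CanGen t p) :=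
  ((List.ofFn fun j : Fin (p i) =>
      FreeAlgebra.ι k (Sum.inr ⟨i, j⟩ : CanGen t p))).reverse.prod

/-- The defining relations of the canonical algebra `C(p, λ)`: the path algebra
relations of the canonical quiver, together with the canonical relations
`w_i = w_0 + λ_i · w_1` for `2 ≤ i < t`, where `w_i` is the composition of arm `i`. -/
inductive CanRel (t : ℕ) (p : Fin t → ℕ) (lam : Fin t → k) :
    FreeAlgebra k (CanGen t p) → FreeAlgebra k (CanGen t p) → Prop
  | idem (v : CanVert t p) : CanRel t p lam
      (FreeAlgebra.ι k (Sum.inl v : CanGen t p) * FreeAlgebra.ι k (Sum.inl v : CanGen t p))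
      (FreeAlgebra.ι k (Sum.inl v : CanGen t p))
  | orth {v w : CanVert t p} (h : v ≠ w) : CanRel t p lam
      (FreeAlgebra.ι k (Sum.inl v : CanGen t p) * FreeAlgebra.ι k (Sum.inl w : CanGen t p)) 0
  | sum_one : CanRel t p lam
      (∑ v : CanVert t p, FreeAlgebra.ι k (Sum.inl v : CanGen t p)) 1
  | target (a : CanArr t p) : CanRel t p lam
      (FreeAlgebra.ι k (Sum.inl (arrTgt t p a.1 a.2) : CanGen t p) *
        FreeAlgebra.ι k (Sum.inr a : CanGen t p))
      (FreeAlgebra.ι k (Sum.inr a : CanGen t p))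
  | source (a : CanArr t p) : CanRel t p lam
      (FreeAlgebra.ι k (Sum.inr a : CanGen t p) *
        FreeAlgebra.ι k (Sum.inl (arrSrc t p a.1 a.2) : CanGen t p))
      (FreeAlgebra.ι k (Sum.inr a : CanGen t p))
  | canonical (i : Fin t) (h2 : 2 ≤ (i : ℕ)) : CanRel t p lam
      (armWord k t p i)
      (armWord k t p ⟨0, lt_trans (lt_of_lt_of_le two_pos h2) i.isLt⟩ +
        lam i • armWord k t p ⟨1, lt_trans (lt_of_lt_of_le one_lt_two h2) i.isLt⟩)

/-- The canonical algebra `C(p, λ)`. -/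
abbrev CanAlg (t : ℕ) (p : Fin t → ℕ) (lam : Fin t → k) : Type :=
  RingQuot (CanRel k t p lam)

/-- The conditions on the weights and parameters of a canonical algebra:
`t ≥ 2` arms, weights `≥ 1` (and `≥ 2` if there are at least three arms and hence
nontrivial relations), and pairwise distinct nonzero parameters `λ_i` for `i ≥ 2`. -/
def IsCanonicalData (t : ℕ) (p : Fin t → ℕ) (lam : Fin t → k) : Prop :=
  2 ≤ t ∧ (∀ i, 1 ≤ p i) ∧ (3 ≤ t → ∀ i, 2 ≤ p i) ∧
  (∀ i : Fin t, 2 ≤ (i : ℕ) → lam i ≠ 0) ∧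
  (∀ i j : Fin t, 2 ≤ (i : ℕ) → 2 ≤ (j : ℕ) → lam i = lam j → i = j)

/-- The idempotent of the canonical algebra at the vertex `v`. -/
def canIdem (t : ℕ) (p : Fin t → ℕ) (lam : Fin t → k) (v : CanVert t p) :
    CanAlg k t p lam :=
  RingQuot.mkAlgHom k (CanRel k t p lam) (FreeAlgebra.ι k (Sum.inl v : CanGen t p))

/-- The `k`-dimension of `e • X`, for an idempotent `e` of a `k`-algebra `A` attached to
a vertex of a quiver: the dimension of the vertex component of the module `X`. -/
def vdim (A : Type) [Ring A] [Algebra k A] (e : A) (X : Type) [AddCommGroup X]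
    [Module A X] : ℕ :=
  letI := Module.compHom X (algebraMap k A)
  Module.finrank k ↥(LinearMap.range
    ({ toFun := fun x => e • x
       map_add' := fun x y => smul_add e x y
       map_smul' := fun c x => by
         show e • (algebraMap k A c • x) = algebraMap k A c • (e • x)
         rw [smul_smul, smul_smul, Algebra.commutes] } : X →ₗ[k] X))

/-- `X` belongs to `add T`: it is a direct summand of a finite direct sum of copies
of `T`. -/
def InAddOf (A : Type) [Ring A] (T X : ModuleCat.{0} A) : Prop :=
  ∃ (n : ℕ) (f : ↥X →ₗ[A] (Fin n → ↥T)) (g : (Fin n → ↥T) →ₗ[A] ↥X),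
    g ∘ₗ f = LinearMap.id

/-- `T` is a tilting module: finite dimensional, of projective dimension at most one,
with `Ext¹(T, T) = 0`, and admitting a coresolution `0 → A → T₀ → T₁ → 0` of the regular
module with `T₀, T₁ ∈ add T`. -/
def IsTiltingModule (A : Type) [Ring A] (T : ModuleCat.{0} A) : Prop :=
  Module.Finite A T ∧
  (∃ (P1 P0 : ModuleCat.{0} A) (f : ↥P1 →ₗ[A] ↥P0) (g : ↥P0 →ₗ[A] ↥T),
    Module.Projective A P1 ∧ Module.Projective A P0 ∧ IsSES A f g) ∧
  ¬ Ext1Nonzero A T T ∧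
  (∃ (T0 T1 : ModuleCat.{0} A) (f : A →ₗ[A] ↥T0) (g : ↥T0 →ₗ[A] ↥T1),
    InAddOf A T T0 ∧ InAddOf A T T1 ∧ IsSES A f g)

/-- `Λ` is (isomorphic to) the concealed canonical algebra `End_C(T)` obtained from the
canonical algebra `C = C(p, λ)` and a tilting `C`-module `T` all of whose indecomposable
direct summands lie in the positive part `𝒫^C` (the indecomposables `X` with
`dim_k e_0 X < dim_k e_ω X`, which separates `𝒫^C` from the canonical tubular family and
the negative part). -/
def IsConcealedCanonicalOf (Λ : Type) [Ring Λ] [Algebra k Λ] (t : ℕ) (p : Fin t → ℕ)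
    (lam : Fin t → k) : Prop :=
  IsCanonicalData k t p lam ∧
  ∃ T : ModuleCat.{0} (CanAlg k t p lam),
    IsTiltingModule (CanAlg k t p lam) T ∧
    (∀ X : ModuleCat.{0} (CanAlg k t p lam), Module.Finite (CanAlg k t p lam) X →
      Indecomp (CanAlg k t p lam) X → InAddOf (CanAlg k t p lam) T X →
      vdim k (CanAlg k t p lam) (canIdem k t p lam (canSource t p)) ↥X <
        vdim k (CanAlg k t p lam) (canIdem k t p lam (canSink t p)) ↥X) ∧
    ∃ φ : Λ ≃+* Module.End (CanAlg k t p lam) ↥T,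
      ∀ (c : k) (x : Λ) (m : ↥T),
        φ (algebraMap k Λ c * x) m = algebraMap k (CanAlg k t p lam) c • (φ x m)

/-- `Λ` is a concealed canonical algebra. -/
def IsConcealedCanonical (Λ : Type) [Ring Λ] [Algebra k Λ] : Prop :=
  ∃ (t : ℕ) (p : Fin t → ℕ) (lam : Fin t → k), IsConcealedCanonicalOf k Λ t p lam

/-- The tubular weight types `(2,2,2,2)`, `(3,3,3)`, `(2,4,4)`, `(2,3,6)`. -/
def IsTubularWeights (t : ℕ) (p : Fin t → ℕ) : Prop :=
  (t = 4 ∧ ∀ i, p i = 2) ∨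
  ((List.ofFn p : Multiset ℕ) = ({3, 3, 3} : Multiset ℕ)) ∨
  ((List.ofFn p : Multiset ℕ) = ({2, 4, 4} : Multiset ℕ)) ∨
  ((List.ofFn p : Multiset ℕ) = ({2, 3, 6} : Multiset ℕ))

/-- `Λ` is a tubular algebra; by a theorem of Lenzing–Meltzer the tubular algebras are
precisely the concealed canonical algebras of tubular weight type. -/
def IsTubularAlgebra (Λ : Type) [Ring Λ] [Algebra k Λ] : Prop :=
  ∃ (t : ℕ) (p : Fin t → ℕ) (lam : Fin t → k),
    IsTubularWeights t p ∧ IsConcealedCanonicalOf k Λ t p lam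

end Canonical

section Exactness

variable {R : Type} [Ring R] {X Y Z W E Q P : Type}
  [AddCommGroup X] [Module R X] [AddCommGroup Y] [Module R Y] [AddCommGroup Z] [Module R Z]
  [AddCommGroup W] [Module R W] [AddCommGroup E] [Module R E] [AddCommGroup Q] [Module R Q]
  [AddCommGroup P] [Module R P]

lemma IsSES.apply_eq_zero {f : X →ₗ[R] Y} {g : Y →ₗ[R] Z} (h : IsSES R f g) (x : X) :
    g (f x) = 0 := by
  have : f x ∈ LinearMap.ker g := h.2.2 ▸ ⟨x, rfl⟩
  exact this

lemma IsSES.exists_of_eq_zero {f : X →ₗ[R] Y} {g : Y →ₗ[R] Z} (h : IsSES R f g) {y : Y}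
    (hy : g y = 0) : ∃ x, f x = y := by
  have : y ∈ LinearMap.range f := h.2.2 ▸ hy
  exact this

lemma isSES_mk {f : X →ₗ[R] Y} {g : Y →ₗ[R] Z} (h1 : Function.Injective f)
    (h2 : Function.Surjective g) (h3 : ∀ x, g (f x) = 0) (h4 : ∀ y, g y = 0 → ∃ x, f x = y) :
    IsSES R f g :=
  ⟨h1, h2, le_antisymm (by rintro _ ⟨x, rfl⟩; exact h3 x) (fun y hy => h4 y hy)⟩

lemma isSES_ker {g : Y →ₗ[R] Z} (hg : Function.Surjective g) :
    IsSES R (LinearMap.ker g).subtype g :=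
  isSES_mk Subtype.val_injective hg (fun x => x.2) (fun y hy => ⟨⟨y, hy⟩, rfl⟩)

lemma isSES_mkQ (N : Submodule R Y) : IsSES R N.subtype N.mkQ :=
  isSES_mk Subtype.val_injective N.mkQ_surjective (fun x => by simp)
    (fun y hy => ⟨⟨y, by simpa using hy⟩, rfl⟩)

lemma exists_factor_surj {g : E →ₗ[R] X} (hg : Function.Surjective g) (f : E →ₗ[R] W)
    (h : ∀ e, g e = 0 → f e = 0) : ∃ u : X →ₗ[R] W, u ∘ₗ g = f := by
  refine ⟨((LinearMap.ker g).liftQ f (fun e he => h e he)) ∘ₗ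
    (g.quotKerEquivOfSurjective hg).symm.toLinearMap, ?_⟩
  ext e
  have : (g.quotKerEquivOfSurjective hg).symm (g e) = (LinearMap.ker g).mkQ e := by
    rw [LinearEquiv.symm_apply_eq]; rfl
  simp only [LinearMap.comp_apply, LinearEquiv.coe_coe, this]
  rfl

lemma exists_factor_inj {i : Y →ₗ[R] E} (hi : Function.Injective i) (f : W →ₗ[R] E)
    (h : ∀ w, ∃ y, i y = f w) : ∃ u : W →ₗ[R] Y, i ∘ₗ u = f := by
  refine ⟨(LinearEquiv.ofInjective i hi).symm.toLinearMap ∘ₗ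
    f.codRestrict (LinearMap.range i) (fun w => h w), ?_⟩
  ext w
  have := (LinearEquiv.ofInjective i hi).apply_symm_apply
    (f.codRestrict (LinearMap.range i) (fun w => h w) w)
  exact congrArg Subtype.val this

lemma IsSES.section_of_retraction {i : Y →ₗ[R] E} {g : E →ₗ[R] X} (h : IsSES R i g)
    {r : E →ₗ[R] Y} (hr : ∀ y, r (i y) = y) : ∃ s : X →ₗ[R] E, g ∘ₗ s = LinearMap.id := by
  obtain ⟨s, hs⟩ := exists_factor_surj h.2.1 (LinearMap.id - i ∘ₗ r) (by
    intro e he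
    obtain ⟨y, rfl⟩ := h.exists_of_eq_zero he
    simp [hr])
  refine ⟨s, ?_⟩
  ext x
  obtain ⟨e, rfl⟩ := h.2.1 x
  have := LinearMap.congr_fun hs e
  simp at this
  simp [this, h.apply_eq_zero]

lemma IsSES.retraction_of_section {i : Y →ₗ[R] E} {g : E →ₗ[R] X} (h : IsSES R i g)
    {s : X →ₗ[R] E} (hs : g ∘ₗ s = LinearMap.id) : ∃ r : E →ₗ[R] Y, ∀ y, r (i y) = y := by
  have hs' : ∀ x, g (s x) = x := fun x => LinearMap.congr_fun hs x
  obtain ⟨r, hr⟩ := exists_factor_inj h.1 (LinearMap.id - s ∘ₗ g) (fun e =>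
    h.exists_of_eq_zero (by simp [hs']))
  refine ⟨r, fun y => h.1 ?_⟩
  have := LinearMap.congr_fun hr (i y)
  simpa [h.apply_eq_zero] using this

variable (R) in
/-- Every extension of `X` by `Y` splits, i.e. `Ext¹(X, Y) = 0`. -/
def ExtZ (X Y : Type) [AddCommGroup X] [Module R X] [AddCommGroup Y] [Module R Y] : Prop :=
  ∀ (E : Type) [AddCommGroup E] [Module R E] (i : Y →ₗ[R] E) (g : E →ₗ[R] X),
    IsSES R i g → ∃ s : X →ₗ[R] E, g ∘ₗ s = LinearMap.id

lemma extZ_of_not_ext1Nonzero {X Y : ModuleCat.{0} R} (h : ¬ Ext1Nonzero R X Y) :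
    ExtZ R X Y := by
  intro E _ _ i g hs
  by_contra hc
  exact h ⟨ModuleCat.of R E, i, g, hs, hc⟩

lemma ExtZ.lift (hE : ExtZ R X Y) {i : Y →ₗ[R] E} {q : E →ₗ[R] Q} (hs : IsSES R i q)
    (h : X →ₗ[R] Q) : ∃ u : X →ₗ[R] E, q ∘ₗ u = h := by
  let D : Submodule R (E × X) :=
    LinearMap.ker (q ∘ₗ LinearMap.fst R E X - h ∘ₗ LinearMap.snd R E X)
  have hD : ∀ d : E × X, d ∈ D ↔ q d.1 = h d.2 := fun d => by
    simp [D, sub_eq_zero]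
  let j : Y →ₗ[R] D := (LinearMap.inl R E X ∘ₗ i).codRestrict D (fun y => by
    rw [hD]; simp [hs.apply_eq_zero])
  let p : D →ₗ[R] X := LinearMap.snd R E X ∘ₗ D.subtype
  obtain ⟨s, hsec⟩ := hE D j p (by
    refine isSES_mk ?_ ?_ ?_ ?_
    · intro a b hab
      have := congrArg (fun d : D => d.1.1) hab
      exact hs.1 this
    · intro x
      obtain ⟨e, he⟩ := hs.2.1 (h x)
      exact ⟨⟨(e, x), (hD _).2 he⟩, rfl⟩
    · intro y; rfl
    · rintro ⟨⟨e, x⟩, hd⟩ hx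
      have hx : x = 0 := hx
      subst hx
      rw [hD] at hd
      obtain ⟨y, hy⟩ := hs.exists_of_eq_zero (y := e) (by simpa using hd)
      exact ⟨y, Subtype.ext (Prod.ext hy rfl)⟩)
  refine ⟨LinearMap.fst R E X ∘ₗ D.subtype ∘ₗ s, ?_⟩
  ext x
  have h1 := (hD _).1 (s x).2
  have h2 : (s x).1.2 = x := LinearMap.congr_fun hsec x
  rw [h2] at h1
  exact h1

lemma ExtZ.extend (hE : ExtZ R X Y) {i : W →ₗ[R] E} {g : E →ₗ[R] X} (hs : IsSES R i g)
    (κ : W →ₗ[R] Y) : ∃ u : E →ₗ[R] Y, ∀ w, u (i w) = κ w := by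
  let D : Submodule R (Y × E) := LinearMap.range (κ.prod (-i))
  let j : Y →ₗ[R] (Y × E) ⧸ D := D.mkQ ∘ₗ LinearMap.inl R Y E
  let p : ((Y × E) ⧸ D) →ₗ[R] X := D.liftQ (g ∘ₗ LinearMap.snd R Y E) (by
    rintro _ ⟨w, rfl⟩
    simp [hs.apply_eq_zero])
  have hses : IsSES R j p := by
    refine isSES_mk ?_ ?_ ?_ ?_
    · rw [← LinearMap.ker_eq_bot, LinearMap.ker_eq_bot']
      intro y hy
      have : (y, (0 : E)) ∈ D := by simpa [j] using hy
      obtain ⟨w, hw⟩ := this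
      have h1 : κ w = y := congrArg Prod.fst hw
      have h2 : i w = 0 := by simpa using congrArg Prod.snd hw
      have : w = 0 := hs.1 (by simpa using h2)
      rw [← h1, this, map_zero]
    · intro x
      obtain ⟨e, he⟩ := hs.2.1 x
      exact ⟨D.mkQ (0, e), by simpa [p] using he⟩
    · intro y; simp [j, p]
    · intro d hd
      obtain ⟨⟨y, e⟩, rfl⟩ := D.mkQ_surjective d
      have : g e = 0 := by simpa [p] using hd
      obtain ⟨w, rfl⟩ := hs.exists_of_eq_zero this
      refine ⟨y + κ w, ?_⟩
      have : (y + κ w, (0 : E)) - (y, i w) ∈ D := ⟨w, by ext <;> simp⟩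
      exact (Submodule.Quotient.eq D).2 this
  obtain ⟨s, hsec⟩ := hE _ j p hses
  obtain ⟨r, hr⟩ := hses.retraction_of_section hsec
  refine ⟨r ∘ₗ D.mkQ ∘ₗ LinearMap.inr R Y E, fun w => ?_⟩
  have : D.mkQ (0, i w) = j (κ w) := by
    have : ((0 : Y), i w) - (κ w, 0) ∈ D := ⟨-w, by ext <;> simp⟩
    exact (Submodule.Quotient.eq D).2 this
  simp only [LinearMap.comp_apply, LinearMap.inr_apply]
  rw [this, hr]

lemma extZ_of_extend (h : ∀ (E : Type) [AddCommGroup E] [Module R E] (i : Y →ₗ[R] E)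
    (g : E →ₗ[R] X), IsSES R i g → ∃ r : E →ₗ[R] Y, ∀ y, r (i y) = y) : ExtZ R X Y := by
  intro E _ _ i g hs
  obtain ⟨r, hr⟩ := h E i g hs
  exact hs.section_of_retraction hr

lemma ExtZ.retract_left (hE : ExtZ R X Y) (a : Z →ₗ[R] X) (b : X →ₗ[R] Z)
    (hab : ∀ z, b (a z) = z) : ExtZ R Z Y := by
  intro E _ _ i g hs
  obtain ⟨u, hu⟩ := hE.lift hs b
  refine ⟨u ∘ₗ a, ?_⟩
  rw [← LinearMap.comp_assoc, hu]
  ext z; exact hab z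

lemma ExtZ.pi_left {ι : Type} [Finite ι] (hE : ExtZ R X Y) : ExtZ R (ι → X) Y := by
  classical
  have := Fintype.ofFinite ι
  intro E _ _ i g hs
  choose u hu using fun j : ι => hE.lift hs (LinearMap.single R (fun _ => X) j)
  refine ⟨∑ j, u j ∘ₗ LinearMap.proj j, ?_⟩
  refine LinearMap.ext fun x => ?_
  have hu2 : ∀ j y, g (u j y) = Pi.single j y := fun j y => LinearMap.congr_fun (hu j) y
  rw [LinearMap.comp_apply, LinearMap.sum_apply, map_sum]
  simp only [LinearMap.comp_apply, LinearMap.proj_apply, hu2]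
  exact Finset.univ_sum_single x

lemma ExtZ.pi_right {ι : Type} (hE : ExtZ R X Y) : ExtZ R X (ι → Y) := by
  refine extZ_of_extend fun E _ _ i g hs => ?_
  choose u hu using fun j : ι => hE.extend hs (LinearMap.proj (R := R) (φ := fun _ : ι => Y) j)
  exact ⟨LinearMap.pi u, fun y => funext fun j => hu j y⟩

lemma ExtZ.prod_left (hX : ExtZ R X Y) (hZ : ExtZ R Z Y) : ExtZ R (X × Z) Y := by
  intro E _ _ i g hs
  obtain ⟨u, hu⟩ := hX.lift hs (LinearMap.inl R X Z)
  obtain ⟨v, hv⟩ := hZ.lift hs (LinearMap.inr R X Z)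
  refine ⟨u.coprod v, ?_⟩
  rw [LinearMap.comp_coprod, hu, hv, LinearMap.coprod_inl_inr]

lemma ExtZ.of_isSES_left {a : X →ₗ[R] Z} {b : Z →ₗ[R] W} (h : IsSES R a b)
    (hX : ExtZ R X Y) (hW : ExtZ R W Y) : ExtZ R Z Y := by
  refine extZ_of_extend fun E _ _ i g hs => ?_
  obtain ⟨u, hu⟩ := hX.lift hs a
  let D : Submodule R E := LinearMap.ker (b ∘ₗ g)
  have hD : IsSES R D.subtype (b ∘ₗ g) := isSES_ker (h.2.1.comp hs.2.1)
  have hgD : ∀ d : D, b (g d) = 0 := fun d => d.2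
  choose c hc using fun d : D => h.exists_of_eq_zero (hgD d)
  obtain ⟨c, hc⟩ := exists_factor_inj h.1 (g ∘ₗ D.subtype) (fun d => h.exists_of_eq_zero d.2)
  obtain ⟨r, hr⟩ := exists_factor_inj hs.1 (D.subtype - u ∘ₗ c) (fun d =>
    hs.exists_of_eq_zero (by
      have h1 := LinearMap.congr_fun hu (c d)
      have h2 := LinearMap.congr_fun hc d
      simp at h1 h2 ⊢
      rw [h1, h2, sub_self]))
  obtain ⟨v, hv⟩ := hW.extend hD r
  refine ⟨v, fun y => hs.1 ?_⟩
  have hy : i y ∈ D := by simp [D, hs.apply_eq_zero]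
  have h1 := hv ⟨i y, hy⟩
  have h2 := LinearMap.congr_fun hr ⟨i y, hy⟩
  have h3 : c ⟨i y, hy⟩ = 0 := h.1 (by
    have := LinearMap.congr_fun hc ⟨i y, hy⟩
    simp [hs.apply_eq_zero] at this
    simpa using this)
  simp [h3] at h2
  simp at h1
  rw [h1, h2]

lemma extZ_of_projective [Module.Projective R X] : ExtZ R X Y := by
  intro E _ _ i g hs
  exact Module.projective_lifting_property g LinearMap.id hs.2.1

lemma extZ_of_presentation [Module.Projective R P] {a : W →ₗ[R] P} {b : P →ₗ[R] X}
    (h : IsSES R a b) (hext : ∀ u : W →ₗ[R] Y, ∃ v : P →ₗ[R] Y, ∀ w, v (a w) = u w) :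
    ExtZ R X Y := by
  intro E _ _ i g hs
  obtain ⟨l, hl⟩ := Module.projective_lifting_property g b hs.2.1
  have hl' : ∀ p, g (l p) = b p := fun p => LinearMap.congr_fun hl p
  obtain ⟨u, hu⟩ := exists_factor_inj hs.1 (l ∘ₗ a) (fun w =>
    hs.exists_of_eq_zero (by simp [hl', h.apply_eq_zero]))
  obtain ⟨v, hv⟩ := hext u
  obtain ⟨s, hsec⟩ := exists_factor_surj h.2.1 (l - i ∘ₗ v) (by
    intro p hp
    obtain ⟨w, rfl⟩ := h.exists_of_eq_zero hp
    have := LinearMap.congr_fun hu w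
    simp at this
    simp [hv, this])
  refine ⟨s, ?_⟩
  ext x
  obtain ⟨p, rfl⟩ := h.2.1 x
  have := LinearMap.congr_fun hsec p
  simp at this
  simp [this, hl', hs.apply_eq_zero]

end Exactness

section TorsionBasics

variable {R : Type} [Ring R] {X Y Z W : Type}
  [AddCommGroup X] [Module R X] [AddCommGroup Y] [Module R Y] [AddCommGroup Z] [Module R Z]
  [AddCommGroup W] [Module R W]

/-- Membership of an unbundled module in a class of modules. -/
abbrev Mem (C : Set (ModuleCat.{0} R)) (X : Type) [AddCommGroup X] [Module R X] : Prop :=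
  ModuleCat.of R X ∈ C

lemma IsTorsionClass.finite {C : Set (ModuleCat.{0} R)} (hC : IsTorsionClass R C)
    (h : Mem C X) : Module.Finite R X := hC.1 _ h

lemma IsTorsionClass.quot {C : Set (ModuleCat.{0} R)} (hC : IsTorsionClass R C)
    (h : Mem C X) (f : X →ₗ[R] Y) (hf : Function.Surjective f) : Mem C Y :=
  hC.2.1 _ h (ModuleCat.of R Y) f hf

lemma IsTorsionClass.equiv {C : Set (ModuleCat.{0} R)} (hC : IsTorsionClass R C)
    (h : Mem C X) (e : X ≃ₗ[R] Y) : Mem C Y := hC.quot h e.toLinearMap e.surjective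

lemma IsTorsionClass.ext {C : Set (ModuleCat.{0} R)} (hC : IsTorsionClass R C)
    {f : X →ₗ[R] Y} {g : Y →ₗ[R] Z} (hs : IsSES R f g) (hX : Mem C X) (hZ : Mem C Z) :
    Mem C Y := hC.2.2 (ModuleCat.of R X) (ModuleCat.of R Y) (ModuleCat.of R Z) f g hs hX hZ

lemma IsTorsionClass.range {C : Set (ModuleCat.{0} R)} (hC : IsTorsionClass R C)
    (h : Mem C X) (f : X →ₗ[R] Y) : Mem C (LinearMap.range f) :=
  hC.quot h f.rangeRestrict f.surjective_rangeRestrict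

lemma isSES_prod : IsSES R (LinearMap.inl R X Y) (LinearMap.snd R X Y) :=
  isSES_mk LinearMap.inl_injective LinearMap.snd_surjective (fun _ => rfl)
    (fun y hy => ⟨y.1, Prod.ext rfl (Eq.symm hy)⟩)

lemma IsTorsionClass.prod {C : Set (ModuleCat.{0} R)} (hC : IsTorsionClass R C)
    (hX : Mem C X) (hY : Mem C Y) : Mem C (X × Y) := hC.ext isSES_prod hX hY

lemma IsTorsionClass.subsingleton {C : Set (ModuleCat.{0} R)} (hC : IsTorsionClass R C)
    (h0 : C.Nonempty) [Subsingleton X] : Mem C X := by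
  obtain ⟨Y, hY⟩ := h0
  exact hC.2.1 Y hY (ModuleCat.of R X) 0 (fun x => ⟨0, Subsingleton.elim (α := X) _ _⟩)

lemma IsTorsionClass.pi_fin {C : Set (ModuleCat.{0} R)} (hC : IsTorsionClass R C) (h0 : C.Nonempty) :
    ∀ (n : ℕ) (F : Fin n → Type) [∀ i, AddCommGroup (F i)] [∀ i, Module R (F i)],
      (∀ i, Mem C (F i)) → Mem C (∀ i, F i)
  | 0, F, _, _, _ => hC.subsingleton h0
  | n + 1, F, _, _, h => by
    have := hC.prod (h 0) (hC.pi_fin h0 n (fun i => F i.succ) (fun i => h i.succ))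
    exact hC.equiv this (Fin.consLinearEquiv R F)

lemma IsTorsionClass.pow {C : Set (ModuleCat.{0} R)} (hC : IsTorsionClass R C)
    (hX : Mem C X) (n : ℕ) : Mem C (Fin n → X) :=
  hC.pi_fin ⟨_, hX⟩ n (fun _ => X) (fun _ => hX)

/-- Every noetherian module has a submodule in a given torsion class with torsionfree quotient. -/
lemma IsTorsionClass.exists_radical {C : Set (ModuleCat.{0} R)} (hC : IsTorsionClass R C)
    (h0 : C.Nonempty) (Y : Type) [AddCommGroup Y] [Module R Y] [IsNoetherian R Y] :
    ∃ N : Submodule R Y, Mem C N ∧ ∀ (X : Type) [AddCommGroup X] [Module R X], Mem C X →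
      ∀ f : X →ₗ[R] Y ⧸ N, f = 0 := by
  obtain ⟨N, hN, hmax⟩ := WellFounded.has_min
    (wellFounded_gt (α := Submodule R Y)) {N : Submodule R Y | Mem C N}
    ⟨⊥, hC.subsingleton h0⟩
  refine ⟨N, hN, fun X _ _ hX f => ?_⟩
  let N' : Submodule R Y := (LinearMap.range f).comap N.mkQ
  have hle : N ≤ N' := fun y hy => by
    have : N.mkQ y = 0 := by simpa using hy
    simp only [N', Submodule.mem_comap, this]
    exact Submodule.zero_mem _
  have hN' : Mem C N' := by
    refine hC.ext (f := Submodule.inclusion hle)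
      (g := (N.mkQ ∘ₗ N'.subtype).codRestrict (LinearMap.range f) (fun y => y.2)) ?_ hN
      (hC.range hX f)
    refine isSES_mk (Submodule.inclusion_injective hle) ?_ ?_ ?_
    · rintro ⟨z, hz⟩
      obtain ⟨y, rfl⟩ := N.mkQ_surjective z
      exact ⟨⟨y, hz⟩, rfl⟩
    · intro x
      refine Subtype.ext ?_
      change N.mkQ (x : Y) = 0
      simp
    · rintro ⟨y, hy⟩ h
      have : N.mkQ y = 0 := congrArg Subtype.val h
      exact ⟨⟨y, by simpa using this⟩, rfl⟩
  have hEq : N' = N := by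
    by_contra hne
    exact hmax N' hN' (lt_of_le_of_ne hle (Ne.symm hne))
  ext x
  obtain ⟨y, hy⟩ := N.mkQ_surjective (f x)
  have : y ∈ N' := by
    simp only [N', Submodule.mem_comap, hy]
    exact ⟨x, rfl⟩
  rw [hEq] at this
  rw [← hy]
  simpa using this

lemma mem_fac_of_finite {ι : Type} [Finite ι] (f : (ι → X) →ₗ[R] Y)
    (hf : Function.Surjective f) : Mem (Fac R (ModuleCat.of R X)) Y := by
  obtain ⟨n, ⟨e⟩⟩ := Finite.exists_equiv_fin ι
  exact ⟨n, f ∘ₗ (LinearEquiv.funCongrLeft R X e).toLinearMap,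
    hf.comp (LinearEquiv.surjective _)⟩

lemma mem_fac_iff : Mem (Fac R (ModuleCat.of R X)) Y ↔
    ∃ (n : ℕ) (f : (Fin n → X) →ₗ[R] Y), Function.Surjective f := Iff.rfl

lemma mem_fac_of_surjective (f : X →ₗ[R] Y) (hf : Function.Surjective f) :
    Mem (Fac R (ModuleCat.of R X)) Y :=
  mem_fac_of_finite (ι := Unit) (f ∘ₗ LinearMap.proj ()) (hf.comp (fun x => ⟨fun _ => x, rfl⟩))

lemma mem_fac_self : Mem (Fac R (ModuleCat.of R X)) X :=
  mem_fac_of_surjective LinearMap.id Function.surjective_id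

lemma fac_mono {X' : Type} [AddCommGroup X'] [Module R X']
    (h : Mem (Fac R (ModuleCat.of R X)) X') :
    Fac R (ModuleCat.of R X') ⊆ Fac R (ModuleCat.of R X) := by
  rintro Y ⟨m, g, hg⟩
  obtain ⟨n, f, hf⟩ := mem_fac_iff.1 h
  let F : (Fin m → Fin n → X) →ₗ[R] (Fin m → X') := LinearMap.pi fun i => f ∘ₗ LinearMap.proj i
  have hF : Function.Surjective F := fun x => by
    choose z hz using fun i => hf (x i)
    exact ⟨z, funext hz⟩
  exact mem_fac_of_finite (ι := Fin m × Fin n) (X := X) (Y := Y)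
    (g ∘ₗ F ∘ₗ (LinearEquiv.curry R X (Fin m) (Fin n)).toLinearMap)
    (hg.comp (hF.comp (LinearEquiv.surjective _)))

lemma IsTorsionClass.fac_subset {C : Set (ModuleCat.{0} R)} (hC : IsTorsionClass R C)
    (hX : Mem C X) : Fac R (ModuleCat.of R X) ⊆ C := by
  rintro Y ⟨n, f, hf⟩
  exact hC.2.1 _ (hC.pow hX n) Y f hf

lemma mem_fac_of_trace {Y : Type} [AddCommGroup Y] [Module R Y] [Module.Finite R Y]
    (h : ∀ N : Submodule R Y, (∀ (f : X →ₗ[R] Y) (x : X), f x ∈ N) → ∀ y, y ∈ N) :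
    Mem (Fac R (ModuleCat.of R X)) Y := by
  classical
  have htop : (⊤ : Submodule R Y) ≤ ⨆ f : X →ₗ[R] Y, LinearMap.range f :=
    fun y _ => h _ (fun f x =>
      Submodule.mem_iSup_of_mem f (LinearMap.mem_range_self f x)) y
  have hc : IsCompactElement (⊤ : Submodule R Y) :=
    (Submodule.fg_iff_compact _).1 Module.Finite.fg_top
  obtain ⟨s, hs⟩ := (CompleteLattice.isCompactElement_iff_exists_le_iSup_of_le_iSup _).1 hc _ _ htop
  let F : (s → X) →ₗ[R] Y := ∑ f : s, f.1 ∘ₗ LinearMap.proj f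
  refine mem_fac_of_finite F ?_
  rw [← LinearMap.range_eq_top, eq_top_iff]
  refine hs.trans (Finset.sup_le fun f hf => ?_)
  rintro _ ⟨x, rfl⟩
  refine ⟨Pi.single ⟨f, hf⟩ x, ?_⟩
  simp only [F, LinearMap.sum_apply, LinearMap.comp_apply, LinearMap.proj_apply]
  rw [Finset.sum_eq_single ⟨f, hf⟩]
  · simp
  · intro b _ hb; simp [Pi.single_eq_of_ne hb]
  · simp

lemma isTorsionClass_fac [Module.Finite R X]
    (h : ∀ (Q : Type) [AddCommGroup Q] [Module R Q], Mem (Fac R (ModuleCat.of R X)) Q →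
      ExtZ R X Q) : IsTorsionClass R (Fac R (ModuleCat.of R X)) := by
  refine ⟨?_, ?_, ?_⟩
  · rintro Y ⟨n, f, hf⟩
    have : Module.Finite R (Fin n → (ModuleCat.of R X)) :=
      inferInstanceAs (Module.Finite R (Fin n → X))
    exact Module.Finite.of_surjective f hf
  · rintro Y ⟨n, f, hf⟩ Z g hg
    exact ⟨n, g ∘ₗ f, hg.comp hf⟩
  · rintro A B C a b hs hA ⟨n, f, hf⟩
    obtain ⟨u, hu⟩ := ((h A hA).pi_left (ι := Fin n)).lift hs f
    obtain ⟨m, g, hg⟩ := hA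
    refine mem_fac_of_finite (X := X) (ι := Fin n ⊕ Fin m)
      ((u.coprod (a ∘ₗ g)) ∘ₗ (LinearEquiv.sumArrowLequivProdArrow (Fin n) (Fin m) R X).toLinearMap)
      (Function.Surjective.comp (g := u.coprod (a ∘ₗ g)) ?_ (LinearEquiv.surjective _))
    intro y
    obtain ⟨x, hx⟩ := hf (b y)
    have h1 : b (u x) = f x := LinearMap.congr_fun hu x
    obtain ⟨z, hz⟩ := hs.exists_of_eq_zero (y := y - u x) (by rw [map_sub, h1, hx, sub_self])
    obtain ⟨w, rfl⟩ := hg z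
    refine ⟨(x, w), ?_⟩
    simp only [LinearMap.coprod_apply, LinearMap.comp_apply]
    rw [hz]; abel

lemma isFTorsionClass_fac [Module.Finite R X]
    (h : ∀ (Q : Type) [AddCommGroup Q] [Module R Q], Mem (Fac R (ModuleCat.of R X)) Q →
      ExtZ R X Q) : IsFTorsionClass R (Fac R (ModuleCat.of R X)) :=
  ⟨isTorsionClass_fac h, _, ‹_›, rfl⟩

end TorsionBasics

section OverField

variable (k : Type) {A : Type} [Field k] [Ring A] [Algebra k A]

/-- The vector space structure on a module over a `k`-algebra. -/
@[reducible] def kmod (A X : Type) [Ring A] [Algebra k A] [AddCommGroup X] [Module A X] :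
    Module k X := Module.compHom X (algebraMap k A)

lemma kmod_tower (A X : Type) [Ring A] [Algebra k A] [AddCommGroup X] [Module A X] :
    letI := kmod k A X
    IsScalarTower k A X :=
  letI := kmod k A X
  IsScalarTower.of_algebraMap_smul fun _ _ => rfl

lemma finite_hom (X Y : Type) [AddCommGroup X] [AddCommGroup Y] [Module A X] [Module A Y]
    [Module k X] [Module k Y] [IsScalarTower k A X] [IsScalarTower k A Y]
    [FiniteDimensional k X] [FiniteDimensional k Y] : FiniteDimensional k (X →ₗ[A] Y) :=
  FiniteDimensional.of_injective (LinearMap.restrictScalarsₗ k A X Y k)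
    (LinearMap.restrictScalars_injective k)

variable (X Y : Type) [AddCommGroup X] [Module A X] [AddCommGroup Y] [Module A Y]
  [FiniteDimensional k A]

include k

lemma exists_end_span [Module.Finite A X] : ∃ (n : ℕ) (m : Fin n → X), ∀ x : X,
    ∃ c : Fin n → (X →ₗ[A] X), x = ∑ i, c i (m i) := by
  let _ := kmod k A X
  have := kmod_tower k A X
  have : FiniteDimensional k X := Module.Finite.trans A X
  let b := Module.finBasis k X
  refine ⟨_, b, fun x => ⟨fun i => b.repr x i • LinearMap.id, ?_⟩⟩
  conv_lhs => rw [← b.sum_repr x]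
  rfl

lemma exists_hom_span [Module.Finite A X] [Module.Finite A Y] :
    ∃ (n : ℕ) (b : Fin n → (X →ₗ[A] Y)), ∀ f : X →ₗ[A] Y,
    ∃ c : Fin n → (X →ₗ[A] X), f = ∑ i, b i ∘ₗ c i := by
  let _ := kmod k A X
  have := kmod_tower k A X
  have : FiniteDimensional k X := Module.Finite.trans A X
  let _ := kmod k A Y
  have := kmod_tower k A Y
  have : FiniteDimensional k Y := Module.Finite.trans A Y
  have := finite_hom k (A := A) X Y
  let b := Module.finBasis k (X →ₗ[A] Y)
  refine ⟨_, b, fun f => ⟨fun i => b.repr f i • LinearMap.id, ?_⟩⟩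
  conv_lhs => rw [← b.sum_repr f]
  refine Finset.sum_congr rfl fun i _ => ?_
  rw [LinearMap.comp_smul, LinearMap.comp_id]

/-- A right approximation. -/
lemma exists_approx [Module.Finite A X] [Module.Finite A Y] :
    ∃ (n : ℕ) (p : (Fin n → X) →ₗ[A] Y), (∀ f : X →ₗ[A] Y, ∃ u : X →ₗ[A] (Fin n → X),
      p ∘ₗ u = f) := by
  obtain ⟨n, b, hb⟩ := exists_hom_span k (A := A) X Y
  refine ⟨n, ∑ i, b i ∘ₗ LinearMap.proj i, fun f => ?_⟩
  obtain ⟨c, rfl⟩ := hb f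
  refine ⟨LinearMap.pi c, LinearMap.ext fun x => ?_⟩
  simp [LinearMap.sum_apply]

end OverField

section Progenerator

variable {A : Type} [Ring A]

lemma exists_weak_generator [IsArtinianRing A] {T : Set (ModuleCat.{0} A)}
    (hT : IsTorsionClass A T) {X : ModuleCat.{0} A} (hX : Module.Finite A X) (hTX : T = Fac A X)
    (hend : ∃ (n : ℕ) (m : Fin n → X), ∀ x : X,
      ∃ c : Fin n → (X →ₗ[A] X), x = ∑ i, c i (m i)) :
    ∃ (M : ModuleCat.{0} A) (m₀ : M), M ∈ T ∧
      (∀ (Y : Type) [AddCommGroup Y] [Module A Y], Mem T Y → ∀ y : Y,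
        ∃ h : M →ₗ[A] Y, h m₀ = y) ∧
      ∀ u : M →ₗ[A] M, u m₀ = m₀ → Function.Bijective u := by
  obtain ⟨n, m, hm⟩ := hend
  have hXT : Mem T X := by rw [hTX]; exact mem_fac_self
  have hart : IsArtinian A (Fin n → X) := inferInstance
  obtain ⟨W, ⟨hmW, hWT⟩, hmin⟩ := WellFounded.has_min
    (wellFounded_lt (α := Submodule A (Fin n → X)))
    {W | m ∈ W ∧ Mem T W} ⟨⊤, Submodule.mem_top, hT.equiv (hT.pow hXT n) Submodule.topEquiv.symm⟩
  refine ⟨ModuleCat.of A W, ⟨m, hmW⟩, hWT, ?_, ?_⟩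
  · intro Y _ _ hY y
    rw [hTX] at hY
    obtain ⟨r, f, hf⟩ := hY
    obtain ⟨x, rfl⟩ := hf y
    choose c hc using hm
    let G : (Fin n → X) →ₗ[A] (Fin r → X) := LinearMap.pi fun j =>
      ∑ i, c (x j) i ∘ₗ LinearMap.proj i
    refine ⟨f ∘ₗ G ∘ₗ W.subtype, ?_⟩
    change f (G m) = f x
    congr 1
    funext j
    simp only [G, LinearMap.pi_apply, LinearMap.sum_apply, LinearMap.comp_apply,
      LinearMap.proj_apply]
    exact (hc (x j)).symm
  · intro u hu
    let W' : Submodule A (Fin n → X) := LinearMap.range (W.subtype ∘ₗ u)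
    have hle : W' ≤ W := by rintro _ ⟨w, rfl⟩; exact (u w).2
    have hW' : W' = W := by
      by_contra hne
      refine hmin W' ⟨⟨⟨m, hmW⟩, ?_⟩, hT.range hWT _⟩ (lt_of_le_of_ne hle hne)
      exact congrArg Subtype.val hu
    have hs : Function.Surjective u := by
      intro w
      have : (w : Fin n → X) ∈ W' := by rw [hW']; exact w.2
      obtain ⟨v, hv⟩ := this
      exact ⟨v, Subtype.ext hv⟩
    have : IsNoetherian A W := inferInstance
    exact IsNoetherian.bijective_of_surjective_endomorphism (M := W) u hs

/-- An `Ext`-projective generator of a functorially finite torsion class; it also generates the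
kernels of its approximations. -/
lemma exists_progenerator (k : Type) [Field k] [Algebra k A] [FiniteDimensional k A]
    {T : Set (ModuleCat.{0} A)} (hT : IsFTorsionClass A T) :
    ∃ N : ModuleCat.{0} A, N ∈ T ∧ T = Fac A N ∧
      (∀ (Y : Type) [AddCommGroup Y] [Module A Y], Mem T Y → ExtZ A N Y) ∧
      (∀ (Y : Type) [AddCommGroup Y] [Module A Y] (a : ℕ) (p : (Fin a → N) →ₗ[A] Y),
        (∀ f : N →ₗ[A] Y, ∃ u : N →ₗ[A] (Fin a → N), p ∘ₗ u = f) →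
        Mem T (LinearMap.ker p)) := by
  have : IsArtinianRing A := IsArtinianRing.of_finite k A
  obtain ⟨hT, X, hX, hTX⟩ := hT
  obtain ⟨M, m₀, hM, huniv, hbij⟩ :=
    exists_weak_generator hT hX hTX (exists_end_span k (A := A) X)
  have hE : ∀ (Y : Type) [AddCommGroup Y] [Module A Y], Mem T Y → ExtZ A M Y := by
    intro Y _ _ hY E _ _ i g hs
    have hET : Mem T E := hT.ext hs hY hM
    obtain ⟨e, he⟩ := hs.2.1 m₀
    obtain ⟨h, hh⟩ := huniv E hET e
    have hb := hbij (g ∘ₗ h) (by simp [hh, he])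
    refine ⟨h ∘ₗ (LinearEquiv.ofBijective (g ∘ₗ h) hb).symm.toLinearMap, ?_⟩
    ext x
    exact (LinearEquiv.ofBijective (g ∘ₗ h) hb).apply_symm_apply x
  let S : Submodule A M := Submodule.span A {m₀}
  have hS : ∀ {Y : Type} [AddCommGroup Y] [Module A Y] (f : M →ₗ[A] Y), f m₀ = 0 →
      ∃ u : M ⧸ S →ₗ[A] Y, u ∘ₗ S.mkQ = f := by
    intro Y _ _ f hf
    refine exists_factor_surj S.mkQ_surjective f fun e he => ?_
    have : e ∈ S := by simpa using he
    obtain ⟨a, rfl⟩ := Submodule.mem_span_singleton.1 this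
    rw [map_smul, hf, smul_zero]
  have hm₀ : S.mkQ m₀ = 0 := by
    rw [Submodule.mkQ_apply, Submodule.Quotient.mk_eq_zero]
    exact Submodule.mem_span_singleton_self m₀
  have hE1 : ∀ (Y : Type) [AddCommGroup Y] [Module A Y], Mem T Y → ExtZ A (M ⧸ S) Y := by
    intro Y _ _ hY E _ _ i g hs
    obtain ⟨s, hsl⟩ := (hE Y hY).lift hs S.mkQ
    have hsl' : ∀ x, g (s x) = S.mkQ x := fun x => LinearMap.congr_fun hsl x
    obtain ⟨y₀, hy₀⟩ := hs.exists_of_eq_zero (y := s m₀) (by rw [hsl', hm₀])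
    obtain ⟨y, hy⟩ := huniv Y hY y₀
    obtain ⟨u, hu⟩ := hS (s - i ∘ₗ y) (by simp [hy, hy₀])
    refine ⟨u, ?_⟩
    ext x
    have := LinearMap.congr_fun hu x
    simp only [LinearMap.comp_apply, LinearMap.sub_apply] at this ⊢
    rw [this, map_sub, hsl', hs.apply_eq_zero, sub_zero]
    rfl
  have hM1 : Mem T (M ⧸ S) := hT.quot hM S.mkQ S.mkQ_surjective
  have hN : Mem T (M × (M ⧸ S)) := hT.prod hM hM1
  have hTN : T = Fac A (ModuleCat.of A (M × (M ⧸ S))) := by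
    refine Set.Subset.antisymm ?_ (hT.fac_subset hN)
    intro Y hY
    have := hT.1 Y hY
    refine mem_fac_of_trace (X := M × (M ⧸ S)) (Y := Y) fun N hN y => ?_
    obtain ⟨h, rfl⟩ := huniv Y hY y
    exact hN (h ∘ₗ LinearMap.fst A M (M ⧸ S)) (m₀, 0)
  refine ⟨_, hN, hTN, fun Y _ _ hY => (hE Y hY).prod_left (hE1 Y hY), ?_⟩
  intro Y _ _ a p hp
  have hfin : Module.Finite A (M × (M ⧸ S)) := hT.finite hN
  have : IsNoetherian A (Fin a → (M × (M ⧸ S))) := inferInstance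
  have : Module.Finite A (LinearMap.ker p) :=
    Module.Finite.of_fg (IsNoetherian.noetherian (LinearMap.ker p))
  rw [hTN]
  refine mem_fac_of_trace fun D hD x => ?_
  obtain ⟨h, hh⟩ := huniv (Fin a → (M × (M ⧸ S))) (hT.pow hN a) x.1
  obtain ⟨w, hw⟩ := hS (p ∘ₗ h) (by
    rw [LinearMap.comp_apply, hh]; exact x.2)
  obtain ⟨u, hu⟩ := hp (w ∘ₗ LinearMap.snd A M (M ⧸ S))
  let v : M ⧸ S →ₗ[A] (Fin a → (M × (M ⧸ S))) := u ∘ₗ LinearMap.inr A M (M ⧸ S)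
  have hv : ∀ z, p (v z) = w z := fun z => LinearMap.congr_fun hu (0, z)
  let d : M →ₗ[A] LinearMap.ker p := (h - v ∘ₗ S.mkQ).codRestrict _ (fun z => by
    have := LinearMap.congr_fun hw z
    simp only [LinearMap.comp_apply] at this
    simp only [LinearMap.mem_ker, LinearMap.sub_apply, LinearMap.comp_apply, map_sub, hv, this,
      sub_self])
  have hd : d m₀ = x := by
    apply Subtype.ext
    change h m₀ - v (S.mkQ m₀) = x.1
    rw [hh, hm₀, map_zero, sub_zero]
  rw [← hd]
  exact hD (d ∘ₗ LinearMap.fst A M (M ⧸ S)) (m₀, 0)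

/-- A minimal cover by a direct summand. -/
lemma exists_min_cover {F K : Type} [AddCommGroup F] [Module A F] [AddCommGroup K] [Module A K]
    [IsArtinian A F] [IsNoetherian A F] (π : F →ₗ[A] K) (hπ : Function.Surjective π) :
    ∃ (P : Submodule A F) (r : F →ₗ[A] P), (∀ x : P, r x = x) ∧ (∀ y, ∃ x : P, π x = y) ∧
      ∀ h : P →ₗ[A] P, (∀ x : P, π (h x) = π x) → Function.Surjective h := by
  obtain ⟨P, ⟨⟨r, hr⟩, hP⟩, hmin⟩ := WellFounded.has_min
    (wellFounded_lt (α := Submodule A F))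
    {P | (∃ r : F →ₗ[A] P, ∀ x : P, r x = x) ∧ ∀ y, ∃ x : P, π x = y}
    ⟨⊤, ⟨Submodule.topEquiv.symm.toLinearMap, fun x => rfl⟩, fun y => by
      obtain ⟨x, hx⟩ := hπ y
      exact ⟨⟨x, trivial⟩, hx⟩⟩
  refine ⟨P, r, hr, hP, fun h hh => ?_⟩
  obtain ⟨n, hn1, hn⟩ := ((Filter.eventually_ge_atTop 1).and
    h.eventually_isCompl_ker_pow_range_pow).exists
  have hpow : ∀ (j : ℕ) (x : P), π ((h ^ j) x) = π x := by
    intro j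
    induction j with
    | zero => intro x; rfl
    | succ j ih => intro x; rw [pow_succ', Module.End.mul_apply, hh, ih]
  let Q : Submodule A P := LinearMap.range (h ^ n)
  let Q' : Submodule A F := Q.map P.subtype
  have hle : Q' ≤ P := Submodule.map_subtype_le _ _
  let e : Q ≃ₗ[A] Q' := Submodule.equivMapOfInjective P.subtype P.injective_subtype Q
  have he : ∀ z, (e z : F) = z.1.1 := fun z =>
    Submodule.coe_equivMapOfInjective_apply P.subtype P.injective_subtype Q z
  obtain ⟨ρ, hρ⟩ : ∃ ρ : P →ₗ[A] Q, ∀ x : Q, ρ x = x :=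
    ⟨Submodule.projectionOnto Q _ hn.symm, fun x =>
      Submodule.projectionOnto_apply_left hn.symm x⟩
  have hQ' : Q' = P := by
    by_contra hne
    refine hmin Q' ⟨⟨e.toLinearMap ∘ₗ ρ ∘ₗ r, fun x => ?_⟩, fun y => ?_⟩ (lt_of_le_of_ne hle hne)
    · obtain ⟨z, rfl⟩ := e.surjective x
      have h1 : r (e z : F) = z.1 := by rw [he]; exact hr z.1
      simp only [LinearMap.comp_apply, LinearEquiv.coe_coe]
      rw [h1, hρ]
    · obtain ⟨x, hx⟩ := hP y
      exact ⟨e ⟨(h ^ n) x, x, rfl⟩, by rw [he]; exact (hpow n x).trans hx⟩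
  intro x
  have : (x : F) ∈ Q' := by rw [hQ']; exact x.2
  obtain ⟨z, ⟨w, hw⟩, hz⟩ := this
  obtain ⟨m, rfl⟩ : ∃ m, n = m + 1 := ⟨n - 1, by omega⟩
  refine ⟨(h ^ m) w, ?_⟩
  rw [← Module.End.mul_apply, ← pow_succ', hw]
  exact Subtype.ext hz

lemma projective_of_retract {F : Type} [AddCommGroup F] [Module A F] [Module.Projective A F]
    (P : Submodule A F) (r : F →ₗ[A] P) (hr : ∀ x : P, r x = x) : Module.Projective A P :=
  Module.Projective.of_split P.subtype r (LinearMap.ext hr)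

/-- A presilting presentation of a functorially finite torsion class. -/
lemma exists_presentation (k : Type) [Field k] [Algebra k A] [FiniteDimensional k A]
    {T : Set (ModuleCat.{0} A)} (hT : IsFTorsionClass A T) :
    ∃ (m n : ℕ) (P : Submodule A (Fin m → A)) (r : (Fin m → A) →ₗ[A] P)
      (f : P →ₗ[A] (Fin n → A)), (∀ x : P, r x = x) ∧
      T = Fac A (ModuleCat.of A ((Fin n → A) ⧸ LinearMap.range f)) ∧
      ∀ (Y : Type) [AddCommGroup Y] [Module A Y], Mem T Y →
        ∀ u : P →ₗ[A] Y, ∃ v : (Fin n → A) →ₗ[A] Y, v ∘ₗ f = u := by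
  have : IsArtinianRing A := IsArtinianRing.of_finite k A
  obtain ⟨N, hN, hTN, hext, -⟩ := exists_progenerator k hT
  have hTt := hT.1
  have := hTt.finite hN
  obtain ⟨n, q, hq⟩ := Module.Finite.exists_fin' A N
  have : Module.Finite A (LinearMap.ker q) :=
    Module.Finite.of_fg (IsNoetherian.noetherian (LinearMap.ker q))
  obtain ⟨m, π, hπ⟩ := Module.Finite.exists_fin' A (LinearMap.ker q)
  obtain ⟨P, r, hr, hP, hmin⟩ := exists_min_cover π hπ
  have hproj := projective_of_retract P r hr
  let f : P →ₗ[A] (Fin n → A) := (LinearMap.ker q).subtype ∘ₗ π ∘ₗ P.subtype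
  have hf : LinearMap.range f = LinearMap.ker q := by
    refine le_antisymm ?_ ?_
    · rintro _ ⟨x, rfl⟩; exact (π x).2
    · intro x hx
      obtain ⟨p, hp⟩ := hP ⟨x, hx⟩
      exact ⟨p, congrArg Subtype.val hp⟩
  refine ⟨m, n, P, r, f, hr, ?_, ?_⟩
  · let e : ((Fin n → A) ⧸ LinearMap.range f) ≃ₗ[A] N :=
      (Submodule.quotEquivOfEq _ _ hf).trans (q.quotKerEquivOfSurjective hq)
    rw [hTN]
    exact Set.Subset.antisymm
      (fac_mono (mem_fac_of_surjective e.toLinearMap e.surjective))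
      (fac_mono (mem_fac_of_surjective e.symm.toLinearMap e.symm.surjective))
  · intro Y _ _ hY u
    let π' : P →ₗ[A] LinearMap.ker q := π ∘ₗ P.subtype
    have hπ' : Function.Surjective π' := hP
    let D : Submodule A Y := (LinearMap.ker π').map u
    have hY' : Mem T (Y ⧸ D) := hTt.quot hY D.mkQ D.mkQ_surjective
    obtain ⟨κ, hκ⟩ := exists_factor_surj hπ' (D.mkQ ∘ₗ u) (fun p hp => by
      simp only [LinearMap.comp_apply, Submodule.mkQ_apply, Submodule.Quotient.mk_eq_zero]
      exact ⟨p, hp, rfl⟩)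
    obtain ⟨w, hw⟩ := (hext _ hY').extend (isSES_ker hq) κ
    obtain ⟨v, hv⟩ := Module.projective_lifting_property D.mkQ w D.mkQ_surjective
    let u' : P →ₗ[A] Y := u - v ∘ₗ f
    have hu' : ∀ p, u' p ∈ D := by
      intro p
      have h1 : D.mkQ (v (f p)) = w (f p) := LinearMap.congr_fun hv _
      have h2 : w (f p) = κ (π' p) := hw (π' p)
      have h3 : κ (π' p) = D.mkQ (u p) := LinearMap.congr_fun hκ p
      rw [← D.ker_mkQ]
      simp only [LinearMap.mem_ker, u', LinearMap.sub_apply, LinearMap.comp_apply, map_sub]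
      rw [h1, h2, h3, sub_self]
    have hker : ∀ p, π' p = 0 → u' p = u p := by
      intro p hp
      have : f p = 0 := congrArg Subtype.val hp
      simp [u', this]
    have hsurj : Function.Surjective (π' ∘ₗ (LinearMap.ker u').subtype) := by
      intro y
      obtain ⟨p, rfl⟩ := hπ' y
      obtain ⟨l, hl, hlu⟩ := hu' p
      have hl : π' l = 0 := hl
      refine ⟨⟨p - l, ?_⟩, ?_⟩
      · rw [LinearMap.mem_ker, map_sub, hker l hl, hlu, sub_self]
      · change π' (p - l) = π' p
        rw [map_sub, hl, sub_zero]
    obtain ⟨h, hh⟩ := Module.projective_lifting_property _ π' hsurj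
    have hsur := hmin ((LinearMap.ker u').subtype ∘ₗ h) (fun x => LinearMap.congr_fun hh x)
    refine ⟨v, ?_⟩
    ext1 p
    obtain ⟨p, rfl⟩ := hsur p
    have : u' (h p).1 = 0 := (h p).2
    have := sub_eq_zero.1 this
    exact this.symm

end Progenerator

section Dimensions

variable {k : Type} [Field k]

lemma finrank_of_isSES {X Y Z : Type} [AddCommGroup X] [AddCommGroup Y] [AddCommGroup Z]
    [Module k X] [Module k Y] [Module k Z] [FiniteDimensional k Y]
    {f : X →ₗ[k] Y} {g : Y →ₗ[k] Z} (h : IsSES k f g) :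
    Module.finrank k Y = Module.finrank k X + Module.finrank k Z := by
  have h1 := LinearMap.finrank_range_add_finrank_ker g
  rw [← h.2.2, LinearMap.finrank_range_of_inj h.1, LinearMap.range_eq_top.2 h.2.1,
    finrank_top] at h1
  omega

variable {A : Type} [Ring A] [Algebra k A] {P Y Z : Type} [AddCommGroup P] [Module A P]
  [AddCommGroup Y] [Module A Y] [AddCommGroup Z] [Module A Z]
  [Module k Y] [IsScalarTower k A Y] [Module k Z] [IsScalarTower k A Z]

variable (k P) in
/-- Postcomposition as a `k`-linear map. -/
def homPost (g : Y →ₗ[A] Z) : (P →ₗ[A] Y) →ₗ[k] (P →ₗ[A] Z) where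
  toFun u := g ∘ₗ u
  map_add' _ _ := LinearMap.comp_add _ _ _
  map_smul' c u := by ext x; exact LinearMap.map_smul_of_tower g c (u x)

variable (k Y) in
/-- Precomposition as a `k`-linear map. -/
def homPre {Q : Type} [AddCommGroup Q] [Module A Q] (g : P →ₗ[A] Q) :
    (Q →ₗ[A] Y) →ₗ[k] (P →ₗ[A] Y) where
  toFun u := u ∘ₗ g
  map_add' _ _ := rfl
  map_smul' _ _ := rfl

lemma isSES_homPost {X : Type} [AddCommGroup X] [Module A X] [Module k X] [IsScalarTower k A X]
    {f : X →ₗ[A] Y} {g : Y →ₗ[A] Z} (h : IsSES A f g)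
    (hP : ∀ u : P →ₗ[A] Z, ∃ v : P →ₗ[A] Y, g ∘ₗ v = u) :
    IsSES k (homPost k P f) (homPost k P g) := by
  refine isSES_mk ?_ hP ?_ ?_
  · intro u v huv
    ext x
    exact h.1 (LinearMap.congr_fun huv x)
  · intro u
    ext x
    exact h.apply_eq_zero _
  · intro u hu
    obtain ⟨v, hv⟩ := exists_factor_inj h.1 u
      (fun x => h.exists_of_eq_zero (LinearMap.congr_fun hu x))
    exact ⟨v, hv⟩

lemma isSES_homPre {X W : Type} [AddCommGroup X] [Module A X] [AddCommGroup W] [Module A W]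
    {f : X →ₗ[A] P} {g : P →ₗ[A] W} (h : IsSES A f g)
    (hY : ∀ u : X →ₗ[A] Y, ∃ v : P →ₗ[A] Y, v ∘ₗ f = u) :
    IsSES k (homPre k Y g) (homPre k Y f) := by
  refine isSES_mk ?_ hY ?_ ?_
  · intro u v huv
    ext x
    obtain ⟨p, rfl⟩ := h.2.1 x
    exact LinearMap.congr_fun huv p
  · intro u
    ext x
    exact (congrArg u (h.apply_eq_zero x)).trans (map_zero u)
  · intro u hu
    obtain ⟨v, hv⟩ := exists_factor_surj h.2.1 u (fun x hx => by
      obtain ⟨y, rfl⟩ := h.exists_of_eq_zero hx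
      exact LinearMap.congr_fun hu y)
    exact ⟨v, hv⟩

variable (k) in
/-- The dimension of a space of homomorphisms. -/
def dimHom (A P Y : Type) [Ring A] [Algebra k A] [AddCommGroup P] [Module A P]
    [AddCommGroup Y] [Module A Y] : ℕ :=
  letI := kmod k A Y
  haveI := kmod_tower k A Y
  Module.finrank k (P →ₗ[A] Y)

end Dimensions

section Weights

variable {A : Type} [Ring A]

/-- A function on modules which is additive on short exact sequences of finite modules. -/
def IsAdditive (ℓ : ModuleCat.{0} A → ℤ) : Prop :=
  ∀ (X Y Z : Type) [AddCommGroup X] [Module A X] [AddCommGroup Y] [Module A Y]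
    [AddCommGroup Z] [Module A Z] (f : X →ₗ[A] Y) (g : Y →ₗ[A] Z), IsSES A f g →
    Module.Finite A Y → ℓ (ModuleCat.of A Y) = ℓ (ModuleCat.of A X) + ℓ (ModuleCat.of A Z)

lemma IsAdditive.subsingleton {ℓ : ModuleCat.{0} A → ℤ} (h : IsAdditive ℓ) (X : Type)
    [AddCommGroup X] [Module A X] [Subsingleton X] : ℓ (ModuleCat.of A X) = 0 := by
  have := h X X X 0 0 (isSES_mk (Function.injective_of_subsingleton _)
    (Function.surjective_to_subsingleton _) (fun _ => rfl) (fun y _ => ⟨0, Subsingleton.elim _ _⟩))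
    inferInstance
  omega

lemma IsAdditive.equiv {ℓ : ModuleCat.{0} A → ℤ} (h : IsAdditive ℓ) {X Y : Type}
    [AddCommGroup X] [Module A X] [AddCommGroup Y] [Module A Y] [Module.Finite A Y]
    (e : X ≃ₗ[A] Y) : ℓ (ModuleCat.of A X) = ℓ (ModuleCat.of A Y) := by
  have := h X Y PUnit e.toLinearMap 0 (isSES_mk e.injective
    (Function.surjective_to_subsingleton _) (fun _ => rfl) (fun y _ => e.surjective y))
    inferInstance
  rw [h.subsingleton PUnit] at this
  omega

lemma IsAdditive.prod {ℓ : ModuleCat.{0} A → ℤ} (h : IsAdditive ℓ) (X Y : Type)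
    [AddCommGroup X] [Module A X] [AddCommGroup Y] [Module A Y] [Module.Finite A Y]
    [Module.Finite A X] :
    ℓ (ModuleCat.of A (X × Y)) = ℓ (ModuleCat.of A X) + ℓ (ModuleCat.of A Y) :=
  h _ _ _ _ _ isSES_prod inferInstance

lemma finite_induction [IsArtinianRing A] {motive : ∀ (M : Type) [AddCommGroup M] [Module A M], Prop}
    (h0 : ∀ (M : Type) [AddCommGroup M] [Module A M] [Subsingleton M], motive M)
    (h1 : ∀ (M : Type) [AddCommGroup M] [Module A M] [Module.Finite A M] (N : Submodule A M)
      [IsSimpleModule A (M ⧸ N)], motive N → motive M)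
    (M : Type) [AddCommGroup M] [Module A M] [Module.Finite A M] : motive M := by
  have hl : IsFiniteLength A M := isFiniteLength_iff_isNoetherian_isArtinian.2
    ⟨inferInstance, inferInstance⟩
  induction hl with
  | of_subsingleton => exact h0 _
  | @of_simple_quotient M _ _ N _ hN ih =>
    have hM : IsFiniteLength A M := .of_simple_quotient hN
    have := (isFiniteLength_iff_isNoetherian_isArtinian.1 hM).1
    exact h1 M N ih

lemma IsAdditive.nonneg [IsArtinianRing A] {ℓ : ModuleCat.{0} A → ℤ} (h : IsAdditive ℓ)
    (hs : ∀ (S : Type) [AddCommGroup S] [Module A S], IsSimpleModule A S →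
      0 ≤ ℓ (ModuleCat.of A S))
    (M : Type) [AddCommGroup M] [Module A M] [Module.Finite A M] :
    0 ≤ ℓ (ModuleCat.of A M) := by
  refine finite_induction (A := A) (motive := fun M _ _ => 0 ≤ ℓ (ModuleCat.of A M)) ?_ ?_ M
  · intro M _ _ _
    rw [h.subsingleton]
  · intro M _ _ _ N _ ih
    rw [h _ _ _ _ _ (isSES_mkQ N) inferInstance]
    exact add_nonneg ih (hs _ inferInstance)

lemma IsTorsionClass.eq_all [IsArtinianRing A] {C : Set (ModuleCat.{0} A)}
    (hC : IsTorsionClass A C) (h0 : C.Nonempty)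
    (hs : ∀ (S : Type) [AddCommGroup S] [Module A S], IsSimpleModule A S → Mem C S)
    (M : Type) [AddCommGroup M] [Module A M] [Module.Finite A M] : Mem C M := by
  refine finite_induction (A := A) (motive := fun M _ _ => Mem C M) ?_ ?_ M
  · intro M _ _ _
    exact hC.subsingleton h0
  · intro M _ _ _ N _ ih
    exact hC.ext (isSES_mkQ N) ih (hs _ inferInstance)

variable (k : Type) [Field k] [Algebra k A] [FiniteDimensional k A]

include k in
lemma exists_weight {T : Set (ModuleCat.{0} A)} (hT : IsFTorsionClass A T) :
    ∃ ℓ : ModuleCat.{0} A → ℤ, IsAdditive ℓ ∧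
      (∀ (Y : Type) [AddCommGroup Y] [Module A Y] [Nontrivial Y], Mem T Y →
        0 < ℓ (ModuleCat.of A Y)) ∧
      (∀ (Y : Type) [AddCommGroup Y] [Module A Y], Module.Finite A Y →
        (∀ (X : Type) [AddCommGroup X] [Module A X], Mem T X → ∀ f : X →ₗ[A] Y, f = 0) →
        ℓ (ModuleCat.of A Y) ≤ 0) := by
  obtain ⟨m, n, P, r, f, hr, hTf, hpre⟩ := exists_presentation k hT
  have hproj := projective_of_retract P r hr
  have : IsArtinianRing A := IsArtinianRing.of_finite k A
  have hfinP : Module.Finite A P := Module.Finite.of_fg (IsNoetherian.noetherian P)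
  have hdim : ∀ (Q : Type) [AddCommGroup Q] [Module A Q] [Module.Finite A Q] (Y : Type)
      [AddCommGroup Y] [Module A Y] [Module k Y] [IsScalarTower k A Y] [FiniteDimensional k Y],
      FiniteDimensional k (Q →ₗ[A] Y) := by
    intro Q _ _ _ Y _ _ _ _ _
    let _ := kmod k A Q
    have := kmod_tower k A Q
    have : FiniteDimensional k Q := Module.Finite.trans A Q
    exact finite_hom k (A := A) Q Y
  refine ⟨fun Y => dimHom k A (Fin n → A) Y - dimHom k A P Y, ?_, ?_, ?_⟩
  · intro X Y Z _ _ _ _ _ _ a b hs hY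
    let _ := kmod k A X
    have := kmod_tower k A X
    let _ := kmod k A Y
    have := kmod_tower k A Y
    let _ := kmod k A Z
    have := kmod_tower k A Z
    have : FiniteDimensional k Y := Module.Finite.trans A Y
    have h1 := finrank_of_isSES (isSES_homPost (k := k) (P := Fin n → A) hs
      (fun u => Module.projective_lifting_property b u hs.2.1))
    have h2 := finrank_of_isSES (isSES_homPost (k := k) (P := P) hs
      (fun u => Module.projective_lifting_property b u hs.2.1))
    change ((Module.finrank k ((Fin n → A) →ₗ[A] Y) : ℕ) : ℤ) -
      (Module.finrank k (P →ₗ[A] Y) : ℕ) =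
      ((Module.finrank k ((Fin n → A) →ₗ[A] X) : ℕ) : ℤ) -
      (Module.finrank k (P →ₗ[A] X) : ℕ) + (((Module.finrank k ((Fin n → A) →ₗ[A] Z) : ℕ) : ℤ) -
      (Module.finrank k (P →ₗ[A] Z) : ℕ))
    rw [h1, h2]; push_cast; ring
  · intro Y _ _ _ hY
    have hfY := hT.1.finite hY
    let _ := kmod k A Y
    have := kmod_tower k A Y
    have : FiniteDimensional k Y := Module.Finite.trans A Y
    have hsurj : Function.Surjective (homPre k Y f) := hpre Y hY
    have h1 := LinearMap.finrank_range_add_finrank_ker (homPre k Y f)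
    rw [LinearMap.range_eq_top.2 hsurj, finrank_top] at h1
    have hpos : 0 < Module.finrank k (LinearMap.ker (homPre k Y f)) := by
      rw [Module.finrank_pos_iff]
      by_contra hsub
      rw [not_nontrivial_iff_subsingleton] at hsub
      rw [hTf] at hY
      obtain ⟨a, g, hg⟩ := hY
      have : g = 0 := by
        refine LinearMap.pi_ext' fun i => ?_
        have h0 : (g ∘ₗ LinearMap.single A (fun _ => (Fin n → A) ⧸ LinearMap.range f) i) ∘ₗ
            (LinearMap.range f).mkQ = 0 := by
          have hmem : (g ∘ₗ LinearMap.single A (fun _ => (Fin n → A) ⧸ LinearMap.range f) i) ∘ₗ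
            (LinearMap.range f).mkQ ∈ LinearMap.ker (homPre k Y f) := by
            ext1 x
            have : (LinearMap.range f).mkQ (f x) = 0 := by simp
            change (g ∘ₗ LinearMap.single A _ i) ((LinearMap.range f).mkQ (f x)) = 0
            rw [this, map_zero]
          exact congrArg Subtype.val (Subsingleton.elim (α := LinearMap.ker (homPre k Y f))
            ⟨_, hmem⟩ 0)
        refine LinearMap.ext fun x => ?_
        obtain ⟨x, rfl⟩ := (LinearMap.range f).mkQ_surjective x
        exact LinearMap.congr_fun h0 x
      obtain ⟨y, hy⟩ := exists_ne (0 : Y)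
      obtain ⟨x, hx⟩ := hg y
      rw [this] at hx
      exact hy hx.symm
    change (0 : ℤ) < (Module.finrank k ((Fin n → A) →ₗ[A] Y) : ℕ) -
      (Module.finrank k (P →ₗ[A] Y) : ℕ)
    omega
  · intro Y _ _ hfY hY
    let _ := kmod k A Y
    have := kmod_tower k A Y
    have : FiniteDimensional k Y := Module.Finite.trans A Y
    have hinj : Function.Injective (homPre k Y f) := by
      rw [← LinearMap.ker_eq_bot, LinearMap.ker_eq_bot']
      intro u hu
      obtain ⟨v, hv⟩ := exists_factor_surj (LinearMap.range f).mkQ_surjective u (fun x hx => by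
        obtain ⟨p, rfl⟩ : x ∈ LinearMap.range f := by simpa using hx
        exact LinearMap.congr_fun hu p)
      rw [← hv, hY _ (by rw [hTf]; exact mem_fac_self) v, LinearMap.zero_comp]
    have := LinearMap.finrank_le_finrank_of_injective hinj
    change (Module.finrank k ((Fin n → A) →ₗ[A] Y) : ℤ) -
      (Module.finrank k (P →ₗ[A] Y) : ℕ) ≤ 0
    omega

end Weights

section PosetLemmas

variable {P : Type*} [PartialOrder P]

lemma isMeetOf_of_isGLB {S : Set P} {m : P} (h : IsGLB S m) : IsMeetOf S m :=
  ⟨⟨h.1, fun _ hy hmy => le_antisymm (h.2 hy) hmy⟩, fun _ hy => (hy.2 m h.1 (h.2 hy.1)).symm⟩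

lemma isJoinOf_of_isLUB {S : Set P} {m : P} (h : IsLUB S m) : IsJoinOf S m :=
  ⟨⟨h.1, fun _ hy hmy => le_antisymm hmy (h.2 hy)⟩, fun _ hy => (hy.2 m h.1 (h.2 hy.1)).symm⟩

lemma isMeetSemilatticePoset_of_pairs (htop : ∃ t : P, ∀ x, x ≤ t)
    (h : ∀ a b : P, ∃ m, IsGLB {a, b} m) : IsMeetSemilatticePoset P := by
  intro S hS
  suffices ∃ m, IsGLB S m from this.imp fun m hm => isMeetOf_of_isGLB hm
  induction S, hS using Set.Finite.induction_on with
  | empty =>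
    obtain ⟨t, ht⟩ := htop
    exact ⟨t, by simp, fun y _ => ht y⟩
  | insert _ _ ih =>
    rename_i a S _ _
    obtain ⟨m, hm⟩ := ih
    obtain ⟨m', hm'⟩ := h a m
    refine ⟨m', ?_, fun y hy => hm'.2 ?_⟩
    · rintro x (rfl | hx)
      · exact hm'.1 (by simp)
      · exact (hm'.1 (show m ∈ {a, m} by simp)).trans (hm.1 hx)
    · rintro x (rfl | rfl)
      · exact hy (by simp)
      · exact hm.2 fun z hz => hy (Or.inr hz)

lemma isJoinSemilatticePoset_of_pairs (hbot : ∃ t : P, ∀ x, t ≤ x)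
    (h : ∀ a b : P, ∃ m, IsLUB {a, b} m) : IsJoinSemilatticePoset P := by
  intro S hS
  suffices ∃ m, IsLUB S m from this.imp fun m hm => isJoinOf_of_isLUB hm
  induction S, hS using Set.Finite.induction_on with
  | empty =>
    obtain ⟨t, ht⟩ := hbot
    exact ⟨t, by simp, fun y _ => ht y⟩
  | insert _ _ ih =>
    rename_i a S _ _
    obtain ⟨m, hm⟩ := ih
    obtain ⟨m', hm'⟩ := h a m
    refine ⟨m', ?_, fun y hy => hm'.2 ?_⟩
    · rintro x (rfl | hx)
      · exact hm'.1 (by simp)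
      · exact (hm.1 hx).trans (hm'.1 (show m ∈ {a, m} by simp))
    · rintro x (rfl | rfl)
      · exact hy (by simp)
      · exact hm.2 fun z hz => hy (Or.inr hz)

end PosetLemmas

section RankTwo

variable {A : Type} [Ring A]

lemma isFTorsionClass_zero : IsFTorsionClass A (Fac A (ModuleCat.of A PUnit)) :=
  isFTorsionClass_fac fun _ _ _ _ => extZ_of_projective

lemma isFTorsionClass_top : IsFTorsionClass A (Fac A (ModuleCat.of A A)) :=
  isFTorsionClass_fac fun _ _ _ _ => extZ_of_projective

lemma mem_top_of_finite (M : Type) [AddCommGroup M] [Module A M] [Module.Finite A M] :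
    Mem (Fac A (ModuleCat.of A A)) M := by
  obtain ⟨n, q, hq⟩ := Module.Finite.exists_fin' A M
  exact ⟨n, q, hq⟩

lemma IsFTorsionClass.nonempty {T : Set (ModuleCat.{0} A)} (hT : IsFTorsionClass A T) :
    T.Nonempty := by
  obtain ⟨-, X, -, rfl⟩ := hT
  exact ⟨X, mem_fac_self⟩

lemma subsingleton_of_mem_zero {M : Type} [AddCommGroup M] [Module A M]
    (h : Mem (Fac A (ModuleCat.of A PUnit)) M) : Subsingleton M := by
  obtain ⟨n, f, hf⟩ := h
  have : Subsingleton (Fin n → PUnit) := inferInstance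
  exact hf.subsingleton

lemma mem_zero_of_subsingleton {M : Type} [AddCommGroup M] [Module A M] [Subsingleton M] :
    Mem (Fac A (ModuleCat.of A PUnit)) M :=
  mem_fac_of_surjective 0 (Function.surjective_to_subsingleton _)

lemma exists_simple_quotient (M : Type) [AddCommGroup M] [Module A M] [Module.Finite A M]
    [Nontrivial M] : ∃ N : Submodule A M, IsSimpleModule A (M ⧸ N) := by
  obtain ⟨N, hN⟩ := IsCoatomic.exists_coatom (α := Submodule A M)
  exact ⟨N, isSimpleModule_iff_isCoatom.2 hN⟩

/-- Torsion classes containing the same single simple module are comparable. -/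
lemma comparable_of_simple (k : Type) [Field k] [Algebra k A] [FiniteDimensional k A]
    {T U : Set (ModuleCat.{0} A)} (hT : IsFTorsionClass A T) (hU : IsFTorsionClass A U)
    {S₁ S₂ : Type} [AddCommGroup S₁] [Module A S₁] [AddCommGroup S₂] [Module A S₂]
    [IsSimpleModule A S₁] [IsSimpleModule A S₂]
    (hS : ∀ (X : Type) [AddCommGroup X] [Module A X], IsSimpleModule A X →
      Nonempty (X ≃ₗ[A] S₁) ∨ Nonempty (X ≃ₗ[A] S₂))
    (hT1 : Mem T S₁) (hU1 : Mem U S₁) : T ⊆ U ∨ U ⊆ T := by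
  have : IsArtinianRing A := IsArtinianRing.of_finite k A
  obtain ⟨a, ha, hapos, hanonpos⟩ := exists_weight k hT
  obtain ⟨b, hb, hbpos, hbnonpos⟩ := exists_weight k hU
  have : Nontrivial S₁ := IsSimpleModule.nontrivial A S₁
  have ha1 := hapos S₁ hT1
  have hb1 := hbpos S₁ hU1
  have key : ∀ (c : ℤ) (V W : Set (ModuleCat.{0} A)) (v w : ModuleCat.{0} A → ℤ),
      IsFTorsionClass A V → IsFTorsionClass A W → IsAdditive v → IsAdditive w →
      (∀ (Y : Type) [AddCommGroup Y] [Module A Y], Module.Finite A Y →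
        (∀ (X : Type) [AddCommGroup X] [Module A X], Mem V X → ∀ f : X →ₗ[A] Y, f = 0) →
        v (ModuleCat.of A Y) ≤ 0) →
      (∀ (Y : Type) [AddCommGroup Y] [Module A Y] [Nontrivial Y], Mem W Y →
        0 < w (ModuleCat.of A Y)) →
      0 < v (ModuleCat.of A S₁) → 0 < w (ModuleCat.of A S₁) →
      0 ≤ w (ModuleCat.of A S₁) * v (ModuleCat.of A S₂) -
        v (ModuleCat.of A S₁) * w (ModuleCat.of A S₂) → W ⊆ V := by
    intro c V W v w hV hW hv hw hvn hwp hv1 hw1 h2 Y hY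
    have hfY : Module.Finite A Y := hW.1.1 Y hY
    obtain ⟨N, hN, hN0⟩ := hV.1.exists_radical hV.nonempty Y
    rcases subsingleton_or_nontrivial (Y ⧸ N) with hsub | hnt
    · have : N = ⊤ := Submodule.Quotient.subsingleton_iff.1 hsub
      subst this
      exact hV.1.equiv hN Submodule.topEquiv
    · exfalso
      have h3 := hvn (Y ⧸ N) inferInstance hN0
      have h4 := hwp (Y ⧸ N) (hW.1.quot hY N.mkQ N.mkQ_surjective)
      have hadd : IsAdditive (fun Y => w (ModuleCat.of A S₁) * v Y - v (ModuleCat.of A S₁) * w Y) := by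
        intro X Y Z _ _ _ _ _ _ f g hs hf
        simp only [hv X Y Z f g hs hf, hw X Y Z f g hs hf]
        ring
      have h5 := hadd.nonneg (fun S _ _ hSs => by
        rcases hS S hSs with ⟨⟨e⟩⟩ | ⟨⟨e⟩⟩
        · rw [hadd.equiv e]
          show (0:ℤ) ≤ w _ * v _ - v _ * w _
          rw [mul_comm, sub_self]
        · rw [hadd.equiv e]
          exact h2) (Y ⧸ N)
      nlinarith
  rcases le_total 0 (b (ModuleCat.of A S₁) * a (ModuleCat.of A S₂) -
        a (ModuleCat.of A S₁) * b (ModuleCat.of A S₂)) with h | h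
  · exact Or.inr (key 0 T U a b hT hU ha hb hanonpos hbpos ha1 hb1 h)
  · exact Or.inl (key 0 U T b a hU hT hb ha hbnonpos hapos hb1 ha1 (by linarith))

lemma comparable_or (k : Type) [Field k] [Algebra k A] [FiniteDimensional k A]
    (S₁ S₂ : ModuleCat.{0} A) (hS : ∀ X : ModuleCat.{0} A, IsSimpleModule A ↥X →
         (Nonempty (↥X ≃ₗ[A] ↥S₁) ∨ Nonempty (↥X ≃ₗ[A] ↥S₂)))
    {T U : Set (ModuleCat.{0} A)} (hT : IsFTorsionClass A T) (hU : IsFTorsionClass A U) :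
    (T ⊆ U ∨ U ⊆ T) ∨ ((∀ M, M ∈ T → M ∈ U → Subsingleton M) ∧
      ∀ C, IsTorsionClass A C → T ⊆ C → U ⊆ C → ∀ M : ModuleCat.{0} A, Module.Finite A M →
        M ∈ C) := by
  have : IsArtinianRing A := IsArtinianRing.of_finite k A
  have hS' : ∀ (X : Type) [AddCommGroup X] [Module A X], IsSimpleModule A X →
      Nonempty (X ≃ₗ[A] S₁) ∨ Nonempty (X ≃ₗ[A] S₂) := fun X _ _ h => hS (ModuleCat.of A X) h
  have hsimp : ∀ {V : Set (ModuleCat.{0} A)}, IsFTorsionClass A V → ∀ M, M ∈ V →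
      Nontrivial M → ∃ S : ModuleCat.{0} A, IsSimpleModule A S ∧ S ∈ V := by
    intro V hV M hM hnt
    have := hV.1.1 M hM
    obtain ⟨N, hN⟩ := exists_simple_quotient (A := A) M
    exact ⟨ModuleCat.of A (M ⧸ N), hN, hV.1.quot hM N.mkQ N.mkQ_surjective⟩
  by_contra hcon
  push Not at hcon
  obtain ⟨⟨hTU, hUT⟩, hcon⟩ := hcon
  have hex : ∀ {V W : Set (ModuleCat.{0} A)}, IsFTorsionClass A V → IsFTorsionClass A W →
      ¬ V ⊆ W → ∃ S : ModuleCat.{0} A, IsSimpleModule A S ∧ S ∈ V := by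
    intro V W hV hW hVW
    obtain ⟨M, hM, hMW⟩ := Set.not_subset.1 hVW
    refine hsimp hV M hM ?_
    rw [← not_subsingleton_iff_nontrivial]
    intro hsub
    exact hMW (hW.1.subsingleton hW.nonempty (X := M))
  -- a common simple module makes the two classes comparable
  have hcommon : ∀ S : ModuleCat.{0} A, IsSimpleModule A S → S ∈ T → S ∈ U → False := by
    intro S hSs hST hSU
    by_cases h2 : ∃ S' : ModuleCat.{0} A, IsSimpleModule A S' ∧ ¬ Nonempty (S' ≃ₗ[A] S)
    · obtain ⟨S', hS's, hne⟩ := h2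
      have hpair : ∀ (X : Type) [AddCommGroup X] [Module A X], IsSimpleModule A X →
          Nonempty (X ≃ₗ[A] S) ∨ Nonempty (X ≃ₗ[A] S') := by
        intro X _ _ hX
        rcases hS' S hSs with ⟨⟨e⟩⟩ | ⟨⟨e⟩⟩ <;> rcases hS' S' hS's with ⟨⟨e'⟩⟩ | ⟨⟨e'⟩⟩ <;>
          rcases hS' X hX with ⟨⟨e''⟩⟩ | ⟨⟨e''⟩⟩
        all_goals first
          | exact Or.inl ⟨e''.trans e.symm⟩
          | exact Or.inr ⟨e''.trans e'.symm⟩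
          | exact (hne ⟨e'.trans e.symm⟩).elim
      rcases comparable_of_simple k hT hU hpair hST hSU with h | h
      · exact hTU h
      · exact hUT h
    · push Not at h2
      have hpair : ∀ (X : Type) [AddCommGroup X] [Module A X], IsSimpleModule A X →
          Nonempty (X ≃ₗ[A] S) ∨ Nonempty (X ≃ₗ[A] S) :=
        fun X _ _ hX => Or.inl (h2 (ModuleCat.of A X) hX)
      rcases comparable_of_simple k hT hU hpair hST hSU with h | h
      · exact hTU h
      · exact hUT h
  have hcap : ∀ M ∈ T, M ∈ U → Subsingleton M := by
    intro M hMT hMU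
    by_contra hns
    rw [not_subsingleton_iff_nontrivial] at hns
    have := hT.1.1 M hMT
    obtain ⟨N, hN⟩ := exists_simple_quotient (A := A) M
    exact hcommon (ModuleCat.of A (M ⧸ N)) hN (hT.1.quot hMT N.mkQ N.mkQ_surjective)
      (hU.1.quot hMU N.mkQ N.mkQ_surjective)
  obtain ⟨C, hC, hTC, hUC, M, hfM, hMC⟩ := hcon hcap
  obtain ⟨X, hXs, hXT⟩ := hex hT hU hTU
  obtain ⟨Y, hYs, hYU⟩ := hex hU hT hUT
  refine hMC (hC.eq_all (hT.nonempty.mono hTC) (fun S _ _ hSs => ?_) M)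
  have hXY : ¬ Nonempty (X ≃ₗ[A] Y) := fun ⟨e⟩ =>
    hcommon Y hYs (hT.1.equiv (X := X) (Y := Y) hXT e) hYU
  have h1 : ∀ e : S ≃ₗ[A] X, Mem C S := fun e => hC.equiv (X := X) (hTC hXT) e.symm
  have h2 : ∀ e : S ≃ₗ[A] Y, Mem C S := fun e => hC.equiv (X := Y) (hUC hYU) e.symm
  rcases hS' X hXs with ⟨⟨e⟩⟩ | ⟨⟨e⟩⟩ <;> rcases hS' Y hYs with ⟨⟨e'⟩⟩ | ⟨⟨e'⟩⟩ <;>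
          rcases hS' S hSs with ⟨⟨e''⟩⟩ | ⟨⟨e''⟩⟩
  all_goals first
    | exact h1 (e''.trans e.symm)
    | exact h2 (e''.trans e'.symm)
    | exact (hXY ⟨e.trans e'.symm⟩).elim

/-- The functorially finite torsion classes of an algebra with at most two simple modules form a
lattice. -/
theorem isLatticePoset_of_two_simples (k : Type) [Field k] [Algebra k A] [FiniteDimensional k A]
    (S₁ S₂ : ModuleCat.{0} A) (hS : ∀ X : ModuleCat.{0} A, IsSimpleModule A ↥X →
         (Nonempty (↥X ≃ₗ[A] ↥S₁) ∨ Nonempty (↥X ≃ₗ[A] ↥S₂))) :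
    IsLatticePoset (FTors A) := by
  let t : FTors A := ⟨_, isFTorsionClass_top⟩
  let z : FTors A := ⟨_, isFTorsionClass_zero⟩
  have ht : ∀ x : FTors A, x ≤ t := fun x M hM => by
    have := x.2.1.1 M hM
    exact mem_top_of_finite M
  have hz : ∀ x : FTors A, z ≤ x := fun x M hM => by
    have : Subsingleton M := subsingleton_of_mem_zero hM
    exact x.2.1.subsingleton x.2.nonempty (X := M)
  refine ⟨isJoinSemilatticePoset_of_pairs ⟨z, hz⟩ fun a b => ?_,
    isMeetSemilatticePoset_of_pairs ⟨t, ht⟩ fun a b => ?_⟩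
  · rcases comparable_or k S₁ S₂ hS a.2 b.2 with (h | h) | ⟨h1, h2⟩
    · refine ⟨b, ?_, fun y hy => hy (by simp)⟩
      rintro x (rfl | rfl)
      exacts [h, le_rfl]
    · refine ⟨a, ?_, fun y hy => hy (by simp)⟩
      rintro x (rfl | rfl)
      exacts [le_rfl, h]
    · refine ⟨t, fun x _ => ht x, fun y hy M hM => ?_⟩
      exact h2 y.1 y.2.1 (hy (show a ∈ {a, b} by simp)) (hy (show b ∈ {a, b} by simp)) M
        (t.2.1.1 M hM)
  · rcases comparable_or k S₁ S₂ hS a.2 b.2 with (h | h) | ⟨h1, h2⟩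
    · refine ⟨a, ?_, fun y hy => hy (by simp)⟩
      rintro x (rfl | rfl)
      exacts [le_rfl, h]
    · refine ⟨b, ?_, fun y hy => hy (by simp)⟩
      rintro x (rfl | rfl)
      exacts [h, le_rfl]
    · refine ⟨z, fun x _ => hz x, fun y hy M hM => ?_⟩
      have := h1 M (hy (show a ∈ {a, b} by simp) hM) (hy (show b ∈ {a, b} by simp) hM)
      exact mem_zero_of_subsingleton

end RankTwo

section MaximalBelow

lemma simple_equiv_of_idempotent {R : Type} [Ring R] [IsArtinianRing R] {S S' : Type}
    [AddCommGroup S] [Module R S] [AddCommGroup S'] [Module R S'] [IsSimpleModule R S]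
    [IsSimpleModule R S']
    (h : ∀ f : R, f * f = f → (∀ s : S, f • s = 0) → ∀ s : S', f • s = 0) :
    Nonempty (S' ≃ₗ[R] S) := by
  have : Nontrivial S' := IsSimpleModule.nontrivial R S'
  obtain ⟨s₀, hs₀⟩ := exists_ne (0 : S')
  have hπ : Function.Surjective (LinearMap.toSpanSingleton R S' s₀) :=
    IsSimpleModule.toSpanSingleton_surjective R hs₀
  obtain ⟨P, r, hr, hsurj, hend⟩ := exists_min_cover (LinearMap.toSpanSingleton R S' s₀) hπ
  set f : R := (r 1 : R) with hf
  have hPf : ∀ x : P, (x : R) * f = x := by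
    intro x
    have h1 := hr x
    have h2 : (x : R) = (x : R) • (1 : R) := by simp
    rw [h2, map_smul] at h1
    simpa [hf] using congrArg Subtype.val h1
  have hff : f * f = f := hPf (r 1)
  have hP : Module.Projective R P := projective_of_retract P r hr
  obtain ⟨s, hs⟩ : ∃ s : S, f • s ≠ 0 := by
    by_contra hcon
    push Not at hcon
    obtain ⟨x, hx⟩ := hsurj s₀
    refine hs₀ ?_
    rw [← hx, ← hPf x]
    have := h f hff hcon s₀
    simp [mul_smul, this]
  let π : P →ₗ[R] S' := LinearMap.toSpanSingleton R S' s₀ ∘ₗ P.subtype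
  have hπs : Function.Surjective π := hsurj
  let g : P →ₗ[R] S := LinearMap.toSpanSingleton R S s ∘ₗ P.subtype
  have hg : g (r 1) ≠ 0 := hs
  have hker : ∀ x, g x = 0 → π x = 0 := by
    by_contra hcon
    push Not at hcon
    obtain ⟨x, hx1, hx2⟩ := hcon
    have h1 : Function.Surjective (π ∘ₗ (LinearMap.ker g).subtype) := by
      refine LinearMap.surjective_of_ne_zero fun h0 => hx2 ?_
      exact congrArg (fun φ => φ ⟨x, hx1⟩) h0
    obtain ⟨l, hl⟩ := Module.projective_lifting_property _ π h1
    have h2 := hend ((LinearMap.ker g).subtype ∘ₗ l) (fun x => congrArg (fun φ => φ x) hl)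
    obtain ⟨y, hy⟩ := h2 (r 1)
    exact hg (by rw [← hy]; exact (l y).2)
  have hgs : Function.Surjective g :=
    LinearMap.surjective_of_ne_zero fun h0 => hg (by rw [h0]; rfl)
  obtain ⟨u, hu⟩ := exists_factor_surj hgs π hker
  have hu0 : u ≠ 0 := by
    rintro rfl
    obtain ⟨x, hx⟩ := hπs s₀
    exact hs₀ (by rw [← hx, ← hu]; rfl)
  exact ⟨(LinearEquiv.ofBijective u (LinearMap.bijective_of_ne_zero hu0)).symm⟩

variable {A : Type} [Ring A] (N : Type) [AddCommGroup N] [Module A N]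

/-- The submodule of `N` generated by the images of the endomorphisms in a right ideal. -/
def idealTrace (I : Submodule (Module.End A N)ᵐᵒᵖ (Module.End A N)ᵐᵒᵖ) : Submodule A N :=
  Submodule.span A {y | ∃ e : Module.End A N, MulOpposite.op e ∈ I ∧ ∃ x, e x = y}

variable {N}

lemma mem_idealTrace {I : Submodule (Module.End A N)ᵐᵒᵖ (Module.End A N)ᵐᵒᵖ}
    {e : Module.End A N} (he : MulOpposite.op e ∈ I) (x : N) : e x ∈ idealTrace N I :=
  Submodule.subset_span ⟨e, he, x, rfl⟩

lemma idealTrace_le {I : Submodule (Module.End A N)ᵐᵒᵖ (Module.End A N)ᵐᵒᵖ}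
    {L : Submodule A N} (h : ∀ e : Module.End A N, MulOpposite.op e ∈ I → ∀ x, e x ∈ L) :
    idealTrace N I ≤ L := by
  refine Submodule.span_le.2 ?_
  rintro _ ⟨e, he, x, rfl⟩
  exact h e he x

lemma isArtinianRing_endOp (k : Type) [Field k] [Algebra k A] [FiniteDimensional k A]
    [Module.Finite A N] : IsArtinianRing (Module.End A N)ᵐᵒᵖ ∧
      IsNoetherianRing (Module.End A N)ᵐᵒᵖ := by
  let _ := kmod k A N
  have := kmod_tower k A N
  have : FiniteDimensional k N := Module.Finite.trans A N
  have : FiniteDimensional k (Module.End A N) := finite_hom k (A := A) N N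
  have : FiniteDimensional k (Module.End A N)ᵐᵒᵖ :=
    Module.Finite.equiv (MulOpposite.opLinearEquiv k)
  have : IsArtinianRing (Module.End A N)ᵐᵒᵖ := IsArtinianRing.of_finite k _
  exact ⟨this, inferInstanceAs (IsNoetherianRing (Module.End A N)ᵐᵒᵖ)⟩

lemma exists_maximal_ideal (k : Type) [Field k] [Algebra k A] [FiniteDimensional k A]
    [Module.Finite A N] {J : Set (ModuleCat.{0} A)} (hJ : IsTorsionClass A J)
    (h0 : J.Nonempty) (hN : ¬ Mem J N) :
    ∃ I : Submodule (Module.End A N)ᵐᵒᵖ (Module.End A N)ᵐᵒᵖ,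
      IsSimpleModule (Module.End A N)ᵐᵒᵖ ((Module.End A N)ᵐᵒᵖ ⧸ I) ∧
      ¬ Mem J (N ⧸ idealTrace N I) := by
  obtain ⟨_, _⟩ := isArtinianRing_endOp (A := A) (N := N) k
  by_contra hcon
  push Not at hcon
  have hall : ∀ I : Submodule (Module.End A N)ᵐᵒᵖ (Module.End A N)ᵐᵒᵖ,
      Mem J (N ⧸ idealTrace N I) := by
    intro I
    induction I using WellFoundedGT.induction with
    | ind I ih =>
    by_cases hI : I = ⊤
    · have : Subsingleton (N ⧸ idealTrace N I) := by
        rw [Submodule.Quotient.subsingleton_iff, eq_top_iff]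
        intro x _
        exact mem_idealTrace (e := LinearMap.id) (by rw [hI]; trivial) x
      exact hJ.subsingleton h0
    · obtain ⟨I', hI'⟩ := exists_covBy_of_wellFoundedLT (a := I) (by
        rwa [isMax_iff_eq_top])
      obtain ⟨e, he', he⟩ := SetLike.exists_of_lt hI'.1
      have hsimp : IsSimpleModule (Module.End A N)ᵐᵒᵖ (I' ⧸ I.submoduleOf I') :=
        (covBy_iff_quot_is_simple hI'.1.le).1 hI'
      let ε : I' ⧸ I.submoduleOf I' := Submodule.Quotient.mk ⟨e, he'⟩
      have hε : ε ≠ 0 := by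
        rw [Ne, Submodule.Quotient.mk_eq_zero]
        exact he
      have hmax := IsSimpleModule.ker_toSpanSingleton_isMaximal (Module.End A N)ᵐᵒᵖ hε
      set K := LinearMap.ker (LinearMap.toSpanSingleton (Module.End A N)ᵐᵒᵖ _ ε) with hK
      have hKmem : ∀ x, x ∈ K → x * e ∈ I := by
        intro x hx
        have h1 : x • ε = 0 := hx
        rw [← Submodule.Quotient.mk_smul, Submodule.Quotient.mk_eq_zero] at h1
        exact h1
      have hKJ := hcon K (isSimpleModule_iff_isCoatom.2 hmax.out)
      let e₀ : N →ₗ[A] N := MulOpposite.unop e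
      have hle : idealTrace N K ≤ (idealTrace N I).comap e₀ := by
        refine idealTrace_le fun x hx y => ?_
        exact mem_idealTrace (e := e₀ ∘ₗ x) (hKmem _ hx) y
      let φ : (N ⧸ idealTrace N K) →ₗ[A] (N ⧸ idealTrace N I) :=
        Submodule.mapQ _ _ e₀ hle
      have hII' : idealTrace N I ≤ idealTrace N I' :=
        idealTrace_le fun x hx y => mem_idealTrace (hI'.1.le hx) y
      let ψ : (N ⧸ idealTrace N I) →ₗ[A] (N ⧸ idealTrace N I') := Submodule.factor hII'
      have hspan : ∀ x ∈ I', ∃ y : (Module.End A N)ᵐᵒᵖ, x - y * e ∈ I := by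
        intro x hx
        obtain ⟨y, hy⟩ := IsSimpleModule.toSpanSingleton_surjective (Module.End A N)ᵐᵒᵖ hε
          (Submodule.Quotient.mk ⟨x, hx⟩)
        refine ⟨y, ?_⟩
        rw [LinearMap.toSpanSingleton_apply, ← Submodule.Quotient.mk_smul] at hy
        have := (Submodule.Quotient.eq _).1 hy.symm
        exact this
      have hker : ∀ y, ψ y = 0 → ∃ x, φ x = y := by
        intro y hy
        obtain ⟨y, rfl⟩ := Submodule.Quotient.mk_surjective _ y
        have hy' : y ∈ idealTrace N I' := (Submodule.Quotient.mk_eq_zero _).1 hy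
        have hle' : idealTrace N I' ≤ (LinearMap.range φ).comap (idealTrace N I).mkQ := by
          refine idealTrace_le fun x hx z => ?_
          obtain ⟨u, hu⟩ := hspan _ hx
          let u₀ : N →ₗ[A] N := MulOpposite.unop u
          refine ⟨Submodule.Quotient.mk (u₀ z), ?_⟩
          have h1 := mem_idealTrace (e := x - e₀ ∘ₗ u₀) hu z
          have : (idealTrace N I).mkQ (x z - e₀ (u₀ z)) = 0 :=
            (Submodule.Quotient.mk_eq_zero _).2 h1
          rw [map_sub, sub_eq_zero] at this
          exact this.symm
        exact hle' hy'
      have hses : IsSES A (LinearMap.range φ).subtype ψ := by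
        refine isSES_mk Subtype.val_injective (Submodule.factor_surjective _) ?_ ?_
        · rintro ⟨_, x, rfl⟩
          obtain ⟨x, rfl⟩ := Submodule.Quotient.mk_surjective _ x
          exact (Submodule.Quotient.mk_eq_zero _).2 (mem_idealTrace (e := e₀) he' x)
        · intro y hy
          exact ⟨⟨y, hker y hy⟩, rfl⟩
      exact hJ.ext hses (hJ.range hKJ φ) (ih I' hI'.1)
  have hbot := hall ⊥
  refine hN (hJ.equiv hbot (Submodule.quotEquivOfEqBot _ ?_))
  rw [eq_bot_iff]
  refine idealTrace_le fun e he x => ?_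
  have : e = 0 := MulOpposite.op_injective he
  rw [this]
  exact zero_mem _

/-- Precomposition makes `Hom(N, Y)` a right module over the endomorphism ring of `N`. -/
@[reducible] def homOpModule (N Y : Type) [AddCommGroup N] [Module A N] [AddCommGroup Y]
    [Module A Y] : Module (Module.End A N)ᵐᵒᵖ (N →ₗ[A] Y) where
  smul c f := f ∘ₗ c.unop
  one_smul _ := rfl
  mul_smul _ _ _ := rfl
  smul_zero _ := rfl
  smul_add _ _ _ := rfl
  add_smul _ _ f := LinearMap.comp_add _ _ f
  zero_smul f := LinearMap.comp_zero f

theorem exists_fTorsionClass_between (k : Type) [Field k] [Algebra k A] [FiniteDimensional k A]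
    {T J : Set (ModuleCat.{0} A)} (hT : IsFTorsionClass A T) (hJ : IsTorsionClass A J)
    (h0 : J.Nonempty) (hJT : J ⊆ T) (hne : J ≠ T) :
    ∃ T' : Set (ModuleCat.{0} A), IsFTorsionClass A T' ∧ J ⊆ T' ∧ T' ⊆ T ∧ T' ≠ T := by
  obtain ⟨N, hNT, hTN, hExt, happ⟩ := exists_progenerator k hT
  have hfN : Module.Finite A N := hT.1.1 N hNT
  have hNJ : ¬ Mem J N := fun h => hne (hJT.antisymm (by
    rw [hTN]; exact hJ.fac_subset (X := N) h))
  obtain ⟨I, hI, hB⟩ := exists_maximal_ideal k hJ h0 hNJ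
  obtain ⟨_, _⟩ := isArtinianRing_endOp (A := A) (N := N) k
  have : IsArtinianRing A := IsArtinianRing.of_finite k A
  let _ := kmod k A N
  have := kmod_tower k A N
  have : FiniteDimensional k N := Module.Finite.trans A N
  have : FiniteDimensional k (Module.End A N) := finite_hom k (A := A) N N
  -- the idempotents annihilating the simple module given by `I`
  let 𝔑 : Set (Module.End A N) :=
    {f | f * f = f ∧ ∀ e : Module.End A N, MulOpposite.op (e * f) ∈ I}
  let 𝔘 : Set (Module.End A N) := {g | ∃ a b f, f ∈ 𝔑 ∧ g = a * f * b}
  obtain ⟨s, hs, hspan⟩ := (Submodule.fg_span_iff_fg_span_finset_subset (R := k) 𝔘).1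
    (IsNoetherian.noetherian _)
  choose a b f hf hg using fun x : s => hs x.2
  let F : s → Type := fun x => LinearMap.range (f x)
  have hff : ∀ x (y : LinearMap.range (f x)), f x y = y := by
    rintro x ⟨_, y, rfl⟩
    exact congrArg (fun φ => φ y) (hf x).1
  have hzero : ∀ (Y : Type) [AddCommGroup Y] [Module A Y],
      (∀ x : s, ∀ h : LinearMap.range (f x) →ₗ[A] Y, h = 0) →
      ∀ h : N →ₗ[A] Y, ∀ g ∈ 𝔑, h ∘ₗ g = 0 := by
    intro Y _ _ hY h g hgN
    have hmem : g ∈ Submodule.span k (s : Set (Module.End A N)) := by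
      rw [← hspan]
      exact Submodule.subset_span ⟨1, 1, g, hgN, by simp⟩
    clear hgN
    induction hmem using Submodule.span_induction with
    | mem x hx =>
      have h1 := hY ⟨x, hx⟩ (h ∘ₗ a ⟨x, hx⟩ ∘ₗ (LinearMap.range (f ⟨x, hx⟩)).subtype)
      have h2 := hg ⟨x, hx⟩
      ext y
      have h3 := congrArg (fun φ => φ ⟨f ⟨x, hx⟩ (b ⟨x, hx⟩ y), _, rfl⟩) h1
      have h4 : x y = a ⟨x, hx⟩ (f ⟨x, hx⟩ (b ⟨x, hx⟩ y)) := congrArg (fun φ => φ y) h2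
      rw [LinearMap.comp_apply, h4]
      exact h3
    | zero => exact LinearMap.comp_zero h
    | add x y _ _ hx hy => rw [LinearMap.comp_add, hx, hy, add_zero]
    | smul c x _ hx =>
      ext y
      have h1 : h (x (algebraMap k A c • y)) = 0 := congrArg (fun φ => φ (algebraMap k A c • y)) hx
      rw [map_smul] at h1
      exact h1
  let N' : Type := ∀ x, F x
  let α : N' →ₗ[A] (s → N) := LinearMap.pi fun x => (LinearMap.range (f x)).subtype ∘ₗ
    LinearMap.proj x
  let β : (s → N) →ₗ[A] N' := LinearMap.pi fun x => (f x).rangeRestrict ∘ₗ LinearMap.proj x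
  have hβα : ∀ z, β (α z) = z := fun z => funext fun x => Subtype.ext (hff x (z x))
  have hN'T : Mem T N' := by
    rw [hTN]
    exact mem_fac_of_finite β fun z => ⟨_, hβα z⟩
  have hfN' : Module.Finite A N' := hT.1.finite hN'T
  have hle : Fac A (ModuleCat.of A N') ⊆ T := hT.1.fac_subset hN'T
  have hT' : IsFTorsionClass A (Fac A (ModuleCat.of A N')) :=
    isFTorsionClass_fac fun Q _ _ hQ => ((hExt Q (hle hQ)).pi_left (ι := s)).retract_left α β hβα
  refine ⟨_, hT', ?_, hle, ?_⟩
  · intro Y hY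
    have hfY : Module.Finite A Y := hJ.1 Y hY
    obtain ⟨L, hL, hL0⟩ := hT'.1.exists_radical ⟨_, mem_fac_self⟩ Y
    by_cases hsub : L = ⊤
    · subst hsub
      exact hT'.1.equiv hL Submodule.topEquiv
    exfalso
    have hYJ : Mem J (Y ⧸ L) := hJ.quot hY L.mkQ L.mkQ_surjective
    have hYT : Mem T (Y ⧸ L) := hJT hYJ
    let _ := homOpModule (A := A) N (Y ⧸ L)
    have hkill : ∀ h : N →ₗ[A] Y ⧸ L, ∀ g ∈ 𝔑, h ∘ₗ g = 0 := by
      refine hzero _ fun x h => ?_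
      have h1 := hL0 N' mem_fac_self (h ∘ₗ LinearMap.proj x)
      ext y
      classical
      have h2 : h ((Pi.single x y : N') x) = 0 := congrArg (fun φ => φ (Pi.single x y)) h1
      rwa [Pi.single_eq_same] at h2
    have hgen : ∃ (n : ℕ) (p : (Fin n → N) →ₗ[A] Y ⧸ L), Function.Surjective p := by
      rw [hTN] at hYT
      exact hYT
    have hnt : Nontrivial (N →ₗ[A] Y ⧸ L) := by
      by_contra hcon
      rw [not_nontrivial_iff_subsingleton] at hcon
      obtain ⟨n, p, hp⟩ := hgen
      apply hsub
      rw [← Submodule.Quotient.subsingleton_iff]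
      have hp0 : p = 0 := LinearMap.pi_ext' fun i => Subsingleton.elim _ _
      refine ⟨fun y z => ?_⟩
      obtain ⟨y, rfl⟩ := hp y
      obtain ⟨z, rfl⟩ := hp z
      rw [hp0]
      rfl
    have hfH : Module.Finite (Module.End A N)ᵐᵒᵖ (N →ₗ[A] Y ⧸ L) := by
      obtain ⟨n, c, hc⟩ := exists_hom_span k (A := A) N (Y ⧸ L)
      refine Module.Finite.of_surjective (M := Fin n → (Module.End A N)ᵐᵒᵖ)
        (Fintype.linearCombination _ c) fun h => ?_
      obtain ⟨d, hd⟩ := hc h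
      exact ⟨fun i => MulOpposite.op (d i), hd.symm⟩
    obtain ⟨M, hM⟩ := exists_simple_quotient (A := (Module.End A N)ᵐᵒᵖ) (N →ₗ[A] Y ⧸ L)
    obtain ⟨e⟩ := simple_equiv_of_idempotent (R := (Module.End A N)ᵐᵒᵖ)
      (S := (Module.End A N)ᵐᵒᵖ ⧸ I) (S' := (N →ₗ[A] Y ⧸ L) ⧸ M) (by
        intro g hgg hg0 z
        obtain ⟨h, rfl⟩ := Submodule.Quotient.mk_surjective _ z
        rw [← Submodule.Quotient.mk_smul]
        have : g.unop ∈ 𝔑 := by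
          refine ⟨congrArg MulOpposite.unop hgg, fun e => ?_⟩
          have h1 := hg0 (Submodule.Quotient.mk (MulOpposite.op e))
          rw [← Submodule.Quotient.mk_smul, Submodule.Quotient.mk_eq_zero] at h1
          exact h1
        have h2 : g • h = 0 := hkill h _ this
        rw [h2, Submodule.Quotient.mk_zero])
    let ψ : (N →ₗ[A] Y ⧸ L) →ₗ[(Module.End A N)ᵐᵒᵖ] ((Module.End A N)ᵐᵒᵖ ⧸ I) :=
      e.toLinearMap ∘ₗ M.mkQ
    have hψ : Function.Surjective ψ := e.surjective.comp M.mkQ_surjective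
    obtain ⟨n, p, hp⟩ := exists_approx k (A := A) N (Y ⧸ L)
    have hps : Function.Surjective p := by
      obtain ⟨m, q, hq⟩ := hgen
      choose u hu using fun i => hp (q ∘ₗ LinearMap.single A (fun _ => N) i)
      intro y
      obtain ⟨z, rfl⟩ := hq y
      refine ⟨∑ i, u i (z i), ?_⟩
      rw [map_sum]
      have h1 : ∀ i, p (u i (z i)) = q (Pi.single i (z i)) := fun i =>
        congrArg (fun φ => φ (z i)) (hu i)
      rw [Finset.sum_congr rfl fun i _ => h1 i, ← map_sum, Finset.univ_sum_single]
    have hK := happ (Y ⧸ L) n p hp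
    let pc : Fin n → (N →ₗ[A] Y ⧸ L) := fun i => p ∘ₗ LinearMap.single A (fun _ => N) i
    choose σ hσ using fun i => Submodule.Quotient.mk_surjective I (ψ (pc i))
    let θ : (Fin n → N) →ₗ[A] N := ∑ i, (σ i).unop ∘ₗ LinearMap.proj i
    have hpu : ∀ u : N →ₗ[A] (Fin n → N),
        ψ (p ∘ₗ u) = Submodule.Quotient.mk (MulOpposite.op (θ ∘ₗ u)) := by
      intro u
      have h1 : p ∘ₗ u = ∑ i, MulOpposite.op (LinearMap.proj i ∘ₗ u : Module.End A N) • pc i := by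
        ext x
        rw [LinearMap.sum_apply]
        show p (u x) = ∑ i, p (Pi.single i (u x i))
        rw [← map_sum, Finset.univ_sum_single]
      rw [h1, map_sum]
      simp only [map_smul, ← hσ, ← Submodule.Quotient.mk_smul]
      change ∑ i, I.mkQ (MulOpposite.op (LinearMap.proj i ∘ₗ u : Module.End A N) • σ i) = I.mkQ _
      rw [← map_sum]
      congr 1
      apply MulOpposite.unop_injective
      ext x
      simp [θ, LinearMap.sum_apply]
    let Θ := (idealTrace N I).mkQ ∘ₗ θ
    have hΘ : ∀ z, p z = 0 → Θ z = 0 := by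
      rw [hTN] at hK
      obtain ⟨m, q, hq⟩ := hK
      intro z hz
      obtain ⟨w, hw⟩ := hq ⟨z, hz⟩
      have h0 : Θ ∘ₗ (LinearMap.ker p).subtype ∘ₗ q = 0 := by
        refine LinearMap.pi_ext' fun i => ?_
        have h1 := hpu ((LinearMap.ker p).subtype ∘ₗ q ∘ₗ LinearMap.single A (fun _ => N) i)
        have h2 : p ∘ₗ ((LinearMap.ker p).subtype ∘ₗ q ∘ₗ LinearMap.single A (fun _ => N) i)
          = 0 := LinearMap.ext fun x => (q _).2
        rw [h2, map_zero, eq_comm, Submodule.Quotient.mk_eq_zero] at h1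
        ext x
        exact (Submodule.Quotient.mk_eq_zero _).2 (mem_idealTrace h1 x)
      have h1 := congrArg (fun φ => φ w) h0
      simpa [hw] using h1
    obtain ⟨t, ht⟩ := exists_factor_surj hps Θ hΘ
    refine hB (hJ.quot hYJ t fun x => ?_)
    obtain ⟨x, rfl⟩ := Submodule.Quotient.mk_surjective _ x
    obtain ⟨h, hh⟩ := hψ (Submodule.Quotient.mk 1)
    obtain ⟨u, rfl⟩ := hp h
    rw [hpu] at hh
    have h1 := mem_idealTrace (e := θ ∘ₗ u - 1) ((Submodule.Quotient.eq _).1 hh) x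
    refine ⟨p (u x), ?_⟩
    rw [← LinearMap.comp_apply t p, ht]
    exact (Submodule.Quotient.eq _).2 h1
  · intro heq
    have hNF : Mem (Fac A (ModuleCat.of A N')) N := by rw [heq]; exact hNT
    have hBF : Mem (Fac A (ModuleCat.of A N')) (N ⧸ idealTrace N I) :=
      hT'.1.quot hNF (idealTrace N I).mkQ (Submodule.mkQ_surjective _)
    have hItr : Mem T (idealTrace N I) := by
      rw [hTN]
      refine mem_fac_of_trace (X := N) fun L hL => ?_
      have h1 : idealTrace N I ≤ L.map (idealTrace N I).subtype := by
        refine idealTrace_le fun e he x => ?_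
        exact ⟨⟨e x, mem_idealTrace he x⟩,
          hL (LinearMap.codRestrict _ e fun x => mem_idealTrace he x) x, rfl⟩
      rintro ⟨y, hy⟩
      obtain ⟨z, hz, hzy⟩ := h1 hy
      have : z = ⟨y, hy⟩ := Subtype.ext hzy
      rwa [← this]
    have hnull : ∀ x : s, ∀ h : LinearMap.range (f x) →ₗ[A] N ⧸ idealTrace N I, h = 0 := by
      intro x h
      obtain ⟨e, he⟩ := (hExt _ hItr).lift (isSES_mkQ (idealTrace N I))
        (h ∘ₗ (f x).rangeRestrict)
      ext ⟨_, y, rfl⟩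
      have h1 : (idealTrace N I).mkQ (e (f x y)) = h ⟨f x (f x y), _, rfl⟩ :=
        congrArg (fun φ => φ (f x y)) he
      have h2 : f x (f x y) = f x y := congrArg (fun φ => φ y) (hf x).1
      have h3 : (idealTrace N I).mkQ (e (f x y)) = 0 :=
        (Submodule.Quotient.mk_eq_zero _).2 (mem_idealTrace ((hf x).2 e) y)
      rw [h3] at h1
      rw [LinearMap.zero_apply, h1]
      congr 1
      exact Subtype.ext h2.symm
    obtain ⟨n, q, hq⟩ := hBF
    classical
    have hq0 : q = 0 := LinearMap.pi_ext' fun i => LinearMap.pi_ext' fun x => hnull x _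
    have : Subsingleton (N ⧸ idealTrace N I) := by
      refine ⟨fun y z => ?_⟩
      obtain ⟨y, rfl⟩ := hq y
      obtain ⟨z, rfl⟩ := hq z
      rw [hq0]
      rfl
    exact hB (hJ.subsingleton h0)

end MaximalBelow

section JoinCriterion

variable {A : Type} [Ring A] {V₁ V₂ W₁ W₂ : Type} [AddCommGroup V₁] [Module A V₁]
  [AddCommGroup V₂] [Module A V₂] [AddCommGroup W₁] [Module A W₁] [AddCommGroup W₂] [Module A W₂]

lemma isTorsionClass_inter {C : Set (ModuleCat.{0} A)} (hC : IsTorsionClass A C) (W : Type)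
    [AddCommGroup W] [Module A W] :
    IsTorsionClass A {X | X ∈ C ∧ ∀ f : X →ₗ[A] W, f = 0} := by
  refine ⟨fun X hX => hC.1 X hX.1, fun X hX Y g hg => ⟨hC.2.1 X hX.1 Y g hg, fun f => ?_⟩,
    fun X Y Z i g hs hX hZ => ⟨hC.2.2 X Y Z i g hs hX.1 hZ.1, fun f => ?_⟩⟩
  · ext y
    obtain ⟨x, rfl⟩ := hg y
    exact congrArg (fun φ => φ x) (hX.2 (f ∘ₗ g))
  · obtain ⟨u, hu⟩ := exists_factor_surj hs.2.1 f fun y hy => by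
      obtain ⟨x, rfl⟩ := hs.exists_of_eq_zero hy
      exact congrArg (fun φ => φ x) (hX.2 (f ∘ₗ i))
    rw [← hu, hZ.2 u, LinearMap.zero_comp]

theorem not_isJoinSemilatticePoset (k : Type) [Field k] [Algebra k A] [FiniteDimensional k A]
    [Nontrivial V₁] [Module.Finite A V₁] [Module.Finite A V₂] [Module.Finite A W₁]
    [Module.Finite A W₂]
    (h1 : ∀ (Q : Type) [AddCommGroup Q] [Module A Q], Mem (Fac A (ModuleCat.of A V₁)) Q →
      ExtZ A V₁ Q)
    (h2 : ∀ (Q : Type) [AddCommGroup Q] [Module A Q], Mem (Fac A (ModuleCat.of A V₂)) Q →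
      ExtZ A V₂ Q)
    (h11 : ∀ f : V₁ →ₗ[A] W₁, f = 0) (h12 : ∀ f : V₁ →ₗ[A] W₂, f = 0)
    (h21 : ∀ f : V₂ →ₗ[A] W₁, f = 0) (h22 : ∀ f : V₂ →ₗ[A] W₂, f = 0)
    (hℓ : ∀ ℓ : ModuleCat.{0} A → ℤ, IsAdditive ℓ →
      ℓ (ModuleCat.of A V₁) + ℓ (ModuleCat.of A V₂) =
        ℓ (ModuleCat.of A W₁) + ℓ (ModuleCat.of A W₂)) :
    ¬ IsJoinSemilatticePoset (FTors A) := by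
  intro hjoin
  let F₁ : FTors A := ⟨_, isFTorsionClass_fac h1⟩
  let F₂ : FTors A := ⟨_, isFTorsionClass_fac h2⟩
  obtain ⟨m, ⟨hmub, hmin⟩, -⟩ := hjoin {F₁, F₂} (Set.toFinite _)
  have hm1 : Mem m.1 V₁ := (hmub (show F₁ ∈ _ by simp)) (mem_fac_self (X := V₁))
  have hm2 : Mem m.1 V₂ := (hmub (show F₂ ∈ _ by simp)) (mem_fac_self (X := V₂))
  have hJ := isTorsionClass_inter (isTorsionClass_inter m.2.1 W₁) W₂
  set J : Set (ModuleCat.{0} A) := {X | X ∈ {X | X ∈ m.1 ∧ ∀ f : X →ₗ[A] W₁, f = 0} ∧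
    ∀ f : X →ₗ[A] W₂, f = 0} with hJdef
  have hJ1 : Mem J V₁ := ⟨⟨hm1, h11⟩, h12⟩
  have hJ2 : Mem J V₂ := ⟨⟨hm2, h21⟩, h22⟩
  by_cases hJm : J = m.1
  · obtain ⟨ℓ, hadd, hpos, hneg⟩ := exists_weight k m.2
    have e1 := hpos V₁ hm1
    have e2 : 0 ≤ ℓ (ModuleCat.of A V₂) := by
      rcases subsingleton_or_nontrivial V₂ with h | h
      · exact (hadd.subsingleton V₂).ge
      · exact (hpos V₂ hm2).le
    have e3 := hneg W₁ inferInstance fun X _ _ hX => (hJm ▸ hX : Mem J X).1.2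
    have e4 := hneg W₂ inferInstance fun X _ _ hX => (hJm ▸ hX : Mem J X).2
    have := hℓ ℓ hadd
    omega
  · obtain ⟨T', hT', hJT', hT'm, hne⟩ := exists_fTorsionClass_between k m.2 hJ ⟨_, hJ1⟩
      (fun X hX => hX.1.1) hJm
    refine hne (congrArg Subtype.val (hmin ⟨T', hT'⟩ ?_ hT'm))
    rintro x (rfl | rfl)
    · exact (hJ.fac_subset hJ1).trans hJT'
    · exact (hJ.fac_subset hJ2).trans hJT'

end JoinCriterion

section Duality

variable (k : Type) [Field k] {A B : Type} [Ring A] [Ring B] [Algebra k A] [Algebra k B]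

/-- Mutually inverse anti-isomorphisms of `k`-algebras. -/
structure IsAntiIso (s : A → B) (t : B → A) : Prop where
  add : ∀ x y, s (x + y) = s x + s y
  mul : ∀ x y, s (x * y) = s y * s x
  alg : ∀ c, s (algebraMap k A c) = algebraMap k B c
  left : ∀ x, t (s x) = x
  right : ∀ y, s (t y) = y

variable {k} {s : A → B} {t : B → A}

lemma IsAntiIso.symm (h : IsAntiIso k s t) : IsAntiIso k t s where
  add x y := by rw [← h.right x, ← h.right y, ← h.add, h.left, h.left, h.left]
  mul x y := by rw [← h.right x, ← h.right y, ← h.mul, h.left, h.left, h.left]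
  alg c := by rw [← h.alg, h.left]
  left := h.right
  right := h.left

lemma IsAntiIso.one (h : IsAntiIso k s t) : s 1 = 1 := by
  simpa using h.alg 1

lemma IsAntiIso.zero (h : IsAntiIso k s t) : s 0 = 0 := by
  simpa using h.alg 0

lemma IsAntiIso.sum (h : IsAntiIso k s t) {ι : Type} (S : Finset ι) (f : ι → A) :
    s (∑ i ∈ S, f i) = ∑ i ∈ S, s (f i) :=
  map_sum (AddMonoidHom.mk ⟨s, h.zero⟩ h.add) f S

variable (k) in
/-- A balanced `k`-bilinear pairing between an `A`-module and a `B`-module. -/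
structure IsPairing (s : A → B) {X V : Type} [AddCommGroup X] [Module A X] [AddCommGroup V]
    [Module B V] (β : X → V → k) : Prop where
  add_left : ∀ x y v, β (x + y) v = β x v + β y v
  add_right : ∀ x v w, β x (v + w) = β x v + β x w
  smul : ∀ (c : k) x v, β (algebraMap k A c • x) v = c * β x v
  balanced : ∀ a x v, β (a • x) v = β x (s a • v)

variable (k) in
/-- All pairings between `X` and `V` vanish. -/
def Orth (s : A → B) (X V : Type) [AddCommGroup X] [Module A X] [AddCommGroup V]
    [Module B V] : Prop := ∀ β : X → V → k, IsPairing k s β → ∀ x v, β x v = 0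

variable {X Y V W : Type} [AddCommGroup X] [Module A X] [AddCommGroup V] [Module B V]
  [AddCommGroup Y] [Module A Y] [AddCommGroup W] [Module B W]

lemma IsPairing.swap (h : IsAntiIso k s t) {β : X → V → k} (hβ : IsPairing k s β) :
    IsPairing k t fun v x => β x v where
  add_left v w x := hβ.add_right x v w
  add_right v x y := hβ.add_left x y v
  smul c v x := by rw [← h.alg, ← hβ.balanced, hβ.smul]
  balanced b v x := by rw [hβ.balanced, h.right]

lemma Orth.swap (h : IsAntiIso k s t) (ho : Orth k s X V) : Orth k t V X :=
  fun _ hβ v x => ho _ (hβ.swap h.symm) x v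

omit [Algebra k B] in
lemma IsPairing.comp_left {β : Y → V → k} (hβ : IsPairing k s β) (f : X →ₗ[A] Y) :
    IsPairing k s fun x v => β (f x) v where
  add_left x y v := by rw [map_add, hβ.add_left]
  add_right x v w := hβ.add_right _ v w
  smul c x v := by rw [map_smul, hβ.smul]
  balanced a x v := by rw [map_smul, hβ.balanced]

omit [Algebra k B] in
lemma IsPairing.zero_left {β : X → V → k} (hβ : IsPairing k s β) (v : V) : β 0 v = 0 := by
  simpa using hβ.add_left 0 0 v

omit [Algebra k B] in
lemma IsPairing.zero_right {β : X → V → k} (hβ : IsPairing k s β) (x : X) : β x 0 = 0 := by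
  simpa using hβ.add_right x 0 0

omit [Algebra k B] in
lemma IsPairing.sum_left {β : X → V → k} (hβ : IsPairing k s β) {ι : Type} (S : Finset ι)
    (f : ι → X) (v : V) : β (∑ i ∈ S, f i) v = ∑ i ∈ S, β (f i) v :=
  map_sum (AddMonoidHom.mk ⟨fun x => β x v, hβ.zero_left v⟩ fun x y => hβ.add_left x y v) f S

omit [Algebra k B] in
lemma IsPairing.sum_right {β : X → V → k} (hβ : IsPairing k s β) {ι : Type} (S : Finset ι)
    (f : ι → V) (x : X) : β x (∑ i ∈ S, f i) = ∑ i ∈ S, β x (f i) :=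
  map_sum (AddMonoidHom.mk ⟨fun v => β x v, hβ.zero_right x⟩ fun v w => hβ.add_right x v w) f S

omit [Algebra k B] in
lemma Orth.of_surjective (h : Orth k s X V) (f : X →ₗ[A] Y) (hf : Function.Surjective f) :
    Orth k s Y V := by
  intro β hβ y v
  obtain ⟨x, rfl⟩ := hf y
  exact h _ (hβ.comp_left f) x v

omit [Algebra k B] in
lemma Orth.eq_zero_of_ker (ho : Orth k s Y V) (g : X →ₗ[A] Y) (hg : Function.Surjective g)
    {β : X → V → k} (hβ : IsPairing k s β) (h0 : ∀ x v, g x = 0 → β x v = 0) (x : X) (v : V) :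
    β x v = 0 := by
  choose l hl using hg
  have h1 : ∀ y y' v, g y = g y' → β y v = β y' v := by
    intro y y' v hyy
    have h2 := hβ.add_left (y - y') y' v
    rwa [h0 (y - y') v (by rw [map_sub, hyy, sub_self]), zero_add, sub_add_cancel] at h2
  have h2 : IsPairing k s fun z v => β (l z) v :=
    { add_left := fun x y v => by
        rw [← hβ.add_left]
        exact h1 _ _ _ (by simp [hl])
      add_right := fun x v w => hβ.add_right _ v w
      smul := fun c x v => by
        rw [← hβ.smul]
        exact h1 _ _ _ (by simp [hl])
      balanced := fun a x v => by
        rw [← hβ.balanced]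
        exact h1 _ _ _ (by simp [hl]) }
  rw [← ho _ h2 (g x) v]
  exact h1 _ _ _ (hl _).symm

omit [Algebra k B] in
lemma Orth.of_isSES {Z : Type} [AddCommGroup Z] [Module A Z] {f : X →ₗ[A] Y} {g : Y →ₗ[A] Z}
    (hs : IsSES A f g) (hX : Orth k s X V) (hZ : Orth k s Z V) : Orth k s Y V := by
  intro β hβ
  refine hZ.eq_zero_of_ker g hs.2.1 hβ fun y v hy => ?_
  obtain ⟨x, rfl⟩ := hs.exists_of_eq_zero hy
  exact hX _ (hβ.comp_left f) x v

omit [Algebra k B] in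
lemma orth_pi (h : Orth k s X V) (n : ℕ) : Orth k s (Fin n → X) V := by
  intro β hβ x v
  have h1 : ∀ i, β (Pi.single i (x i)) v = 0 := fun i =>
    h _ (hβ.comp_left (LinearMap.single A (fun _ => X) i)) (x i) v
  rw [← Finset.univ_sum_single x, hβ.sum_left]
  exact Finset.sum_eq_zero fun i _ => h1 i

omit [Algebra k B] in
lemma Orth.of_fac (h : Orth k s X V) (hY : Mem (Fac A (ModuleCat.of A X)) Y) : Orth k s Y V := by
  obtain ⟨n, f, hf⟩ := hY
  exact (orth_pi h n).of_surjective f hf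

variable (k) in
/-- The class of all finite modules orthogonal to the given class. -/
def orthClass (s : A → B) (T : Set (ModuleCat.{0} A)) : Set (ModuleCat.{0} B) :=
  {V | Module.Finite B V ∧ ∀ (X : Type) [AddCommGroup X] [Module A X], Mem T X → Orth k s X V}

lemma isTorsionClass_orthClass (h : IsAntiIso k s t) (T : Set (ModuleCat.{0} A)) :
    IsTorsionClass B (orthClass k s T) := by
  refine ⟨fun X hX => hX.1, ?_, ?_⟩
  · intro V hV W f hf
    have := hV.1
    exact ⟨Module.Finite.of_surjective f hf, fun X _ _ hX =>
      (((hV.2 X hX).swap h).of_surjective f hf).swap h.symm⟩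
  · intro V V' V'' f g hs hV hV''
    refine ⟨?_, fun X _ _ hX => (((hV.2 X hX).swap h).of_isSES hs ((hV''.2 X hX).swap h)).swap h.symm⟩
    have := hV.1
    have := hV''.1
    have ht := (isFTorsionClass_top (A := B)).1
    exact ht.1 _ (ht.ext hs (mem_top_of_finite V) (mem_top_of_finite V''))

end Duality

section Duality

variable {k : Type} [Field k] {A B : Type} [Ring A] [Ring B] [Algebra k A] [Algebra k B]
  {s : A → B} {t : B → A}

/-- The dual of an `A`-module is a module over the opposite algebra `B`. -/
lemma exists_dualModule [FiniteDimensional k A] (h : IsAntiIso k s t) (X : Type) [AddCommGroup X]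
    [Module A X] [Module k X] [IsScalarTower k A X] [FiniteDimensional k X] :
    ∃ (V : Type) (_ : AddCommGroup V) (_ : Module k V) (_ : Module B V) (D : V ≃ₗ[k] Module.Dual k X),
      Module.Finite B V ∧ (∀ (b : B) v x, D (b • v) x = D v (t b • x)) ∧
        ∀ (c : k) (v : V), algebraMap k B c • v = c • v := by
  let act : B → Module.Dual k X → Module.Dual k X := fun b ξ =>
    { toFun := fun x => ξ (t b • x)
      map_add' := fun x y => by rw [smul_add, map_add]
      map_smul' := fun c x => by rw [smul_algebra_smul_comm, map_smul, RingHom.id_apply] }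
  have hact : ∀ b ξ x, act b ξ x = ξ (t b • x) := fun _ _ _ => rfl
  let inst : Module B (Module.Dual k X) :=
    { smul := act
      one_smul := fun ξ => by
        ext x
        change act 1 ξ x = _
        rw [hact, h.symm.one, one_smul]
      mul_smul := fun b b' ξ => by
        ext x
        change act (b * b') ξ x = act b (act b' ξ) x
        rw [hact, hact, hact, h.symm.mul, mul_smul]
      smul_zero := fun b => rfl
      smul_add := fun b ξ η => rfl
      add_smul := fun b b' ξ => by
        ext x
        change act (b + b') ξ x = act b ξ x + act b' ξ x
        rw [hact, hact, hact, h.symm.add, add_smul, map_add]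
      zero_smul := fun ξ => by
        ext x
        change act 0 ξ x = 0
        rw [hact, h.symm.zero, zero_smul, map_zero] }
  have halg : ∀ (c : k) (ξ : Module.Dual k X), algebraMap k B c • ξ = c • ξ := by
    intro c ξ
    ext x
    change act _ ξ x = c • ξ x
    rw [hact, h.symm.alg, algebraMap_smul, map_smul]
  refine ⟨Module.Dual k X, inferInstance, inferInstance, inst, LinearEquiv.refl _ _, ?_,
    fun _ _ _ => rfl, halg⟩
  have : IsScalarTower k B (Module.Dual k X) := ⟨fun c b ξ => by
    rw [Algebra.smul_def, mul_smul, halg]⟩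
  have : Module.Finite k (Module.Dual k X) := inferInstance
  exact Module.Finite.of_restrictScalars_finite k B _

omit [Algebra k B] in
lemma mem_orthClass {T : Set (ModuleCat.{0} A)} {V : Type} [AddCommGroup V] [Module B V] :
    Mem (orthClass k s T) V ↔ Module.Finite B V ∧
      ∀ (X : Type) [AddCommGroup X] [Module A X], Mem T X → Orth k s X V := Iff.rfl

lemma orthClass_orthClass [FiniteDimensional k A] (h : IsAntiIso k s t)
    {T : Set (ModuleCat.{0} A)} (hT : IsTorsionClass A T) (h0 : T.Nonempty) :
    orthClass k t (orthClass k s T) = T := by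
  have : IsArtinianRing A := IsArtinianRing.of_finite k A
  have : IsNoetherianRing A := inferInstance
  refine Set.Subset.antisymm ?_ fun X hX => ⟨hT.1 X hX, fun V _ _ hV => (hV.2 X hX).swap h⟩
  intro X hX
  have hfin := hX.1
  obtain ⟨N, hN, hrad⟩ := hT.exists_radical h0 X
  let _ := kmod k A (X ⧸ N)
  have := kmod_tower k A (X ⧸ N)
  have hfd : FiniteDimensional k (X ⧸ N) := Module.Finite.trans A _
  obtain ⟨V, _, _, _, D, hfinD, hD, hVk⟩ := exists_dualModule h (X ⧸ N)
  have hV : Mem (orthClass k s T) V := by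
    refine mem_orthClass.2 ⟨hfinD, ?_⟩
    intro Y _ _ hY β hβ y ξ
    let _ := kmod k A Y
    have hk : ∀ (c : k) (y : Y) (ξ : V), β y (c • ξ) = c * β y ξ := by
      intro c y ξ
      rw [← hβ.smul, hβ.balanced, h.alg, hVk]
    let b0 : Y → V →ₗ[k] k := fun y =>
      { toFun := β y, map_add' := hβ.add_right y, map_smul' := fun c ξ => hk c y ξ }
    let g0 : Y → X ⧸ N := fun y => (Module.evalEquiv k (X ⧸ N)).symm (b0 y ∘ₗ D.symm.toLinearMap)
    have hg0 : ∀ y (ξ : V), D ξ (g0 y) = β y ξ := by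
      intro y ξ
      simp [g0, b0]
    have hext : ∀ x y : X ⧸ N, (∀ ξ : V, D ξ x = D ξ y) → x = y := by
      intro x y hxy
      refine (Module.evalEquiv k (X ⧸ N)).injective (LinearMap.ext fun ξ => ?_)
      simpa using hxy (D.symm ξ)
    let g : Y →ₗ[A] X ⧸ N :=
      { toFun := g0
        map_add' := fun x y => hext _ _ fun ξ => by
          rw [map_add, hg0, hg0, hg0, hβ.add_left]
        map_smul' := fun a y => hext _ _ fun ξ => by
          rw [hg0, hβ.balanced, ← hg0, hD, h.left]
          rfl }
    rw [← hg0]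
    have : g0 y = 0 := congrArg (fun φ => φ y) (hrad Y hY g)
    rw [this, map_zero]
  have hp : IsPairing k t fun (ξ : V) (x : X) => D ξ (N.mkQ x) :=
    { add_left := fun _ _ _ => by rw [map_add]; rfl
      add_right := fun ξ x y => by rw [map_add, map_add]
      smul := fun c ξ x => by rw [hVk, map_smul]; rfl
      balanced := fun b ξ x => by rw [hD, N.mkQ.map_smul] }
  have hz := hX.2 _ hV _ hp
  have : ∀ x : X, x ∈ N := by
    intro x
    rw [← Submodule.Quotient.mk_eq_zero]
    exact (Module.forall_dual_apply_eq_zero_iff k _).1 fun ξ => by simpa using hz (D.symm ξ) x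
  exact hT.quot hN N.subtype fun x => ⟨⟨x, this x⟩, rfl⟩

/-- The map `V ⊗ A ^ m → V ⊗ A ^ n` induced by a linear map `A ^ m → A ^ n`. -/
def tmap (s : A → B) {m n : ℕ} (g : (Fin m → A) →ₗ[A] (Fin n → A)) {V : Type} [AddCommGroup V]
    [Module B V] : (Fin m → V) →+ (Fin n → V) where
  toFun u j := ∑ i, s (g (Pi.single i 1) j) • u i
  map_zero' := by ext j; simp
  map_add' u v := by ext j; simp [Finset.sum_add_distrib]

section Tensor

variable {l m n : ℕ} {V W : Type} [AddCommGroup V] [Module B V] [AddCommGroup W] [Module B W]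

lemma tmap_apply (g : (Fin m → A) →ₗ[A] (Fin n → A)) (u : Fin m → V) (j : Fin n) :
    tmap s g u j = ∑ i, s (g (Pi.single i 1) j) • u i := rfl

omit [Algebra k A] [Algebra k B] in
lemma linearMap_apply_eq_sum (h : (Fin n → A) →ₗ[A] (Fin l → A)) (x : Fin n → A) (j : Fin l) :
    h x j = ∑ i, x i * h (Pi.single i 1) j := by
  conv_lhs => rw [← Finset.univ_sum_single x, map_sum, Finset.sum_apply]
  refine Finset.sum_congr rfl fun i _ => ?_
  have : (Pi.single i (x i) : Fin n → A) = x i • Pi.single i 1 := by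
    rw [← Pi.single_smul, smul_eq_mul, mul_one]
  rw [this, map_smul, Pi.smul_apply, smul_eq_mul]

lemma tmap_comp (hs : IsAntiIso k s t) (h : (Fin n → A) →ₗ[A] (Fin l → A))
    (g : (Fin m → A) →ₗ[A] (Fin n → A)) (u : Fin m → V) :
    tmap s (h ∘ₗ g) u = tmap s h (tmap s g u) := by
  ext j
  simp only [tmap_apply, Finset.smul_sum, LinearMap.comp_apply]
  rw [Finset.sum_comm]
  refine Finset.sum_congr rfl fun i _ => ?_
  rw [linearMap_apply_eq_sum h, hs.sum, Finset.sum_smul]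
  exact Finset.sum_congr rfl fun i _ => by rw [hs.mul, mul_smul]

lemma tmap_add (hs : IsAntiIso k s t) (g g' : (Fin m → A) →ₗ[A] (Fin n → A)) (u : Fin m → V) :
    tmap s (g + g') u = tmap s g u + tmap s g' u := by
  ext j
  simp [tmap_apply, hs.add, add_smul, Finset.sum_add_distrib]

lemma tmap_natural (g : (Fin m → A) →ₗ[A] (Fin n → A)) (φ : V →ₗ[B] W) (u : Fin m → V) :
    tmap s g (fun i => φ (u i)) = fun j => φ (tmap s g u j) := by
  ext j
  simp [tmap_apply]

/-- Orthogonality to a cokernel, in terms of the presentation. -/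
lemma orth_coker_iff (hs : IsAntiIso k s t) (g : (Fin m → A) →ₗ[A] (Fin n → A)) :
    Orth k s ((Fin n → A) ⧸ LinearMap.range g) V ↔
      Function.Surjective (tmap s g : (Fin m → V) → (Fin n → V)) := by
  constructor
  · intro ho v
    by_contra hv
    let _ := kmod k B V
    have := kmod_tower k B V
    let R : Submodule k (Fin n → V) :=
      { (tmap s g : (Fin m → V) →+ _).range with
        smul_mem' := by
          rintro c _ ⟨u, rfl⟩
          refine ⟨c • u, ?_⟩
          ext j
          simp only [tmap_apply, Pi.smul_apply, Finset.smul_sum]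
          exact Finset.sum_congr rfl fun i _ => smul_algebra_smul_comm _ _ _ }
    have hR : v ∉ R := fun ⟨u, hu⟩ => hv ⟨u, hu⟩
    obtain ⟨ξ, hξ, hξR⟩ := Submodule.exists_le_ker_of_notMem hR
    have hp : IsPairing k s fun (y : Fin n → A) (v : V) => ξ fun j => s (y j) • v :=
      { add_left := fun x y v => by
          rw [← map_add]
          congr 1
          ext j
          simp [hs.add, add_smul]
        add_right := fun x v w => by
          rw [← map_add]
          congr 1
          ext j
          simp
        smul := fun c x v => by
          rw [← smul_eq_mul, ← map_smul]
          congr 1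
          ext j
          simp only [Pi.smul_apply, smul_eq_mul, hs.mul, mul_smul, hs.alg, algebraMap_smul]
          rw [smul_algebra_smul_comm]
        balanced := fun a x v => by
          congr 1
          ext j
          simp [hs.mul, mul_smul] }
    have h0 := ho.eq_zero_of_ker (LinearMap.range g).mkQ (Submodule.mkQ_surjective _) hp (by
      intro y v hy
      rw [Submodule.mkQ_apply, Submodule.Quotient.mk_eq_zero] at hy
      obtain ⟨x, rfl⟩ := hy
      refine LinearMap.mem_ker.1 (hξR ⟨fun i => s (x i) • v, ?_⟩)
      ext j
      rw [linearMap_apply_eq_sum g, hs.sum, Finset.sum_smul, tmap_apply]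
      exact Finset.sum_congr rfl fun i _ => by rw [hs.mul, mul_smul])
    apply hξ
    rw [← Finset.univ_sum_single v, map_sum]
    refine Finset.sum_eq_zero fun j _ => ?_
    rw [← h0 (Pi.single j 1) (v j)]
    congr 1
    ext j'
    by_cases hj : j' = j
    · subst hj
      simp [hs.one]
    · simp [hj, hs.zero]
  · intro hsurj β hβ
    have h1 : ∀ v : Fin n → V,
        ∑ j, β ((LinearMap.range g).mkQ (Pi.single j 1)) (v j) = 0 := by
      intro v
      obtain ⟨u, rfl⟩ := hsurj v
      have h2 : ∀ j, β ((LinearMap.range g).mkQ (Pi.single j 1)) (tmap s g u j) =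
          ∑ i, β ((LinearMap.range g).mkQ (Pi.single j (g (Pi.single i 1) j))) (u i) := by
        intro j
        rw [tmap_apply, hβ.sum_right]
        refine Finset.sum_congr rfl fun i _ => ?_
        rw [← hβ.balanced, ← map_smul, ← Pi.single_smul, smul_eq_mul, mul_one]
      simp only [h2]
      rw [Finset.sum_comm]
      refine Finset.sum_eq_zero fun i _ => ?_
      rw [← hβ.sum_left, ← map_sum, Finset.univ_sum_single]
      have : (LinearMap.range g).mkQ (g (Pi.single i 1)) = 0 := by
        rw [Submodule.mkQ_apply, Submodule.Quotient.mk_eq_zero]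
        exact ⟨_, rfl⟩
      rw [this, hβ.zero_left]
    have h3 : ∀ j (v : V), β ((LinearMap.range g).mkQ (Pi.single j 1)) v = 0 := by
      intro j v
      have h4 := h1 (Pi.single j v)
      rwa [Finset.sum_eq_single j (fun i _ hi => by rw [Pi.single_eq_of_ne hi, hβ.zero_right])
        (by simp), Pi.single_eq_same] at h4
    intro y v
    obtain ⟨y, rfl⟩ := Submodule.mkQ_surjective _ y
    rw [← Finset.univ_sum_single y, map_sum, hβ.sum_left]
    refine Finset.sum_eq_zero fun j _ => ?_
    have : (Pi.single j (y j) : Fin n → A) = y j • Pi.single j 1 := by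
      rw [← Pi.single_smul, smul_eq_mul, mul_one]
    rw [this, map_smul, hβ.balanced, h3]

end Tensor

end Duality

section Duality

variable {k : Type} [Field k] {A B : Type} [Ring A] [Ring B] [Algebra k A] [Algebra k B]
  {s : A → B} {t : B → A}

/-- An idempotent `ε` and a map `f'` presenting the `f`-torsion class `T`. -/
lemma exists_square_presentation [FiniteDimensional k A]
    {T : Set (ModuleCat.{0} A)} (hT : IsFTorsionClass A T) :
    ∃ (m n : ℕ) (ε : (Fin m → A) →ₗ[A] (Fin m → A)) (f : (Fin m → A) →ₗ[A] (Fin n → A)),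
      ε ∘ₗ ε = ε ∧ f ∘ₗ ε = f ∧ T = Fac A (ModuleCat.of A ((Fin n → A) ⧸ LinearMap.range f)) ∧
      ∀ γ : (Fin m → A) →ₗ[A] (Fin n → A), ∃ (x : (Fin n → A) →ₗ[A] (Fin n → A))
        (y : (Fin m → A) →ₗ[A] (Fin m → A)), γ ∘ₗ ε = x ∘ₗ f + f ∘ₗ y := by
  obtain ⟨m, n, P, r, f, hr, hTf, hpres⟩ := exists_presentation k hT
  have hrange : LinearMap.range (f ∘ₗ r) = LinearMap.range f :=
    LinearMap.range_comp_of_range_eq_top f (LinearMap.range_eq_top.2 fun x => ⟨x, hr x⟩)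
  refine ⟨m, n, P.subtype ∘ₗ r, f ∘ₗ r, ?_, ?_, ?_, ?_⟩
  · ext1 i
    ext1
    exact congrArg P.subtype (hr _)
  · ext1 i
    ext1
    exact congrArg f (hr _)
  · rw [hrange]
    exact hTf
  · intro γ
    obtain ⟨v, hv⟩ := hpres ((Fin n → A) ⧸ LinearMap.range f) (by rw [hTf]; exact mem_fac_self)
      ((LinearMap.range f).mkQ ∘ₗ γ ∘ₗ P.subtype)
    obtain ⟨x, hx⟩ := Module.projective_lifting_property (LinearMap.range f).mkQ v
      (Submodule.mkQ_surjective _)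
    let δ : (Fin m → A) →ₗ[A] (Fin n → A) := γ ∘ₗ P.subtype ∘ₗ r - x ∘ₗ f ∘ₗ r
    have hδ : ∀ w, δ w ∈ LinearMap.range (f ∘ₗ r) := by
      intro w
      have h1 : v (f (r w)) = _ := congrArg (fun φ => φ (r w)) hv
      have h2 : _ = v (f (r w)) := congrArg (fun φ => φ (f (r w))) hx
      have h3 : δ w = γ (P.subtype (r w)) - x (f (r w)) := rfl
      rw [hrange, ← Submodule.Quotient.mk_eq_zero, ← Submodule.mkQ_apply, h3, map_sub, sub_eq_zero]
      exact (h2.trans h1).symm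
    obtain ⟨y, hy⟩ := Module.projective_lifting_property (f ∘ₗ r).rangeRestrict
      (δ.codRestrict _ hδ) (LinearMap.surjective_rangeRestrict _)
    refine ⟨x, y, ?_⟩
    have h3 : (f ∘ₗ r) ∘ₗ y = δ := LinearMap.ext fun w =>
      congrArg (fun φ => (φ w : Fin n → A)) hy
    rw [h3]
    simp only [δ]
    abel

lemma mem_orthClass_iff_surjective (hs : IsAntiIso k s t) {m n : ℕ}
    {T : Set (ModuleCat.{0} A)} {f : (Fin m → A) →ₗ[A] (Fin n → A)}
    (hT : T = Fac A (ModuleCat.of A ((Fin n → A) ⧸ LinearMap.range f)))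
    {V : Type} [AddCommGroup V] [Module B V] :
    Mem (orthClass k s T) V ↔ Module.Finite B V ∧
      Function.Surjective (tmap s f : (Fin m → V) → (Fin n → V)) := by
  rw [mem_orthClass, ← orth_coker_iff hs]
  refine and_congr_right fun _ => ⟨fun h => h _ ?_, fun h X _ _ hX => h.of_fac ?_⟩
  · rw [hT]
    exact mem_fac_self
  · rw [hT] at hX
    exact hX

/-- The relations of the module generating the dual torsion class. -/
def dualRel (s : A → B) {d m n : ℕ} (c : Fin d → B) (ε : (Fin m → A) →ₗ[A] (Fin m → A))
    (f : (Fin m → A) →ₗ[A] (Fin n → A)) :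
    Submodule B (Option (Fin d × Fin n × Fin m) → B) :=
  Submodule.span B
    ({x | ∃ q j j', x = tmap s f (fun i => (Pi.single (some (q, j, i)) 1 :
        Option (Fin d × Fin n × Fin m) → B)) j' -
          (Pi.single j (c q • (Pi.single none 1 : Option (Fin d × Fin n × Fin m) → B)) :
            Fin n → Option (Fin d × Fin n × Fin m) → B) j'} ∪
     {x | ∃ q j i', x = tmap s ε (fun i => (Pi.single (some (q, j, i)) 1 :
        Option (Fin d × Fin n × Fin m) → B)) i' - Pi.single (some (q, j, i')) 1})

lemma isFTorsionClass_orthClass [FiniteDimensional k A] [FiniteDimensional k B]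
    (hs : IsAntiIso k s t) {T : Set (ModuleCat.{0} A)} (hT : IsFTorsionClass A T) :
    IsFTorsionClass B (orthClass k s T) := by
  obtain ⟨m, n, ε, f, hε, hfε, hTf, hγ⟩ := exists_square_presentation (k := k) hT
  have hmem : ∀ (V : Type) [AddCommGroup V] [Module B V], Mem (orthClass k s T) V ↔ _ :=
    fun V _ _ => mem_orthClass_iff_surjective hs hTf (V := V)
  let c := Module.finBasis k B
  let R := dualRel s c ε f
  let I := Option (Fin (Module.finrank k B) × Fin n × Fin m)
  let e : (I → B) ⧸ R := R.mkQ (Pi.single none 1)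
  let u : Fin (Module.finrank k B) → Fin n → Fin m → (I → B) ⧸ R :=
    fun q j i => R.mkQ (Pi.single (some (q, j, i)) 1)
  have hu : ∀ q j, tmap s f (u q j) = Pi.single j (c q • e) := by
    intro q j
    ext j'
    have h1 : R.mkQ _ = 0 := (Submodule.Quotient.mk_eq_zero R).2
      (Submodule.subset_span (Or.inl ⟨q, j, j', rfl⟩))
    rw [map_sub, sub_eq_zero] at h1
    refine (congrFun (tmap_natural (s := s) f R.mkQ _) j').trans (h1.trans ?_)
    by_cases hj : j' = j
    · subst hj
      rw [Pi.single_eq_same, Pi.single_eq_same, map_smul]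
    · rw [Pi.single_eq_of_ne hj, Pi.single_eq_of_ne hj, map_zero]
  have hue : ∀ q j, tmap s ε (u q j) = u q j := by
    intro q j
    ext i'
    have h1 : R.mkQ _ = 0 := (Submodule.Quotient.mk_eq_zero R).2
      (Submodule.subset_span (Or.inr ⟨q, j, i', rfl⟩))
    rw [map_sub, sub_eq_zero] at h1
    exact (congrFun (tmap_natural (s := s) ε R.mkQ _) i').trans h1
  have hE : Mem (orthClass k s T) ((I → B) ⧸ R) := by
    rw [hmem]
    refine ⟨inferInstance, ?_⟩
    let S := (tmap s f : (Fin m → (I → B) ⧸ R) →+ _).range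
    have hS : ∀ w, tmap s f w ∈ S := fun w => ⟨w, rfl⟩
    have hsum : ∀ w : Fin n → (I → B) ⧸ R, (∀ j, Pi.single j (w j) ∈ S) → w ∈ S := by
      intro w hw
      rw [← Finset.univ_sum_single w]
      exact S.sum_mem fun j _ => hw j
    have h1 : ∀ (b : B) j, Pi.single j (b • e) ∈ S := by
      intro b j
      rw [← c.sum_repr b, Finset.sum_smul]
      have : (Pi.single j (∑ q, (c.repr b q • c q) • e) : Fin n → (I → B) ⧸ R) =
          ∑ q, Pi.single j ((c.repr b q • c q) • e) :=
        map_sum (AddMonoidHom.single (fun _ : Fin n => (I → B) ⧸ R) j) _ _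
      rw [this]
      refine S.sum_mem fun q _ => ⟨fun i => algebraMap k B (c.repr b q) • u q j i, ?_⟩
      ext1 j'
      have h2 := congrArg (fun w => algebraMap k B (c.repr b q) • w j') (hu q j)
      simp only [tmap_apply, Finset.smul_sum] at h2
      rw [tmap_apply]
      calc _ = ∑ i, algebraMap k B (c.repr b q) • s (f (Pi.single i 1) j') • u q j i :=
            Finset.sum_congr rfl fun i _ => by rw [smul_smul, smul_smul, Algebra.commutes]
        _ = _ := by
            rw [h2]
            by_cases hj : j' = j
            · subst hj
              rw [Pi.single_eq_same, Pi.single_eq_same, Algebra.smul_def, mul_smul]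
            · rw [Pi.single_eq_of_ne hj, Pi.single_eq_of_ne hj, smul_zero]
    have h2 : ∀ γ q j, tmap s γ (u q j) ∈ S := by
      intro γ q j
      obtain ⟨x, y, hxy⟩ := hγ γ
      rw [← hue q j, ← tmap_comp hs, hxy, tmap_add hs, tmap_comp hs, tmap_comp hs]
      refine S.add_mem ?_ (hS _)
      rw [hu]
      refine hsum _ fun j' => ?_
      rw [tmap_apply, Finset.sum_eq_single j (fun i _ hi => by
        rw [Pi.single_eq_of_ne hi, smul_zero]) (by simp), Pi.single_eq_same, smul_smul]
      exact h1 _ _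
    have h3 : ∀ (b : B) q j i j', Pi.single j' (b • u q j i) ∈ S := by
      intro b q j i j'
      convert h2 (LinearMap.single A (fun _ => A) j' ∘ₗ LinearMap.toSpanSingleton A A (t b) ∘ₗ
        LinearMap.proj i) q j using 1
      ext1 l
      rw [tmap_apply, Finset.sum_eq_single i]
      · by_cases hl : l = j'
        · subst hl
          simp [hs.right]
        · simp [hl, hs.zero]
      · intro i' _ hi
        simp [hi.symm, hs.zero]
      · simp
    intro w
    refine hsum w fun j => ?_
    obtain ⟨x, hx⟩ := R.mkQ_surjective (w j)
    rw [← hx, ← Finset.univ_sum_single x, map_sum]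
    have : (Pi.single j (∑ i, R.mkQ (Pi.single i (x i))) : Fin n → (I → B) ⧸ R) =
          ∑ i, Pi.single j (R.mkQ (Pi.single i (x i))) :=
        map_sum (AddMonoidHom.single (fun _ : Fin n => (I → B) ⧸ R) j) _ _
    rw [this]
    refine S.sum_mem fun i _ => ?_
    have h4 : (Pi.single i (x i) : I → B) = x i • Pi.single i 1 := by
      rw [← Pi.single_smul, smul_eq_mul, mul_one]
    rw [h4, map_smul]
    match i with
    | none => exact h1 _ _
    | some (q, j, i) => exact h3 _ _ _ _ _
  refine ⟨isTorsionClass_orthClass hs T, ModuleCat.of B ((I → B) ⧸ R), inferInstanceAs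
    (Module.Finite B ((I → B) ⧸ R)), ?_⟩
  refine Set.Subset.antisymm ?_ ((isTorsionClass_orthClass hs T).fac_subset hE)
  intro V hV
  have hV' := (hmem V).1 hV
  have := hV'.1
  refine mem_fac_of_trace fun N hN v => ?_
  choose w hw using fun q j => hV'.2 (Pi.single j (c q • v))
  let φ : (I → B) →ₗ[B] V := (Pi.basisFun B I).constr ℕ fun i =>
    match i with
    | none => v
    | some (q, j, i) => tmap s ε (w q j) i
  have hφ0 : φ (Pi.single none 1) = v := by
    rw [← Pi.basisFun_apply, Module.Basis.constr_basis]
  have hφ1 : ∀ q j i, φ (Pi.single (some (q, j, i)) 1) = tmap s ε (w q j) i := by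
    intro q j i
    rw [← Pi.basisFun_apply, Module.Basis.constr_basis]
  have hφR : R ≤ LinearMap.ker φ := by
    refine Submodule.span_le.2 ?_
    rintro x (⟨q, j, j', rfl⟩ | ⟨q, j, i', rfl⟩)
    · rw [SetLike.mem_coe, LinearMap.mem_ker, map_sub, sub_eq_zero]
      have h5 := congrFun (tmap_natural (s := s) f φ fun i => (Pi.single (some (q, j, i)) 1 : I → B)) j'
      refine h5.symm.trans ?_
      simp only [hφ1]
      have h6 : tmap s f (fun i => tmap s ε (w q j) i) = Pi.single j (c q • v) := by
        change tmap s f (tmap s ε (w q j)) = _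
        rw [← tmap_comp hs, hfε, hw]
      rw [h6]
      by_cases hj : j' = j
      · subst hj
        rw [Pi.single_eq_same, Pi.single_eq_same, map_smul, hφ0]
      · rw [Pi.single_eq_of_ne hj, Pi.single_eq_of_ne hj, map_zero]
    · rw [SetLike.mem_coe, LinearMap.mem_ker, map_sub, sub_eq_zero]
      have h5 := congrFun (tmap_natural (s := s) ε φ fun i => (Pi.single (some (q, j, i)) 1 : I → B)) i'
      refine h5.symm.trans ?_
      simp only [hφ1]
      change tmap s ε (tmap s ε (w q j)) i' = _
      rw [← tmap_comp hs, hε]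
  have := hN (R.liftQ φ hφR) (R.mkQ (Pi.single none 1))
  rwa [Submodule.mkQ_apply, Submodule.liftQ_apply, hφ0] at this

omit [Algebra k B] in
lemma orthClass_anti {T U : Set (ModuleCat.{0} A)} (h : T ⊆ U) :
    orthClass k s U ⊆ orthClass k s T := fun _ hV => ⟨hV.1, fun X _ _ hX => hV.2 X (h hX)⟩

end Duality

lemma isJoinSemilatticePoset_of_anti {P Q : Type*} [PartialOrder P] [PartialOrder Q]
    (φ : P → Q) (ψ : Q → P) (hφ : ∀ x y, x ≤ y → φ y ≤ φ x) (hψ : ∀ x y, x ≤ y → ψ y ≤ ψ x)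
    (hl : ∀ x, ψ (φ x) = x) (hr : ∀ y, φ (ψ y) = y) (h : IsMeetSemilatticePoset P) :
    IsJoinSemilatticePoset Q := by
  have hub : ∀ (S : Set Q) (y : Q), y ∈ upperBounds S ↔ ψ y ∈ lowerBounds (ψ '' S) := by
    intro S y
    constructor
    · rintro hy _ ⟨z, hz, rfl⟩
      exact hψ _ _ (hy hz)
    · intro hy z hz
      rw [← hr y, ← hr z]
      exact hφ _ _ (hy ⟨z, hz, rfl⟩)
  have hmin : ∀ (S : Set Q) (y : Q), MinimalIn (upperBounds S) y ↔
      MaximalIn (lowerBounds (ψ '' S)) (ψ y) := by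
    intro S y
    constructor
    · rintro ⟨h1, h2⟩
      refine ⟨(hub S y).1 h1, fun x hx hyx => ?_⟩
      rw [← h2 (φ x) ((hub S _).2 (by rwa [hl])) (by rw [← hr y]; exact hφ _ _ hyx), hl]
    · rintro ⟨h1, h2⟩
      refine ⟨(hub S y).2 h1, fun x hx hyx => ?_⟩
      rw [← hr x, h2 (ψ x) ((hub S _).1 hx) (hψ _ _ hyx), hr]
  intro S hS
  obtain ⟨m, hm1, hm2⟩ := h (ψ '' S) (hS.image ψ)
  refine ⟨φ m, (hmin S _).2 (by rwa [hl]), fun y hy => ?_⟩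
  rw [← hm2 (ψ y) ((hmin S y).1 hy), hr]

/-- Duality exchanges meets and joins of functorially finite torsion classes. -/
theorem isJoinSemilatticePoset_op (k : Type) [Field k] {A : Type} [Ring A] [Algebra k A]
    [FiniteDimensional k A] (h : IsMeetSemilatticePoset (FTors A)) :
    IsJoinSemilatticePoset (FTors Aᵐᵒᵖ) := by
  have hs : IsAntiIso k (MulOpposite.op : A → Aᵐᵒᵖ) MulOpposite.unop :=
    ⟨fun _ _ => rfl, fun _ _ => rfl, fun _ => rfl, fun _ => rfl, fun _ => rfl⟩
  have : FiniteDimensional k Aᵐᵒᵖ := Module.Finite.equiv (MulOpposite.opLinearEquiv k)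
  exact isJoinSemilatticePoset_of_anti
    (fun T => ⟨orthClass k _ T.1, isFTorsionClass_orthClass hs T.2⟩)
    (fun T => ⟨orthClass k _ T.1, isFTorsionClass_orthClass hs.symm T.2⟩)
    (fun _ _ hxy => orthClass_anti hxy) (fun _ _ hxy => orthClass_anti hxy)
    (fun T => Subtype.ext (orthClass_orthClass hs T.2.1 T.2.nonempty))
    (fun T => Subtype.ext (orthClass_orthClass hs.symm T.2.1 T.2.nonempty)) h

section CanonicalBasics

variable {k : Type} [Field k] {t : ℕ} {p : Fin t → ℕ} {lam : Fin t → k}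

variable (k p lam) in
/-- The arrow `j` of arm `i` as an element of the canonical algebra (zero out of range). -/
def canArrow (i : Fin t) (j : ℕ) : CanAlg k t p lam :=
  if h : j < p i then
    RingQuot.mkAlgHom k (CanRel k t p lam) (FreeAlgebra.ι k (Sum.inr ⟨i, ⟨j, h⟩⟩ : CanGen t p))
  else 0

variable (k lam) in
abbrev canE (v : CanVert t p) : CanAlg k t p lam := canIdem k t p lam v

variable (p) in
/-- The `j`-th vertex along arm `i`. -/
def canPos (i : Fin t) (j : ℕ) : CanVert t p :=
  if _ : j = 0 then canSource t p
  else if h : j < p i then Sum.inr (Sum.inr ⟨i, ⟨j - 1, by omega⟩⟩)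
  else canSink t p

lemma canPos_zero (i : Fin t) : canPos p i 0 = canSource t p := by simp [canPos]

lemma canPos_last (hp : ∀ i, 1 ≤ p i) (i : Fin t) : canPos p i (p i) = canSink t p := by
  have := hp i
  rw [canPos, dif_neg (by omega), dif_neg (by omega)]

lemma canPos_eq (hp : ∀ i, 1 ≤ p i) {i i' : Fin t} {j j' : ℕ} (hj : j ≤ p i) (hj' : j' ≤ p i')
    (h : canPos p i j = canPos p i' j') :
    (j = 0 ∧ j' = 0) ∨ (j = p i ∧ j' = p i') ∨ (i = i' ∧ j = j') := by
  have h1 := hp i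
  have h2 := hp i'
  unfold canPos canSource canSink at h
  split_ifs at h
  all_goals first
    | exact Or.inl ⟨by omega, by omega⟩
    | exact Or.inr (Or.inl ⟨by omega, by omega⟩)
    | (exfalso; simp at h; done)
    | skip
  obtain ⟨rfl, h4⟩ := Sigma.mk.inj_iff.1 (Sum.inr.inj (Sum.inr.inj h))
  have h5 := Fin.mk.inj_iff.1 (eq_of_heq h4)
  exact Or.inr (Or.inr ⟨rfl, by omega⟩)

lemma canVert_cases (ht : 0 < t) (hp : ∀ i, 1 ≤ p i) (v : CanVert t p) :
    ∃ i j, j ≤ p i ∧ v = canPos p i j := by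
  rcases v with ⟨⟩ | ⟨⟨⟩⟩ | ⟨i, j⟩
  · exact ⟨⟨0, ht⟩, 0, by omega, (canPos_zero _).symm⟩
  · exact ⟨⟨0, ht⟩, p _, le_rfl, (canPos_last hp _).symm⟩
  · refine ⟨i, j + 1, by omega, ?_⟩
    rw [canPos, dif_neg (by omega), dif_pos (by omega)]
    rfl

lemma arrSrc_eq (i : Fin t) (j : Fin (p i)) : arrSrc t p i j = canPos p i j := by
  unfold arrSrc canPos
  split_ifs
  · rfl
  · rfl
  · omega

lemma arrTgt_eq (i : Fin t) (j : Fin (p i)) : arrTgt t p i j = canPos p i (j + 1) := by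
  have hj := j.2
  rw [arrTgt, canPos, dif_neg (by omega : ¬ (j : ℕ) + 1 = 0)]
  by_cases h : (j : ℕ) + 1 = p i
  · rw [dif_pos h, dif_neg (by omega)]
  · rw [dif_neg h, dif_pos (by omega)]
    rfl

lemma canE_mul_self (v : CanVert t p) : canE k lam v * canE k lam v = canE k lam v := by
  rw [canE, canIdem, ← map_mul]
  exact RingQuot.mkAlgHom_rel k (CanRel.idem v)

lemma canE_mul_of_ne {v w : CanVert t p} (h : v ≠ w) : canE k lam v * canE k lam w = 0 := by
  rw [canE, canE, canIdem, canIdem, ← map_mul, RingQuot.mkAlgHom_rel k (CanRel.orth h), map_zero]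

lemma sum_canE : ∑ v : CanVert t p, canE k lam v = 1 := by
  simp only [canE, canIdem]
  rw [← map_sum, RingQuot.mkAlgHom_rel k CanRel.sum_one, map_one]

lemma canE_mul_canArrow (i : Fin t) (j : ℕ) :
    canE k lam (canPos p i (j + 1)) * canArrow k p lam i j = canArrow k p lam i j := by
  unfold canArrow
  split_ifs with h
  · have := RingQuot.mkAlgHom_rel k (CanRel.target (k := k) (lam := lam) (⟨i, ⟨j, h⟩⟩ : CanArr t p))
    rw [map_mul, arrTgt_eq] at this
    exact this
  · rw [mul_zero]

lemma canArrow_mul_canE (i : Fin t) (j : ℕ) :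
    canArrow k p lam i j * canE k lam (canPos p i j) = canArrow k p lam i j := by
  unfold canArrow
  split_ifs with h
  · have := RingQuot.mkAlgHom_rel k (CanRel.source (k := k) (lam := lam) (⟨i, ⟨j, h⟩⟩ : CanArr t p))
    rw [map_mul, arrSrc_eq] at this
    exact this
  · rw [zero_mul]

variable (k p lam) in
/-- The path of length `n` starting at the `j`-th vertex of arm `i`. -/
def canPath (i : Fin t) (j : ℕ) : ℕ → CanAlg k t p lam
  | 0 => canE k lam (canPos p i j)
  | n + 1 => canArrow k p lam i (j + n) * canPath i j n

lemma canE_mul_canPath (i : Fin t) (j n : ℕ) :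
    canE k lam (canPos p i (j + n)) * canPath k p lam i j n = canPath k p lam i j n := by
  cases n with
  | zero => exact canE_mul_self _
  | succ n => rw [canPath, ← mul_assoc, ← add_assoc, canE_mul_canArrow]

lemma canPath_mul_canE (i : Fin t) (j n : ℕ) :
    canPath k p lam i j n * canE k lam (canPos p i j) = canPath k p lam i j n := by
  induction n with
  | zero => exact canE_mul_self _
  | succ n ih => rw [canPath, mul_assoc, ih]

lemma canPath_mul (i : Fin t) (j m n : ℕ) :
    canPath k p lam i (j + m) n * canPath k p lam i j m = canPath k p lam i j (m + n) := by
  induction n with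
  | zero => exact canE_mul_canPath i j m
  | succ n ih => rw [canPath, mul_assoc, ih, ← add_assoc, canPath, add_assoc]

lemma canPath_one (i : Fin t) (j : ℕ) : canPath k p lam i j 1 = canArrow k p lam i j :=
  canArrow_mul_canE i j

variable (k p lam) in
/-- The composition of all the arrows of arm `i`. -/
abbrev canW (i : Fin t) : CanAlg k t p lam := canPath k p lam i 0 (p i)

lemma mkAlgHom_armWord (hp : ∀ i, 1 ≤ p i) (i : Fin t) :
    RingQuot.mkAlgHom k (CanRel k t p lam) (armWord k t p i) = canW k p lam i := by
  have key : ∀ n (hn : n ≤ p i), 1 ≤ n →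
      ((List.ofFn fun j : Fin n => RingQuot.mkAlgHom k (CanRel k t p lam)
        (FreeAlgebra.ι k (Sum.inr ⟨i, ⟨j, j.2.trans_le hn⟩⟩ : CanGen t p))).reverse).prod =
      canPath k p lam i 0 n := by
    intro n hn h1
    induction n with
    | zero => omega
    | succ n ih =>
      rw [List.ofFn_succ', List.concat_eq_append, List.reverse_append, List.prod_append]
      simp only [List.reverse_singleton, List.prod_singleton]
      have h2 : canArrow k p lam i n = RingQuot.mkAlgHom k (CanRel k t p lam)
          (FreeAlgebra.ι k (Sum.inr ⟨i, ⟨n, hn⟩⟩ : CanGen t p)) := dif_pos _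
      rw [canPath, zero_add, h2]
      rcases Nat.eq_zero_or_pos n with rfl | hn'
      · have := canArrow_mul_canE (k := k) (p := p) (lam := lam) i 0
        rw [h2] at this
        simp only [List.ofFn_zero, List.reverse_nil, List.prod_nil, mul_one]
        exact this.symm
      · congr 1
        exact ih (by omega) hn'
  rw [armWord, map_list_prod, List.map_reverse, List.map_ofFn]
  exact key (p i) le_rfl (hp i)

lemma canW_eq (hp : ∀ i, 1 ≤ p i) (i : Fin t) (h2 : 2 ≤ (i : ℕ)) :
    canW k p lam i = canW k p lam ⟨0, by omega⟩ + lam i • canW k p lam ⟨1, by omega⟩ := by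
  have := RingQuot.mkAlgHom_rel k (CanRel.canonical (k := k) (p := p) (lam := lam) i h2)
  rwa [map_add, map_smul, mkAlgHom_armWord hp, mkAlgHom_armWord hp, mkAlgHom_armWord hp] at this

/-- Induction on the generators. -/
lemma canAlg_induction {P : CanAlg k t p lam → Prop} (hc : ∀ c, P (algebraMap k _ c))
    (hE : ∀ v, P (canE k lam v)) (hA : ∀ i j, j < p i → P (canArrow k p lam i j))
    (hmul : ∀ x y, P x → P y → P (x * y)) (hadd : ∀ x y, P x → P y → P (x + y)) (x) : P x := by
  obtain ⟨y, rfl⟩ := RingQuot.mkAlgHom_surjective k (CanRel k t p lam) x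
  induction y using FreeAlgebra.induction with
  | grade0 c => rw [AlgHom.commutes]; exact hc c
  | grade1 g =>
    rcases g with v | ⟨i, j⟩
    · exact hE v
    · have := hA i j j.2
      rwa [canArrow, dif_pos j.2] at this
  | mul a b ha hb => rw [map_mul]; exact hmul _ _ ha hb
  | add a b ha hb => rw [map_add]; exact hadd _ _ ha hb

/-- The paths span the canonical algebra. -/
lemma span_canPath (ht : 0 < t) (hp : ∀ i, 1 ≤ p i) :
    Submodule.span k {x : CanAlg k t p lam | ∃ i j n, j + n ≤ p i ∧ x = canPath k p lam i j n} = ⊤ := by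
  set S := Submodule.span k {x : CanAlg k t p lam | ∃ i j n, j + n ≤ p i ∧ x = canPath k p lam i j n}
  have h0 : ∀ i j n, j + n ≤ p i → canPath k p lam i j n ∈ S := fun i j n h =>
    Submodule.subset_span ⟨i, j, n, h, rfl⟩
  have h1 : (1 : CanAlg k t p lam) ∈ S := by
    rw [← sum_canE]
    refine S.sum_mem fun v _ => ?_
    obtain ⟨i, j, hj, rfl⟩ := canVert_cases ht hp v
    exact h0 i j 0 hj
  have key : ∀ (y : CanAlg k t p lam), ∀ x ∈ S, y * x ∈ S := by
    intro y
    induction y using canAlg_induction with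
    | hc c =>
      intro x hx
      rw [← Algebra.smul_def]
      exact S.smul_mem _ hx
    | hmul y z hy hz => intro x hx; rw [mul_assoc]; exact hy _ (hz _ hx)
    | hadd y z hy hz => intro x hx; rw [add_mul]; exact S.add_mem (hy _ hx) (hz _ hx)
    | hE v =>
      intro x hx
      induction hx using Submodule.span_induction with
      | zero => rw [mul_zero]; exact S.zero_mem
      | add x y _ _ hx hy => rw [mul_add]; exact S.add_mem hx hy
      | smul c x _ hx => rw [mul_smul_comm]; exact S.smul_mem _ hx
      | mem x hx =>
        obtain ⟨i, j, n, h, rfl⟩ := hx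
        rw [← canE_mul_canPath, ← mul_assoc]
        by_cases hv : v = canPos p i (j + n)
        · rw [hv, canE_mul_self, canE_mul_canPath]
          exact h0 _ _ _ h
        · rw [canE_mul_of_ne hv, zero_mul]
          exact S.zero_mem
    | hA i' m hm =>
      intro x hx
      induction hx using Submodule.span_induction with
      | zero => rw [mul_zero]; exact S.zero_mem
      | add x y _ _ hx hy => rw [mul_add]; exact S.add_mem hx hy
      | smul c x _ hx => rw [mul_smul_comm]; exact S.smul_mem _ hx
      | mem x hx =>
        obtain ⟨i, j, n, h, rfl⟩ := hx
        by_cases hv : canPos p i' m = canPos p i (j + n)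
        · rcases canPos_eq hp hm.le h hv with ⟨rfl, h3⟩ | ⟨h3, -⟩ | ⟨rfl, rfl⟩
          · obtain ⟨rfl, rfl⟩ : j = 0 ∧ n = 0 := by omega
            have : canArrow k p lam i' 0 * canPath k p lam i 0 0 = canPath k p lam i' 0 1 := by
              rw [canPath, canPath_one, canPos_zero, ← canPos_zero (p := p) i', canArrow_mul_canE]
            rw [this]
            exact h0 _ _ _ (by have := hp i'; omega)
          · omega
          · exact h0 i' j (n + 1) (by omega)
        · rw [← canE_mul_canPath, ← mul_assoc, ← canArrow_mul_canE, mul_assoc _ _ (canE k lam _),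
            canE_mul_of_ne hv, mul_zero, zero_mul]
          exact S.zero_mem
  refine eq_top_iff.2 fun x _ => ?_
  rw [← mul_one x]
  exact key x 1 h1

lemma canAlg_finite (ht : 0 < t) (hp : ∀ i, 1 ≤ p i) : FiniteDimensional k (CanAlg k t p lam) := by
  refine ⟨?_⟩
  rw [← span_canPath ht hp]
  refine Submodule.fg_span ?_
  refine (Set.finite_range fun x : Σ i : Fin t, Fin (p i + 1) × Fin (p i + 1) =>
    canPath k p lam x.1 x.2.1 x.2.2).subset ?_
  rintro _ ⟨i, j, n, h, rfl⟩
  exact ⟨⟨i, ⟨j, by omega⟩, ⟨n, by omega⟩⟩, rfl⟩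

/-- An element `e_y c e_x` is a combination of the paths from `x` to `y`. -/
lemma corner_mem (ht : 0 < t) (hp : ∀ i, 1 ≤ p i) (x y : CanVert t p)
    (S : Submodule k (CanAlg k t p lam))
    (hS : ∀ i j n, j + n ≤ p i → canPos p i j = x → canPos p i (j + n) = y →
      canPath k p lam i j n ∈ S) (c : CanAlg k t p lam) :
    canE k lam y * c * canE k lam x ∈ S := by
  have hc : c ∈ (⊤ : Submodule k (CanAlg k t p lam)) := Submodule.mem_top
  rw [← span_canPath ht hp] at hc
  induction hc using Submodule.span_induction with
  | zero => simp
  | add a b _ _ ha hb => rw [mul_add, add_mul]; exact S.add_mem ha hb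
  | smul r a _ ha => rw [mul_smul_comm, smul_mul_assoc]; exact S.smul_mem _ ha
  | mem a ha =>
    obtain ⟨i, j, n, h, rfl⟩ := ha
    rw [← canE_mul_canPath, ← mul_assoc]
    by_cases hy : canPos p i (j + n) = y
    · rw [hy, canE_mul_self, ← hy, canE_mul_canPath]
      by_cases hx : canPos p i j = x
      · rw [← hx, canPath_mul_canE]
        exact hS i j n h hx hy
      · rw [← canPath_mul_canE, mul_assoc, canE_mul_of_ne hx, mul_zero]
        exact S.zero_mem
    · rw [canE_mul_of_ne (Ne.symm hy), zero_mul, zero_mul]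
      exact S.zero_mem

end CanonicalBasics

section Coinduced

variable {k : Type} [Field k] {A : Type} [Ring A] [Algebra k A]

variable (k) in
/-- `Q` is a kernel of a map between coinduced modules: it represents the functionals `ζ` with
`ζ ∘ v = ζ` and `ζ ∘ z = 0`, by means of the functional `ξ`. -/
structure IsCoinduced (v z : A) {Q : Type} [AddCommGroup Q] [Module A Q] [Module k Q]
    (ξ : Q →ₗ[k] k) : Prop where
  smul_eq_zero : ∀ q : Q, z • q = 0
  eq_zero : ∀ q : Q, (∀ c : A, ξ ((v * c) • q) = 0) → q = 0
  exists_eq : ∀ η : A →ₗ[k] k, (∀ c, η (v * c) = η c) → (∀ c, η (z * c) = 0) →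
    ∃ q : Q, ∀ c, ξ ((v * c) • q) = η c

variable {v z : A} {Q : Type} [AddCommGroup Q] [Module A Q] [Module k Q] [IsScalarTower k A Q]
  {ξ : Q →ₗ[k] k}

omit [IsScalarTower k A Q] in
lemma IsCoinduced.ext (h : IsCoinduced k v z ξ) {q q' : Q}
    (hq : ∀ c : A, ξ ((v * c) • q) = ξ ((v * c) • q')) : q = q' := by
  refine sub_eq_zero.1 (h.eq_zero _ fun c => ?_)
  rw [smul_sub, map_sub, hq, sub_self]

omit [IsScalarTower k A Q] in
/-- A functional gives a homomorphism. -/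
lemma IsCoinduced.exists_hom (h : IsCoinduced k v z ξ) {E : Type} [AddCommGroup E] [Module A E]
    [Module k E] [IsScalarTower k A E] (ζ : E →ₗ[k] k) (hv : ∀ x, ζ (v • x) = ζ x)
    (hz : ∀ x, ζ (z • x) = 0) :
    ∃ r : E →ₗ[A] Q, ∀ (c : A) x, ξ ((v * c) • r x) = ζ (c • x) := by
  have key : ∀ x : E, ∃ q : Q, ∀ c : A, ξ ((v * c) • q) = ζ (c • x) := by
    intro x
    refine h.exists_eq (ζ ∘ₗ (LinearMap.toSpanSingleton A E x).restrictScalars k) ?_ ?_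
    · intro c
      simp [mul_smul, hv]
    · intro c
      simp [mul_smul, hz]
  choose r hr using key
  refine ⟨⟨⟨r, fun x y => h.ext fun c => ?_⟩, fun a x => h.ext fun c => ?_⟩, fun c x => hr x c⟩
  · rw [smul_add, map_add, hr, hr, hr, smul_add, map_add]
  · simp only [RingHom.id_apply]
    rw [← mul_smul, mul_assoc, hr, hr, mul_smul]

lemma IsCoinduced.extZ (h : IsCoinduced k v z ξ) (hvv : v * v = v) (hvz : v * z = z) {e : A}
    (hze : z * e = z) {Y : Type} [AddCommGroup Y] [Module A Y]
    (hY : ∀ y : Y, z • y = 0 → e • y = 0) : ExtZ A Y Q := by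
  refine extZ_of_extend fun E _ _ i g hs => ?_
  let _ := kmod k A E
  have := kmod_tower k A E
  let S : Submodule k E := LinearMap.range (Algebra.lsmul k k E z)
  let j : Q →ₗ[k] E ⧸ S := S.mkQ ∘ₗ i.restrictScalars k
  have hj : LinearMap.ker j = ⊥ := by
    rw [LinearMap.ker_eq_bot']
    intro q hq
    obtain ⟨x, hx⟩ : i q ∈ S := (Submodule.Quotient.mk_eq_zero S).1 hq
    have hx : z • x = i q := hx
    have h1 : z • g x = 0 := by rw [← map_smul, hx, hs.apply_eq_zero]
    obtain ⟨q', hq'⟩ := hs.exists_of_eq_zero (y := e • x) (by rw [map_smul, hY _ h1])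
    refine hs.1 ?_
    rw [← hx, map_zero, ← hze, mul_smul, ← hq', ← map_smul, h.smul_eq_zero, map_zero]
  obtain ⟨l, hl⟩ := j.exists_leftInverse_of_injective hj
  have hl' : ∀ q, l (S.mkQ (i q)) = q := fun q => LinearMap.congr_fun hl q
  have hlz : ∀ x : E, l (S.mkQ (z • x)) = 0 := fun x => by
    have : S.mkQ (z • x) = 0 := (Submodule.Quotient.mk_eq_zero S).2 ⟨x, rfl⟩
    rw [this, map_zero]
  let ζ₀ : E →ₗ[k] k := ξ ∘ₗ Algebra.lsmul k k Q v ∘ₗ l ∘ₗ S.mkQ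
  obtain ⟨r, hr⟩ := h.exists_hom (ζ₀ ∘ₗ Algebra.lsmul k k E v) (E := E)
    (fun x => by simp [← mul_smul, hvv])
    (fun x => by
      simp only [LinearMap.comp_apply, ζ₀, Algebra.lsmul_coe, ← mul_smul, hvz]
      rw [hlz, smul_zero, map_zero])
  refine ⟨r, fun q => h.ext fun c => ?_⟩
  rw [hr]
  simp only [LinearMap.comp_apply, ζ₀, Algebra.lsmul_coe, ← map_smul, ← mul_smul]
  rw [hl', ← mul_smul, ← mul_assoc, hvv]

/-- A criterion for being coinduced, vertex by vertex. -/
lemma isCoinduced_of_vertices {V : Type} [Fintype V] (e : V → A)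
    (hsum : ∑ x, e x = 1)
    (hz : ∀ q : Q, z • q = 0)
    (h : ∀ x, ((∀ q : Q, e x • q = 0) ∧ ∀ a, ∃ b, v * a * e x = z * b) ∨
      ∃ (c : A) (d : Q), v * c * e x = c ∧ (∀ q : Q, ∃ r : k, e x • q = r • d) ∧
        (∀ a, ∃ (r : k) (b : A), v * a * e x = r • c + z * b) ∧ e x • d = d ∧ ξ (c • d) ≠ 0) :
    IsCoinduced k v z ξ := by
  have hq : ∀ q : Q, q = ∑ x, e x • q := fun q => by rw [← Finset.sum_smul, hsum, one_smul]
  have hA : ∀ a : A, a = ∑ x, a * e x := fun a => by rw [← Finset.mul_sum, hsum, mul_one]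
  refine ⟨hz, fun q h0 => ?_, fun η h1 h2 => ?_⟩
  · rw [hq q]
    refine Finset.sum_eq_zero fun x _ => ?_
    rcases h x with ⟨h3, -⟩ | ⟨c, d, hc, h3, -, h5, h6⟩
    · exact h3 q
    · obtain ⟨r, hr⟩ := h3 q
      have := h0 (c * e x)
      have hd : (v * (c * e x)) • q = r • c • d := by
        have h7 : c • e x • d = c • d := by rw [h5]
        calc (v * (c * e x)) • q = (v * c) • e x • q := by rw [← mul_smul, mul_assoc]
          _ = (v * c) • e x • r • d := by rw [← hr, hr, smul_comm (e x) r d, h5]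
          _ = r • (v * c * e x) • d := by
            rw [smul_comm (e x) r d, smul_comm (v * c) r, ← mul_smul (v * c)]
          _ = _ := by rw [hc]
      rw [hd, map_smul, smul_eq_mul, mul_eq_zero, or_iff_left h6] at this
      rw [hr, this, zero_smul]
  · have key : ∀ x, ∃ q : Q, ∀ a, ξ ((v * a) • q) = η (a * e x) := by
      intro x
      rcases h x with ⟨-, h4⟩ | ⟨c, d, hc, -, h4, h5, h6⟩
      · refine ⟨0, fun a => ?_⟩
        obtain ⟨b, hb⟩ := h4 a
        rw [smul_zero, map_zero, ← h1, ← mul_assoc, hb, h2]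
      · refine ⟨(η c / ξ (c • d)) • d, fun a => ?_⟩
        obtain ⟨r, b, hb⟩ := h4 a
        have h7 : (v * a) • d = r • c • d := by
          rw [← h5, ← mul_smul, hb, add_smul, mul_smul z, hz, add_zero, h5, smul_assoc]
        rw [← h1 (a * e x), ← mul_assoc, hb, map_add, h2, add_zero, smul_comm (v * a), h7, map_smul ξ,
          map_smul ξ r, map_smul η r, smul_eq_mul, smul_eq_mul, smul_eq_mul]
        field_simp
    choose d hd using key
    refine ⟨∑ x, d x, fun c => ?_⟩
    conv_rhs => rw [hA c, map_sum]
    rw [Finset.smul_sum, map_sum]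
    exact Finset.sum_congr rfl fun x _ => hd x c

omit [IsScalarTower k A Q] in
lemma isCoinduced_of_subsingleton [Subsingleton Q] (hvz : v = z) (ξ : Q →ₗ[k] k) :
    IsCoinduced k v z ξ := by
  subst hvz
  refine ⟨fun _ => Subsingleton.elim _ _, fun _ _ => Subsingleton.elim _ _, fun η h1 h2 =>
    ⟨0, fun c => ?_⟩⟩
  rw [smul_zero, map_zero, ← h1, h2]

end Coinduced

section CanonicalPaths

variable {k : Type} [Field k] {t : ℕ} {p : Fin t → ℕ} {lam : Fin t → k}

/-- A representation of the canonical quiver with relations is a module over the canonical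
algebra. -/
lemma exists_canLift {M : Type} [AddCommGroup M] [Module k M] (F : CanGen t p → Module.End k M)
    (h1 : ∀ v, F (Sum.inl v) * F (Sum.inl v) = F (Sum.inl v))
    (h2 : ∀ v w, v ≠ w → F (Sum.inl v) * F (Sum.inl w) = 0)
    (h3 : ∑ v, F (Sum.inl v) = 1)
    (h4 : ∀ a : CanArr t p, F (Sum.inl (arrTgt t p a.1 a.2)) * F (Sum.inr a) = F (Sum.inr a))
    (h5 : ∀ a : CanArr t p, F (Sum.inr a) * F (Sum.inl (arrSrc t p a.1 a.2)) = F (Sum.inr a))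
    (h6 : ∀ i : Fin t, ∀ h : 2 ≤ (i : ℕ),
      (List.ofFn fun j : Fin (p i) => F (Sum.inr ⟨i, j⟩)).reverse.prod =
        (List.ofFn fun j => F (Sum.inr ⟨⟨0, by omega⟩, j⟩)).reverse.prod +
        lam i • (List.ofFn fun j => F (Sum.inr ⟨⟨1, by omega⟩, j⟩)).reverse.prod) :
    ∃ φ : CanAlg k t p lam →ₐ[k] Module.End k M, (∀ v, φ (canE k lam v) = F (Sum.inl v)) ∧
      ∀ i j, ∀ h : j < p i, φ (canArrow k p lam i j) = F (Sum.inr ⟨i, ⟨j, h⟩⟩) := by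
  have hw : ∀ i, FreeAlgebra.lift k F (armWord k t p i) =
      (List.ofFn fun j : Fin (p i) => F (Sum.inr ⟨i, j⟩)).reverse.prod := by
    intro i
    rw [armWord, map_list_prod, List.map_reverse, List.map_ofFn]
    congr 3
    funext j
    simp
  refine ⟨RingQuot.liftAlgHom k ⟨FreeAlgebra.lift k F, ?_⟩, ?_, ?_⟩
  · intro x y hxy
    induction hxy with
    | idem v => simpa using h1 v
    | orth h => simpa using h2 _ _ h
    | sum_one => simpa using h3
    | target a => simpa using h4 a
    | source a => simpa using h5 a
    | canonical i h => rw [map_add, map_smul, hw, hw, hw]; exact h6 i h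
  · intro v
    simp [canE, canIdem]
  · intro i j h
    rw [canArrow, dif_pos h]
    simp

variable (lam) in
/-- The coordinates of `w_i` with respect to `w_0` and `w_1`. -/
def canCoef (i : Fin t) : k × k :=
  if (i : ℕ) = 0 then (1, 0) else if (i : ℕ) = 1 then (0, 1) else (1, lam i)

lemma canCoef_det (hd : IsCanonicalData k t p lam) {i j : Fin t} (hij : i ≠ j) :
    (canCoef lam i).1 * (canCoef lam j).2 - (canCoef lam i).2 * (canCoef lam j).1 ≠ 0 := by
  obtain ⟨-, -, -, h1, h2⟩ := hd
  have hij' : (i : ℕ) ≠ j := fun h => hij (Fin.ext h)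
  unfold canCoef
  split_ifs with ha hb hc hd he hf hg hh
  all_goals first
    | omega
    | (simp; done)
    | skip
  · simpa using h1 j (by omega)
  · simpa using h1 i (by omega)
  · simp only [one_mul, mul_one, ne_eq, sub_eq_zero]
    exact fun h => hij (h2 j i (by omega) (by omega) h).symm

lemma canW_eq_coef (hd : IsCanonicalData k t p lam) (i : Fin t) :
    canW k p lam i = (canCoef lam i).1 • canW k p lam ⟨0, by have := hd.1; omega⟩ +
      (canCoef lam i).2 • canW k p lam ⟨1, by have := hd.1; omega⟩ := by
  unfold canCoef
  split_ifs with h1 h2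
  · have : i = ⟨0, by omega⟩ := Fin.ext h1
    simp [this]
  · have : i = ⟨1, by omega⟩ := Fin.ext h2
    simp [this]
  · rw [one_smul]
    exact canW_eq hd.2.1 i (by omega)

lemma canW_mem_span (hd : IsCanonicalData k t p lam) {i j : Fin t} (hij : i ≠ j) (l : Fin t) :
    ∃ r s : k, canW k p lam l = r • canW k p lam i + s • canW k p lam j := by
  have hD := canCoef_det hd hij
  set D := (canCoef lam i).1 * (canCoef lam j).2 - (canCoef lam i).2 * (canCoef lam j).1 with hDD
  have key : D • canW k p lam l =
      ((canCoef lam l).1 * (canCoef lam j).2 - (canCoef lam l).2 * (canCoef lam j).1) •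
        canW k p lam i +
      ((canCoef lam i).1 * (canCoef lam l).2 - (canCoef lam i).2 * (canCoef lam l).1) •
        canW k p lam j := by
    rw [canW_eq_coef hd l, canW_eq_coef hd i, canW_eq_coef hd j, hDD]
    module
  refine ⟨D⁻¹ * ((canCoef lam l).1 * (canCoef lam j).2 - (canCoef lam l).2 * (canCoef lam j).1),
    D⁻¹ * ((canCoef lam i).1 * (canCoef lam l).2 - (canCoef lam i).2 * (canCoef lam l).1), ?_⟩
  rw [mul_smul, mul_smul, ← smul_add, ← key, smul_smul, inv_mul_cancel₀ hD, one_smul]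

/-- The arrows of an arm act by scalars, the last one of arm `i` by `c i` and the others by `1`. -/
lemma exists_functional (hd : IsCanonicalData k t p lam) (a b : k) :
    ∃ φ : CanAlg k t p lam →ₗ[k] k, ∀ l, φ (canW k p lam l) =
      (canCoef lam l).1 * a + (canCoef lam l).2 * b := by
  classical
  set c : Fin t → k := fun l => (canCoef lam l).1 * a + (canCoef lam l).2 * b with hc
  let σ : CanVert t p → k →ₗ[k] (CanVert t p → k) := fun v => LinearMap.single k (fun _ => k) v
  let π : CanVert t p → (CanVert t p → k) →ₗ[k] k := fun v => LinearMap.proj v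
  have hπσ : ∀ v, π v ∘ₗ σ v = LinearMap.id := fun v => LinearMap.proj_comp_single_same k _ v
  have hπσ' : ∀ v w, v ≠ w → π v ∘ₗ σ w = 0 := fun v w h =>
    LinearMap.proj_comp_single_ne k _ v w h
  let s : (i : Fin t) → ℕ → k := fun i j => if j = p i then c i else 1
  let F : CanGen t p → Module.End k (CanVert t p → k) := Sum.elim (fun v => σ v ∘ₗ π v)
    (fun x => (if (x.2 : ℕ) + 1 = p x.1 then c x.1 else 1) •
      (σ (arrTgt t p x.1 x.2) ∘ₗ π (arrSrc t p x.1 x.2)))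
  have hp := hd.2.1
  have hmul : ∀ u v w, (σ u ∘ₗ π v) ∘ₗ (σ v ∘ₗ π w) = σ u ∘ₗ π w := fun u v w => by
    rw [LinearMap.comp_assoc, ← LinearMap.comp_assoc _ _ (π v), hπσ, LinearMap.id_comp]
  have hword : ∀ i : Fin t, (List.ofFn fun j : Fin (p i) => F (Sum.inr ⟨i, j⟩)).reverse.prod =
      c i • (σ (canSink t p) ∘ₗ π (canSource t p)) := by
    intro i
    have key : ∀ n (hn : n ≤ p i), 1 ≤ n →
        ((List.ofFn fun j : Fin n => F (Sum.inr ⟨i, ⟨j, j.2.trans_le hn⟩⟩)).reverse).prod =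
        s i n • (σ (canPos p i n) ∘ₗ π (canSource t p)) := by
      intro n hn h1
      induction n with
      | zero => omega
      | succ n ih =>
        rw [List.ofFn_succ', List.concat_eq_append, List.reverse_append, List.prod_append]
        simp only [List.reverse_singleton, List.prod_singleton]
        have hF : F (Sum.inr ⟨i, ⟨n, hn⟩⟩) = s i (n + 1) •
            (σ (canPos p i (n + 1)) ∘ₗ π (canPos p i n)) := by
          simp only [F, Sum.elim_inr, arrTgt_eq, arrSrc_eq, s]
        rcases Nat.eq_zero_or_pos n with rfl | hn'
        · simp only [List.ofFn_zero, List.reverse_nil, List.prod_nil, mul_one, Fin.last]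
          rw [hF, canPos_zero]
        · have ih' := ih (by omega) hn'
          have hs : s i n = 1 := if_neg (by omega)
          rw [hs, one_smul] at ih'
          refine (congrArg₂ (· * ·) hF ih').trans ?_
          show (_ • _) ∘ₗ _ = _
          rw [LinearMap.smul_comp, hmul]
    have := key (p i) le_rfl (hp i)
    rw [canPos_last hp] at this
    rw [this]
    simp [s]
  obtain ⟨φ, h1, h2⟩ := exists_canLift (lam := lam) F
    (fun v => hmul v v v)
    (fun v w h => by
      show (σ v ∘ₗ π v) ∘ₗ (σ w ∘ₗ π w) = 0
      rw [LinearMap.comp_assoc, ← LinearMap.comp_assoc _ _ (π v), hπσ' _ _ h, LinearMap.zero_comp,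
        LinearMap.comp_zero])
    (by
      refine LinearMap.ext fun f => ?_
      simp only [F, Sum.elim_inl, LinearMap.sum_apply, LinearMap.comp_apply, Module.End.one_apply]
      exact LinearMap.sum_single_apply _ f)
    (fun x => by
      show (σ _ ∘ₗ π _) ∘ₗ (_ • _) = _ • _
      rw [LinearMap.comp_smul, hmul])
    (fun x => by
      show (_ • _) ∘ₗ (σ _ ∘ₗ π _) = _ • _
      rw [LinearMap.smul_comp, hmul])
    (fun i h => by
      rw [hword, hword, hword, smul_smul, ← add_smul]
      congr 1
      have : ¬ (i : ℕ) = 0 := by omega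
      have : ¬ (i : ℕ) = 1 := by omega
      simp [canCoef, *])
  refine ⟨π (canSink t p) ∘ₗ LinearMap.applyₗ (σ (canSource t p) 1) ∘ₗ φ.toLinearMap, fun l => ?_⟩
  have : φ (canW k p lam l) = c l • (σ (canSink t p) ∘ₗ π (canSource t p)) := by
    rw [← hword]
    have key : ∀ n (hn : n ≤ p l), 1 ≤ n → φ (canPath k p lam l 0 n) =
        ((List.ofFn fun j : Fin n => F (Sum.inr ⟨l, ⟨j, j.2.trans_le hn⟩⟩)).reverse).prod := by
      intro n hn h1
      induction n with
      | zero => omega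
      | succ n ih =>
        rw [List.ofFn_succ', List.concat_eq_append, List.reverse_append, List.prod_append]
        simp only [List.reverse_singleton, List.prod_singleton]
        rcases Nat.eq_zero_or_pos n with rfl | hn'
        · simp only [List.ofFn_zero, List.reverse_nil, List.prod_nil, mul_one, Fin.last]
          exact (congrArg φ (canPath_one l 0)).trans (h2 l 0 hn)
        · rw [canPath, map_mul, zero_add, h2 l n hn, ih (by omega) hn']
          rfl
    exact key _ le_rfl (hp l)
  simp only [LinearMap.comp_apply, AlgHom.toLinearMap_apply, LinearMap.applyₗ_apply_apply, this]
  have e1 : π (canSource t p) (σ (canSource t p) 1) = 1 :=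
    LinearMap.congr_fun (hπσ (canSource t p)) 1
  have e2 : π (canSink t p) (σ (canSink t p) 1) = 1 := LinearMap.congr_fun (hπσ (canSink t p)) 1
  show π (canSink t p) (c l • σ (canSink t p) (π (canSource t p) (σ (canSource t p) 1))) = _
  rw [e1, map_smul, e2, smul_eq_mul, mul_one]

lemma canW_ne_smul (hd : IsCanonicalData k t p lam) {i j : Fin t} (hij : i ≠ j) (r : k) :
    canW k p lam i ≠ r • canW k p lam j := by
  intro h
  obtain ⟨φ, hφ⟩ := exists_functional hd (canCoef lam j).2 (-(canCoef lam j).1)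
  have := congrArg φ h
  rw [map_smul, hφ, hφ] at this
  apply canCoef_det hd hij
  rw [smul_eq_mul] at this
  linear_combination this

lemma exists_arm_ne (hd : IsCanonicalData k t p lam) (i : Fin t) : ∃ j, i ≠ j := by
  have := hd.1
  have : Nontrivial (Fin t) := Fin.nontrivial_iff_two_le.2 this
  obtain ⟨j, hj⟩ := exists_ne i
  exact ⟨j, hj.symm⟩

lemma canW_ne_zero (hd : IsCanonicalData k t p lam) (i : Fin t) : canW k p lam i ≠ 0 := by
  obtain ⟨j, hij⟩ := exists_arm_ne hd i
  simpa using canW_ne_smul hd hij 0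

lemma canPath_ne_zero (hd : IsCanonicalData k t p lam) {i : Fin t} {j n : ℕ} (h : j + n ≤ p i) :
    canPath k p lam i j n ≠ 0 := by
  intro h0
  apply canW_ne_zero hd i
  obtain ⟨m, hm⟩ : ∃ m, p i = j + (n + m) := ⟨p i - (j + n), by omega⟩
  have h1 := canPath_mul (k := k) (p := p) (lam := lam) i 0 j (n + m)
  have h2 := canPath_mul (k := k) (p := p) (lam := lam) i j n m
  rw [canW, hm, ← h1, zero_add, ← h2, h0, mul_zero, zero_mul]

/-- The paths starting at a vertex other than the source. -/
lemma corner_internal (hd : IsCanonicalData k t p lam) (i : Fin t) {a : ℕ} (ha : 1 ≤ a)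
    (ha' : a ≤ p i) (y : CanVert t p) (c : CanAlg k t p lam) :
    canE k lam y * c * canE k lam (canPos p i a) = 0 ∨
      ∃ (r : k) (n : ℕ), a + n ≤ p i ∧ canPos p i (a + n) = y ∧
        canE k lam y * c * canE k lam (canPos p i a) = r • canPath k p lam i a n := by
  have hp := hd.2.1
  have ht : 0 < t := by have := hd.1; omega
  have key : ∀ i' j n, j + n ≤ p i' → canPos p i' j = canPos p i a → canPos p i' (j + n) = y →
      canPath k p lam i' j n = canPath k p lam i a n ∧ a + n ≤ p i ∧ canPos p i (a + n) = y := by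
    intro i' j n h h1 h2
    rcases canPos_eq hp (by omega) ha' h1 with ⟨-, h3⟩ | ⟨h3, h4⟩ | ⟨rfl, rfl⟩
    · omega
    · obtain rfl : n = 0 := by omega
      refine ⟨?_, by omega, ?_⟩
      · rw [canPath, canPath, h1]
      · rw [add_zero, ← h1]; exact h2
    · exact ⟨rfl, h, h2⟩
  by_cases hex : ∃ n, a + n ≤ p i ∧ canPos p i (a + n) = y
  · obtain ⟨n, hn, hy⟩ := hex
    right
    have : canE k lam y * c * canE k lam (canPos p i a) ∈
        Submodule.span k {canPath k p lam i a n} := by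
      refine corner_mem ht hp _ _ _ (fun i' j m h h1 h2 => ?_) c
      obtain ⟨h3, h4, h5⟩ := key i' j m h h1 h2
      have : n = m := by
        rcases canPos_eq hp h4 hn (h5.trans hy.symm) with h | h | h <;> omega
      rw [h3, this]
      exact Submodule.mem_span_singleton_self _
    obtain ⟨r, hr⟩ := Submodule.mem_span_singleton.1 this
    exact ⟨r, n, hn, hy, hr.symm⟩
  · left
    refine (Submodule.mem_bot k).1 (corner_mem ht hp _ _ ⊥ (fun i' j m h h1 h2 => ?_) c)
    obtain ⟨-, h4, h5⟩ := key i' j m h h1 h2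
    exact absurd ⟨m, h4, h5⟩ hex

lemma eq_zero_of_corners {x : CanAlg k t p lam} (h : ∀ y, canE k lam y * x = 0) : x = 0 := by
  rw [← one_mul x, ← sum_canE, Finset.sum_mul]
  exact Finset.sum_eq_zero fun y _ => h y

lemma mul_canPath_injective (hd : IsCanonicalData k t p lam) (i : Fin t) {a n : ℕ} (ha : 1 ≤ a + n)
    (ha' : a + n ≤ p i) {x : CanAlg k t p lam} (hx : x * canE k lam (canPos p i (a + n)) = x)
    (h0 : x * canPath k p lam i a n = 0) : x = 0 := by
  refine eq_zero_of_corners fun y => ?_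
  rcases corner_internal hd i ha ha' y x with h | ⟨r, m, h1, h2, h3⟩
  · rw [← hx, ← mul_assoc, h]
  · have h4 : canE k lam y * x = r • canPath k p lam i (a + n) m := by
      rw [← h3, mul_assoc, hx]
    have h5 := congrArg (canE k lam y * ·) h0
    simp only [← mul_assoc, h4, mul_zero, smul_mul_assoc, canPath_mul] at h5
    rw [h4, (smul_eq_zero.1 h5).resolve_right (canPath_ne_zero hd (by omega)), zero_smul]

end CanonicalPaths

section CoinducedTypes

variable {k : Type} [Field k] {t : ℕ} {p : Fin t → ℕ} {lam : Fin t → k}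

lemma canPos_eq_source (hp : ∀ i, 1 ≤ p i) {i : Fin t} {j : ℕ} (hj : j ≤ p i)
    (h : canPos p i j = canSource t p) : j = 0 := by
  rw [← canPos_zero i] at h
  have := hp i
  rcases canPos_eq hp hj (Nat.zero_le _) h with h | h | h <;> omega

lemma canPos_eq_sink (hp : ∀ i, 1 ≤ p i) {i : Fin t} {j : ℕ} (hj : j ≤ p i)
    (h : canPos p i j = canSink t p) : j = p i := by
  rw [← canPos_last hp i] at h
  rcases canPos_eq hp hj le_rfl h with h | h | h <;> omega

lemma IsCanonicalData.pos (hd : IsCanonicalData k t p lam) : 0 < t := by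
  have := hd.1
  omega

variable {Q : Type} [AddCommGroup Q] [Module (CanAlg k t p lam) Q]

lemma corner_smul_mem [Module k Q] [IsScalarTower k (CanAlg k t p lam) Q]
    (hd : IsCanonicalData k t p lam) {x y : CanVert t p} {q₀ : Q}
    (hq : canE k lam x • q₀ = q₀) (S : Submodule k Q)
    (hS : ∀ i j n, j + n ≤ p i → canPos p i j = x → canPos p i (j + n) = y →
      canPath k p lam i j n • q₀ ∈ S) (c : CanAlg k t p lam) :
    canE k lam y • c • q₀ ∈ S := by
  have := corner_mem hd.pos hd.2.1 x y
    (S.comap ((LinearMap.toSpanSingleton (CanAlg k t p lam) Q q₀).restrictScalars k))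
    (fun i j n h h1 h2 => hS i j n h h1 h2) c
  have h : (canE k lam y * c * canE k lam x) • q₀ ∈ S := this
  rwa [mul_smul, hq, mul_smul] at h

lemma exists_functional_ne [Module k Q] {q : Q} (hq : q ≠ 0) : ∃ ξ : Q →ₗ[k] k, ξ q ≠ 0 := by
  by_contra! h
  exact hq ((Module.forall_dual_apply_eq_zero_iff k q).1 h)

lemma canPath_smul_eq_zero {i : Fin t} {a m n : ℕ} (hmn : m ≤ n) {q : Q}
    (h : canPath k p lam i a m • q = 0) : canPath k p lam i a n • q = 0 := by
  obtain ⟨l, rfl⟩ := Nat.exists_eq_add_of_le hmn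
  rw [← canPath_mul, mul_smul, h, smul_zero]

/-- Uniserial modules supported on the inner vertices of an arm. -/
lemma isCoinduced_interval [Module k Q] [IsScalarTower k (CanAlg k t p lam) Q]
    (hd : IsCanonicalData k t p lam) {i : Fin t} {a m : ℕ} (h : a + (m + 1) + 1 ≤ p i)
    {q₀ : Q} (hgen : ∀ q : Q, ∃ c : CanAlg k t p lam, q = c • q₀)
    (hq : canE k lam (canPos p i (a + 1)) • q₀ = q₀)
    (h0 : canPath k p lam i (a + 1) (m + 1) • q₀ = 0)
    (h1 : canPath k p lam i (a + 1) m • q₀ ≠ 0) :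
    ∃ ξ : Q →ₗ[k] k, IsCoinduced k (canE k lam (canPos p i (a + (m + 1))))
      (canPath k p lam i a (m + 1)) ξ := by
  have hp := hd.2.1
  obtain ⟨ξ, hξ⟩ := exists_functional_ne (k := k) h1
  refine ⟨ξ, ?_⟩
  have hE : ∀ (q : Q) x, canE k lam x • q = 0 ∨ ∃ (r : k) (n : ℕ), n ≤ m ∧
      x = canPos p i (a + 1 + n) ∧ canE k lam x • q = r • canPath k p lam i (a + 1) n • q₀ := by
    intro q x
    obtain ⟨c, rfl⟩ := hgen q
    have hc : canE k lam x • c • q₀ =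
        (canE k lam x * c * canE k lam (canPos p i (a + 1))) • q₀ := by
      rw [mul_smul, hq, mul_smul]
    rw [hc]
    rcases corner_internal hd i (by omega : 1 ≤ a + 1) (by omega) x c with h2 | ⟨r, n, h2, h3, h4⟩
    · left; rw [h2, zero_smul]
    · by_cases hn : n ≤ m
      · exact Or.inr ⟨r, n, hn, h3.symm, by rw [h4, smul_assoc]⟩
      · left
        rw [h4, smul_assoc, canPath_smul_eq_zero (by omega : m + 1 ≤ n) h0, smul_zero]
  refine isCoinduced_of_vertices (fun x => canE k lam x) sum_canE ?_ ?_
  · intro q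
    rw [← canPath_mul_canE, mul_smul]
    rcases hE q (canPos p i a) with h2 | ⟨r, n, hn, h2, -⟩
    · rw [h2, smul_zero]
    · rcases canPos_eq hp (by omega) (by omega) h2 with h | h | h <;> omega
  · intro x
    by_cases hx : ∃ n ≤ m, x = canPos p i (a + 1 + n)
    · right
      obtain ⟨n, hn, rfl⟩ := hx
      obtain ⟨l, rfl⟩ := Nat.exists_eq_add_of_le hn
      have e1 : a + (n + l + 1) = a + 1 + n + l := by omega
      refine ⟨canPath k p lam i (a + 1 + n) l, canPath k p lam i (a + 1) n • q₀, ?_, ?_, ?_, ?_, ?_⟩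
      · rw [e1, canE_mul_canPath, canPath_mul_canE]
      · intro q
        rcases hE q (canPos p i (a + 1 + n)) with h2 | ⟨r, n', hn', h2, h3⟩
        · exact ⟨0, by rw [h2, zero_smul]⟩
        · have : n' = n := by
            rcases canPos_eq hp (by omega) (by omega) h2 with h | h | h <;> omega
          exact ⟨r, by rw [h3, this]⟩
      · intro c
        rcases corner_internal hd i (by omega : 1 ≤ a + 1 + n) (by omega)
          (canPos p i (a + (n + l + 1))) c with h2 | ⟨r, l', h2, h3, h4⟩
        · exact ⟨0, 0, by rw [h2, zero_smul, mul_zero, add_zero]⟩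
        · have : l' = l := by
            rcases canPos_eq hp (by omega) (by omega) h3 with h | h | h <;> omega
          exact ⟨r, 0, by rw [h4, this, mul_zero, add_zero]⟩
      · rw [← mul_smul, canE_mul_canPath]
      · rwa [← mul_smul, canPath_mul]
    · left
      refine ⟨fun q => ?_, fun c => ?_⟩
      · rcases hE q x with h2 | ⟨r, n, hn, h2, -⟩
        · exact h2
        · exact absurd ⟨n, hn, h2⟩ hx
      · have := corner_mem hd.pos hp x (canPos p i (a + (m + 1)))
          (LinearMap.range (LinearMap.mulLeft k (canPath k p lam i a (m + 1)))) ?_ c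
        · obtain ⟨b, hb⟩ := this
          exact ⟨b, hb.symm⟩
        · intro i' j n hjn h2 h3
          rcases canPos_eq hp hjn (by omega) h3 with h4 | h4 | ⟨rfl, h4⟩
          · omega
          · omega
          · have hj : j ≤ a := by
              by_contra hja
              obtain ⟨l, hl⟩ : ∃ l, j = a + 1 + l := ⟨j - (a + 1), by omega⟩
              exact hx ⟨l, by omega, by rw [← hl, h2]⟩
            obtain ⟨l, rfl⟩ := Nat.exists_eq_add_of_le hj
            refine ⟨canPath k p lam i' j l, ?_⟩
            have : n = l + (m + 1) := by omega
            rw [LinearMap.mulLeft_apply, canPath_mul, this]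

/-- The modules generated at the source, killed by the first arrow of one arm only. -/
lemma isCoinduced_top [Module k Q] [IsScalarTower k (CanAlg k t p lam) Q]
    (hd : IsCanonicalData k t p lam) {i i₁ : Fin t} (hi : i₁ ≠ i)
    {q₀ : Q} (hgen : ∀ q : Q, ∃ c : CanAlg k t p lam, q = c • q₀)
    (hq : canE k lam (canSource t p) • q₀ = q₀) (h0 : canArrow k p lam i 0 • q₀ = 0)
    (h1 : canW k p lam i₁ • q₀ ≠ 0) :
    ∃ ξ : Q →ₗ[k] k, IsCoinduced k (canE k lam (canSink t p)) (canArrow k p lam i (p i - 1)) ξ := by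
  have hp := hd.2.1
  obtain ⟨ξ, hξ⟩ := exists_functional_ne (k := k) h1
  refine ⟨ξ, ?_⟩
  have hpi := hp i
  have hk : ∀ n, 1 ≤ n → canPath k p lam i 0 n • q₀ = 0 := fun n hn =>
    canPath_smul_eq_zero hn (by rwa [canPath_one])
  have hξ' : ∀ l, l ≠ i → ξ (canW k p lam l • q₀) ≠ 0 := by
    intro l hl hl0
    obtain ⟨r, s, hrs⟩ := canW_mem_span hd hl i₁
    apply hξ
    rw [hrs, add_smul, smul_assoc, smul_assoc, hk _ hpi, smul_zero, add_zero, map_smul, hl0,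
      smul_zero]
  have hsrc : ∀ {i₃ j}, j ≤ p i₃ → canPos p i₃ j = canSource t p → j = 0 := canPos_eq_source hp
  have hwE : canE k lam (canSink t p) * canW k p lam i₁ = canW k p lam i₁ := by
    have := canE_mul_canPath (k := k) (p := p) (lam := lam) i₁ 0 (p i₁)
    rwa [zero_add, canPos_last hp] at this
  have hw : canW k p lam i = canArrow k p lam i (p i - 1) * canPath k p lam i 0 (p i - 1) := by
    have := canPath_mul (k := k) (p := p) (lam := lam) i 0 (p i - 1) 1
    rw [zero_add, canPath_one, Nat.sub_add_cancel hpi] at this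
    exact this.symm
  refine isCoinduced_of_vertices (fun x => canE k lam x) sum_canE ?_ ?_
  · intro q
    obtain ⟨c, rfl⟩ := hgen q
    rw [← canArrow_mul_canE, mul_smul]
    refine (Submodule.mem_bot k).1 (corner_smul_mem hd hq
      (LinearMap.ker (Algebra.lsmul k k Q (canArrow k p lam i (p i - 1)))) ?_ c)
    intro i₃ j n hjn h2 h3
    obtain rfl := hsrc (by omega) h2
    rw [zero_add] at hjn h3
    have key : canArrow k p lam i (p i - 1) • canPath k p lam i 0 (p i - 1) • q₀ = 0 := by
      rw [← mul_smul, ← hw, hk _ hpi]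
    rcases canPos_eq hp hjn (by omega) h3 with ⟨h4, h5⟩ | h4 | ⟨rfl, h4⟩
    · rw [h5] at key
      subst h4
      show canArrow k p lam i (p i - 1) • canPath k p lam i₃ 0 0 • q₀ = 0
      have : canPath k p lam i₃ 0 0 = canPath k p lam i 0 0 := by
        rw [canPath, canPath, canPos_zero, canPos_zero]
      rw [this, h5]
      exact key
    · omega
    · rw [h4]
      exact key
  · intro x
    by_cases hx0 : x = canSource t p
    · subst hx0
      refine Or.inr ⟨canW k p lam i₁, q₀, ?_, ?_, ?_, hq, hξ⟩
      · have h2 := canPath_mul_canE (k := k) (p := p) (lam := lam) i₁ 0 (p i₁)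
        rw [canPos_zero] at h2
        rw [mul_assoc, h2, hwE]
      · intro q
        obtain ⟨c, rfl⟩ := hgen q
        have := corner_smul_mem hd hq (y := canSource t p) (Submodule.span k {q₀}) ?_ c
        · obtain ⟨r, hr⟩ := Submodule.mem_span_singleton.1 this
          exact ⟨r, hr.symm⟩
        · intro i₃ j n hjn h2 h3
          obtain ⟨rfl, rfl⟩ : j = 0 ∧ n = 0 := by have := hsrc hjn h3; omega
          rw [canPath, h2, hq]
          exact Submodule.mem_span_singleton_self _
      · intro c
        have := corner_mem hd.pos hp (canSource t p) (canSink t p)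
          (Submodule.span k {canW k p lam i₁} ⊔
            LinearMap.range (LinearMap.mulLeft k (canArrow k p lam i (p i - 1)))) ?_ c
        · obtain ⟨y, hy, z, ⟨b, rfl⟩, hyz⟩ := Submodule.mem_sup.1 this
          obtain ⟨r, rfl⟩ := Submodule.mem_span_singleton.1 hy
          exact ⟨r, b, hyz.symm⟩
        · intro i₃ j n hjn h2 h3
          obtain rfl := hsrc (by omega) h2
          rw [zero_add] at h3 hjn
          obtain rfl := canPos_eq_sink hp hjn h3
          obtain ⟨r, s, hrs⟩ := canW_mem_span hd hi i₃
          change canW k p lam i₃ ∈ _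
          rw [hrs]
          refine Submodule.add_mem _ (Submodule.smul_mem _ _ (Submodule.mem_sup_left
            (Submodule.mem_span_singleton_self _))) (Submodule.smul_mem _ _ (Submodule.mem_sup_right
            ⟨_, hw.symm⟩))
    · by_cases hxω : x = canSink t p
      · subst hxω
        refine Or.inr ⟨canE k lam (canSink t p), canW k p lam i₁ • q₀, ?_, ?_, ?_, ?_, ?_⟩
        · rw [canE_mul_self, canE_mul_self]
        · intro q
          obtain ⟨c, rfl⟩ := hgen q
          have := corner_smul_mem hd hq (y := canSink t p)
            (Submodule.span k {canW k p lam i₁ • q₀}) ?_ c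
          · obtain ⟨r, hr⟩ := Submodule.mem_span_singleton.1 this
            exact ⟨r, hr.symm⟩
          · intro i₃ j n hjn h2 h3
            obtain rfl := hsrc (by omega) h2
            rw [zero_add] at h3 hjn
            obtain rfl := canPos_eq_sink hp hjn h3
            obtain ⟨r, s, hrs⟩ := canW_mem_span hd hi i₃
            change canW k p lam i₃ • q₀ ∈ _
            rw [hrs, add_smul, smul_assoc, smul_assoc, hk _ hpi, smul_zero, add_zero]
            exact Submodule.smul_mem _ _ (Submodule.mem_span_singleton_self _)
        · intro c
          have := corner_mem hd.pos hp (canSink t p) (canSink t p)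
            (Submodule.span k {canE k lam (canSink t p)}) ?_ c
          · obtain ⟨r, hr⟩ := Submodule.mem_span_singleton.1 this
            exact ⟨r, 0, by rw [hr, mul_zero, add_zero]⟩
          · intro i₃ j n hjn h2 h3
            have h4 := canPos_eq_sink hp (by omega) h2
            obtain rfl : n = 0 := by omega
            rw [canPath, h2]
            exact Submodule.mem_span_singleton_self _
        · rw [← mul_smul, hwE]
        · rwa [← mul_smul, hwE]
      · obtain ⟨i₃, j, hj, rfl⟩ := canVert_cases hd.pos hp x
        have hj0 : 1 ≤ j := by
          rcases Nat.eq_zero_or_pos j with rfl | h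
          · exact absurd (canPos_zero i₃) hx0
          · exact h
        have hjp : j < p i₃ := by
          refine lt_of_le_of_ne hj ?_
          rintro rfl
          exact hxω (canPos_last hp i₃)
        have hpath : ∀ i'' j' n, j' + n ≤ p i'' → canPos p i'' j' = canSource t p →
            canPos p i'' (j' + n) = canPos p i₃ j → i'' = i₃ ∧ j' = 0 ∧ n = j := by
          intro i'' j' n hjn h2 h3
          obtain rfl := hsrc (by omega) h2
          rcases canPos_eq hp hjn hj h3 with h4 | h4 | ⟨rfl, h4⟩
          · omega
          · omega
          · exact ⟨rfl, rfl, by omega⟩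
        obtain ⟨l, hl⟩ := Nat.exists_eq_add_of_le hj
        by_cases hii : i₃ = i
        · subst hii
          refine Or.inl ⟨fun q => ?_, fun c => ?_⟩
          · obtain ⟨c, rfl⟩ := hgen q
            refine (Submodule.mem_bot k).1 (corner_smul_mem hd hq ⊥ ?_ c)
            intro i'' j' n hjn h2 h3
            obtain ⟨rfl, rfl, rfl⟩ := hpath i'' j' n hjn h2 h3
            exact hk n hj0
          · rcases corner_internal hd i₃ hj0 hj (canSink t p) c with h2 | ⟨r, n, h2, h3, h4⟩
            · exact ⟨0, by rw [h2, mul_zero]⟩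
            · have hn := canPos_eq_sink hp h2 h3
              obtain ⟨n, rfl⟩ : ∃ n', n = n' + 1 := ⟨n - 1, by omega⟩
              refine ⟨r • canPath k p lam i₃ j n, ?_⟩
              rw [h4, canPath, mul_smul_comm]
              congr 3
              omega
        · refine Or.inr ⟨canPath k p lam i₃ j l, canPath k p lam i₃ 0 j • q₀, ?_, ?_, ?_, ?_, ?_⟩
          · rw [← canPos_last hp i₃, hl, canE_mul_canPath, canPath_mul_canE]
          · intro q
            obtain ⟨c, rfl⟩ := hgen q
            have := corner_smul_mem hd hq (y := canPos p i₃ j)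
              (Submodule.span k {canPath k p lam i₃ 0 j • q₀}) ?_ c
            · obtain ⟨r, hr⟩ := Submodule.mem_span_singleton.1 this
              exact ⟨r, hr.symm⟩
            · intro i'' j' n hjn h2 h3
              obtain ⟨rfl, rfl, rfl⟩ := hpath i'' j' n hjn h2 h3
              exact Submodule.mem_span_singleton_self _
          · intro c
            rcases corner_internal hd i₃ hj0 hj (canSink t p) c with h2 | ⟨r, n, h2, h3, h4⟩
            · exact ⟨0, 0, by rw [h2, zero_smul, mul_zero, add_zero]⟩
            · have hn := canPos_eq_sink hp h2 h3
              obtain rfl : n = l := by omega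
              exact ⟨r, 0, by rw [h4, mul_zero, add_zero]⟩
          · have := canE_mul_canPath (k := k) (p := p) (lam := lam) i₃ 0 j
            rw [zero_add] at this
            rw [← mul_smul, this]
          · have := canPath_mul (k := k) (p := p) (lam := lam) i₃ 0 j l
            rw [zero_add, ← hl] at this
            rw [← mul_smul, this]
            exact hξ' i₃ hii

/-- The simple module at the source. -/
lemma isCoinduced_source [Module k Q] [IsScalarTower k (CanAlg k t p lam) Q]
    (hd : IsCanonicalData k t p lam)
    {q₀ : Q} (hgen : ∀ q : Q, ∃ c : CanAlg k t p lam, q = c • q₀)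
    (hq : canE k lam (canSource t p) • q₀ = q₀) (h0 : ∀ i, canArrow k p lam i 0 • q₀ = 0)
    (h1 : q₀ ≠ 0) :
    ∃ ξ : Q →ₗ[k] k, IsCoinduced k (canE k lam (canSource t p)) 0 ξ := by
  have hp := hd.2.1
  obtain ⟨ξ, hξ⟩ := exists_functional_ne (k := k) h1
  refine ⟨ξ, isCoinduced_of_vertices (fun x => canE k lam x) sum_canE (fun q => zero_smul _ q)
    fun x => ?_⟩
  have hsrc : ∀ {i' j}, j ≤ p i' → canPos p i' j = canSource t p → j = 0 := canPos_eq_source hp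
  by_cases hx0 : x = canSource t p
  · subst hx0
    refine Or.inr ⟨canE k lam (canSource t p), q₀, ?_, ?_, ?_, hq, by rwa [hq]⟩
    · rw [canE_mul_self, canE_mul_self]
    · intro q
      obtain ⟨c, rfl⟩ := hgen q
      have := corner_smul_mem hd hq (y := canSource t p) (Submodule.span k {q₀}) ?_ c
      · obtain ⟨r, hr⟩ := Submodule.mem_span_singleton.1 this
        exact ⟨r, hr.symm⟩
      · intro i' j n hjn h2 h3
        obtain ⟨rfl, rfl⟩ : j = 0 ∧ n = 0 := by have := hsrc hjn h3; omega
        rw [canPath, h2, hq]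
        exact Submodule.mem_span_singleton_self _
    · intro c
      have := corner_mem hd.pos hp (canSource t p) (canSource t p)
        (Submodule.span k {canE k lam (canSource t p)}) ?_ c
      · obtain ⟨r, hr⟩ := Submodule.mem_span_singleton.1 this
        exact ⟨r, 0, by rw [hr, mul_zero, add_zero]⟩
      · intro i' j n hjn h2 h3
        obtain ⟨rfl, rfl⟩ : j = 0 ∧ n = 0 := by have := hsrc hjn h3; omega
        rw [canPath, h2]
        exact Submodule.mem_span_singleton_self _
  · refine Or.inl ⟨fun q => ?_, fun c => ⟨0, ?_⟩⟩
    · obtain ⟨c, rfl⟩ := hgen q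
      refine (Submodule.mem_bot k).1 (corner_smul_mem hd hq ⊥ ?_ c)
      intro i' j n hjn h2 h3
      obtain rfl := hsrc (by omega) h2
      have hn : 1 ≤ n := by
        rcases Nat.eq_zero_or_pos n with rfl | h
        · exact absurd (h3.symm.trans (canPos_zero i')) hx0
        · exact h
      exact canPath_smul_eq_zero hn (by rw [canPath_one, h0])
    · rw [mul_zero]
      refine (Submodule.mem_bot k).1 (corner_mem hd.pos hp _ _ ⊥ (fun i' j n hjn h2 h3 => ?_) c)
      obtain ⟨rfl, rfl⟩ : j = 0 ∧ n = 0 := by have := hsrc hjn h3; omega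
      exact absurd (h2.symm.trans h3) hx0

end CoinducedTypes

section VertexDimension

variable {k : Type} [Field k] {A : Type} [Ring A] [Algebra k A]

lemma vdim_of_isSES [FiniteDimensional k A] {e : A} (he : e * e = e) {X Y Z : Type}
    [AddCommGroup X] [Module A X] [AddCommGroup Y] [Module A Y] [AddCommGroup Z] [Module A Z]
    [Module.Finite A Y] {f : X →ₗ[A] Y} {g : Y →ₗ[A] Z} (h : IsSES A f g) :
    vdim k A e Y = vdim k A e X + vdim k A e Z := by
  let _ := kmod k A X
  let _ := kmod k A Y
  let _ := kmod k A Z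
  have := kmod_tower k A X
  have := kmod_tower k A Y
  have := kmod_tower k A Z
  have : FiniteDimensional k Y := Module.Finite.trans A Y
  let r (M : Type) [AddCommGroup M] [Module A M] [Module k M] [IsScalarTower k A M] :
      Submodule k M := LinearMap.range (Algebra.lsmul k k M e)
  let f' : r X →ₗ[k] r Y := (f.restrictScalars k).restrict (by
    rintro _ ⟨x, rfl⟩
    exact ⟨f x, (f.map_smul e x).symm⟩)
  let g' : r Y →ₗ[k] r Z := (g.restrictScalars k).restrict (by
    rintro _ ⟨x, rfl⟩
    exact ⟨g x, (g.map_smul e x).symm⟩)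
  have hs : IsSES k f' g' := by
    refine isSES_mk ?_ ?_ ?_ ?_
    · intro x y hxy
      exact Subtype.ext (h.1 (congrArg Subtype.val hxy))
    · rintro ⟨_, z, rfl⟩
      obtain ⟨y, rfl⟩ := h.2.1 z
      exact ⟨⟨e • y, y, rfl⟩, Subtype.ext (g.map_smul e y)⟩
    · intro x
      exact Subtype.ext (h.apply_eq_zero x.1)
    · rintro ⟨_, y, rfl⟩ hy
      obtain ⟨x, hx⟩ := h.exists_of_eq_zero (congrArg Subtype.val hy)
      refine ⟨⟨e • x, x, rfl⟩, Subtype.ext ?_⟩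
      show f (e • x) = e • y
      rw [map_smul, hx]
      show e • e • y = e • y
      rw [← mul_smul, he]
  exact finrank_of_isSES hs

variable {X : Type} [AddCommGroup X] [Module A X]

lemma vdim_eq_zero {e : A} (h : ∀ x : X, e • x = 0) : vdim k A e X = 0 := by
  let _ := kmod k A X
  have := kmod_tower k A X
  have h0 : LinearMap.range (Algebra.lsmul k k X e) = ⊥ := by
    rw [LinearMap.range_eq_bot]
    ext x
    exact h x
  show Module.finrank k (LinearMap.range (Algebra.lsmul k k X e)) = 0
  rw [h0, finrank_bot]

lemma vdim_le_one [Module k X] [IsScalarTower k A X] {e : A} (d : X)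
    (h : ∀ x : X, ∃ r : k, e • x = r • d) : vdim k A e X ≤ 1 := by
  have hk : ∀ (r : k) (x : X), r • x = algebraMap k A r • x := fun r x => by
    rw [algebraMap_smul]
  let _ := kmod k A X
  have := kmod_tower k A X
  have h0 : LinearMap.range (Algebra.lsmul k k X e) ≤ Submodule.span k {d} := by
    rintro _ ⟨x, rfl⟩
    obtain ⟨r, hr⟩ := h x
    rw [hk] at hr
    exact Submodule.mem_span_singleton.2 ⟨r, hr.symm⟩
  show Module.finrank k (LinearMap.range (Algebra.lsmul k k X e)) ≤ 1
  exact (Submodule.finrank_mono h0).trans ((finrank_span_le_card {d}).trans (by simp))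

lemma vdim_pos [FiniteDimensional k A] [Module.Finite A X] {e : A} {x : X} (h : e • x ≠ 0) :
    0 < vdim k A e X := by
  let _ := kmod k A X
  have := kmod_tower k A X
  have : FiniteDimensional k X := Module.Finite.trans A X
  show 0 < Module.finrank k (LinearMap.range (Algebra.lsmul k k X e))
  have : Nontrivial (LinearMap.range (Algebra.lsmul k k X e)) :=
    ⟨⟨⟨e • x, x, rfl⟩, 0, fun h' => h (congrArg Subtype.val h')⟩⟩
  exact Module.finrank_pos

end VertexDimension

section ArmInjective

variable {k : Type} [Field k] {t : ℕ} {p : Fin t → ℕ} {lam : Fin t → k}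

variable (k p lam) in
/-- All arrows act injectively on `N`. -/
def IsArmInjective (N : Type) [AddCommGroup N] [Module (CanAlg k t p lam) N] : Prop :=
  ∀ i j, j < p i → ∀ x : N, canArrow k p lam i j • x = 0 → canE k lam (canPos p i j) • x = 0

variable (k p lam) in
/-- The rank of a module over a canonical algebra. -/
def canRank (N : Type) [AddCommGroup N] [Module (CanAlg k t p lam) N] : ℤ :=
  (vdim k (CanAlg k t p lam) (canE k lam (canSink t p)) N : ℤ) -
    vdim k (CanAlg k t p lam) (canE k lam (canSource t p)) N

lemma canRank_of_isSES (hd : IsCanonicalData k t p lam) {X Y Z : Type}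
    [AddCommGroup X] [Module (CanAlg k t p lam) X] [AddCommGroup Y] [Module (CanAlg k t p lam) Y]
    [AddCommGroup Z] [Module (CanAlg k t p lam) Z]
    [Module.Finite (CanAlg k t p lam) Y] {f : X →ₗ[CanAlg k t p lam] Y}
    {g : Y →ₗ[CanAlg k t p lam] Z} (h : IsSES (CanAlg k t p lam) f g) :
    canRank k p lam Y = canRank k p lam X + canRank k p lam Z := by
  have := canAlg_finite (k := k) (lam := lam) hd.pos hd.2.1
  rw [canRank, canRank, canRank, vdim_of_isSES (canE_mul_self _) h,
    vdim_of_isSES (canE_mul_self _) h]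
  push_cast
  ring

lemma canPath_smul_eq_zero_of_arrow {Q : Type} [AddCommGroup Q] [Module (CanAlg k t p lam) Q]
    {i : Fin t} {a n : ℕ} (hn : 1 ≤ n) {q : Q} (h : canArrow k p lam i a • q = 0) :
    canPath k p lam i a n • q = 0 :=
  canPath_smul_eq_zero hn (by rwa [canPath_one])

lemma IsArmInjective.path {N : Type} [AddCommGroup N] [Module (CanAlg k t p lam) N]
    (hN : IsArmInjective k p lam N) {i : Fin t} {j n : ℕ} (h : j + n ≤ p i) {x : N}
    (hx : canPath k p lam i j n • x = 0) : canE k lam (canPos p i j) • x = 0 := by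
  induction n with
  | zero => exact hx
  | succ n ih =>
    refine ih (by omega) ?_
    have h1 := canE_mul_canPath (k := k) (p := p) (lam := lam) i j n
    rw [← h1, mul_smul]
    refine hN i (j + n) (by omega) _ ?_
    rw [← mul_smul]
    exact hx

/-- A module on which some arrow is not injective has a submodule of nonpositive rank without
extensions by modules on which all arrows are injective. -/
lemma exists_submodule_of_not_armInjective (hd : IsCanonicalData k t p lam) {X : Type}
    [AddCommGroup X] [Module (CanAlg k t p lam) X] [Module.Finite (CanAlg k t p lam) X]
    (hX : ¬ IsArmInjective k p lam X) :
    ∃ Q : Submodule (CanAlg k t p lam) X, Q ≠ ⊥ ∧ canRank k p lam Q ≤ 0 ∧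
      ∀ (N : Type) [AddCommGroup N] [Module (CanAlg k t p lam) N], IsArmInjective k p lam N →
        ExtZ (CanAlg k t p lam) N Q := by
  have hp := hd.2.1
  have := canAlg_finite (k := k) (lam := lam) hd.pos hd.2.1
  have : IsArtinianRing (CanAlg k t p lam) := IsArtinianRing.of_finite k _
  have hex : ∃ (i : Fin t) (j : ℕ) (x : X), j < p i ∧ canArrow k p lam i j • x = 0 ∧
      canE k lam (canPos p i j) • x = x ∧ x ≠ 0 := by
    rw [IsArmInjective] at hX
    push Not at hX
    obtain ⟨i, j, hj, x, h1, h2⟩ := hX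
    refine ⟨i, j, canE k lam (canPos p i j) • x, hj, ?_, ?_, h2⟩
    · rw [← mul_smul, canArrow_mul_canE, h1]
    · rw [← mul_smul, canE_mul_self]
  have setup : ∀ x : X, x ≠ 0 → ∃ (Q : Submodule (CanAlg k t p lam) X) (q₀ : Q),
      Q ≠ ⊥ ∧ (q₀ : X) = x ∧ ∀ q : Q, ∃ c : CanAlg k t p lam, q = c • q₀ := by
    intro x hx
    refine ⟨Submodule.span _ {x}, ⟨x, Submodule.mem_span_singleton_self x⟩, ?_, rfl, ?_⟩
    · rwa [Ne, Submodule.span_singleton_eq_bot]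
    · rintro ⟨q, hq⟩
      obtain ⟨c, rfl⟩ := Submodule.mem_span_singleton.1 hq
      exact ⟨c, rfl⟩
  by_cases hmid : ∃ (i : Fin t) (j : ℕ) (x : X), 1 ≤ j ∧ j < p i ∧ canArrow k p lam i j • x = 0 ∧
      canE k lam (canPos p i j) • x = x ∧ x ≠ 0
  · obtain ⟨i, j, x, hj1, hj, h1, h2, h3⟩ := hmid
    obtain ⟨a, rfl⟩ : ∃ a, j = a + 1 := ⟨j - 1, by omega⟩
    obtain ⟨Q, q₀, hQ, hq₀, hgen⟩ := setup x h3
    let _ := kmod k (CanAlg k t p lam) Q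
    have := kmod_tower k (CanAlg k t p lam) Q
    have h0 : q₀ ≠ 0 := fun h => h3 (by rw [← hq₀, h]; rfl)
    have he : canE k lam (canPos p i (a + 1)) • q₀ = q₀ := Subtype.ext (by
      rw [Submodule.coe_smul, hq₀, h2])
    have ha : canArrow k p lam i (a + 1) • q₀ = 0 := Subtype.ext (by
      rw [Submodule.coe_smul, hq₀, h1]; rfl)
    obtain ⟨ξ, hξ⟩ := isCoinduced_interval (Q := Q) (a := a) (m := 0) hd (by omega) hgen he
      (by rw [zero_add, canPath_one, ha]) (by rwa [canPath, he])
    refine ⟨Q, hQ, ?_, fun N _ _ hN => ?_⟩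
    · have h4 : vdim k (CanAlg k t p lam) (canE k lam (canSink t p)) Q = 0 := by
        refine vdim_eq_zero fun q => ?_
        obtain ⟨c, rfl⟩ := hgen q
        have h5 : canE k lam (canSink t p) • c • q₀ =
            (canE k lam (canSink t p) * c * canE k lam (canPos p i (a + 1))) • q₀ := by
          rw [mul_smul, he, mul_smul]
        rw [h5]
        rcases corner_internal hd i (by omega : 1 ≤ a + 1) (by omega) (canSink t p) c with
          h6 | ⟨r, n, h6, h7, h8⟩
        · rw [h6, zero_smul]
        · have := canPos_eq_sink hp h6 h7
          have h9 : canPath k p lam i (a + 1) n • q₀ = 0 :=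
            canPath_smul_eq_zero_of_arrow (Q := Q) (by omega) ha
          rw [h8, smul_assoc, h9, smul_zero]
      rw [canRank, h4]
      simp
    · refine hξ.extZ (canE_mul_self _) (canE_mul_canPath _ _ _) (canPath_mul_canE i a _) ?_
      intro y hy
      exact hN.path (by omega) hy
  · obtain ⟨i, j, x, hj, h1, h2, h3⟩ := hex
    obtain rfl : j = 0 := by
      by_contra hj0
      exact hmid ⟨i, j, x, by omega, hj, h1, h2, h3⟩
    rw [canPos_zero] at h2
    obtain ⟨Q, q₀, hQ, hq₀, hgen⟩ := setup x h3
    let _ := kmod k (CanAlg k t p lam) Q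
    have := kmod_tower k (CanAlg k t p lam) Q
    have h0 : q₀ ≠ 0 := fun h => h3 (by rw [← hq₀, h]; rfl)
    have he : canE k lam (canSource t p) • q₀ = q₀ := Subtype.ext (by
      rw [Submodule.coe_smul, hq₀, h2])
    have ha : canArrow k p lam i 0 • q₀ = 0 := Subtype.ext (by
      rw [Submodule.coe_smul, hq₀, h1]; rfl)
    have hpos : 0 < vdim k (CanAlg k t p lam) (canE k lam (canSource t p)) Q := by
      refine vdim_pos (x := q₀) ?_
      rwa [he]
    have hsink : ∀ (S : Submodule k Q), (∀ l, canW k p lam l • q₀ ∈ S) →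
        ∀ q : Q, canE k lam (canSink t p) • q ∈ S := by
      intro S hS q
      obtain ⟨c, rfl⟩ := hgen q
      refine corner_smul_mem hd he S (fun i' j n hjn h4 h5 => ?_) c
      obtain rfl := canPos_eq_source hp (by omega) h4
      rw [zero_add] at hjn h5
      obtain rfl := canPos_eq_sink hp hjn h5
      exact hS i'
    by_cases hall : ∀ l, canArrow k p lam l 0 • q₀ = 0
    · obtain ⟨ξ, hξ⟩ := isCoinduced_source (Q := Q) hd hgen he hall h0
      refine ⟨Q, hQ, ?_, fun N _ _ hN => ?_⟩
      · have h4 : vdim k (CanAlg k t p lam) (canE k lam (canSink t p)) Q = 0 := by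
          refine vdim_eq_zero fun q => (Submodule.mem_bot k).1 (hsink ⊥ (fun l => ?_) q)
          exact canPath_smul_eq_zero_of_arrow (Q := Q) (hp l) (hall l)
        rw [canRank, h4]
        simp
      · refine hξ.extZ (canE_mul_self _) (mul_zero _) (zero_mul 0) fun y _ => zero_smul _ y
    · push Not at hall
      obtain ⟨i₁, hi₁⟩ := hall
      have hii : i₁ ≠ i := by
        rintro rfl
        exact hi₁ ha
      have hne : ∀ n, 1 ≤ n → n ≤ p i₁ → canPath k p lam i₁ 0 n • q₀ ≠ 0 := by
        intro n hn
        induction n, hn using Nat.le_induction with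
        | base => intro _; rwa [canPath_one]
        | succ n hn ih =>
          intro hnp h4
          refine hmid ⟨i₁, n, canPath k p lam i₁ 0 n • x, hn, by omega, ?_, ?_, ?_⟩
          · have h5 := congrArg Subtype.val h4
            rw [canPath, zero_add, Submodule.coe_smul, hq₀, mul_smul] at h5
            exact h5
          · have := canE_mul_canPath (k := k) (p := p) (lam := lam) i₁ 0 n
            rw [zero_add] at this
            rw [← mul_smul, this]
          · intro h5
            refine ih (by omega) (Subtype.ext ?_)
            rw [Submodule.coe_smul, hq₀, h5]
            rfl
      have hw := hne (p i₁) (hp i₁) le_rfl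
      obtain ⟨ξ, hξ⟩ := isCoinduced_top (Q := Q) hd hii hgen he ha hw
      refine ⟨Q, hQ, ?_, fun N _ _ hN => ?_⟩
      · have h4 : vdim k (CanAlg k t p lam) (canE k lam (canSink t p)) Q ≤ 1 := by
          refine vdim_le_one (canW k p lam i₁ • q₀) fun q => ?_
          have := hsink (Submodule.span k {canW k p lam i₁ • q₀}) (fun l => ?_) q
          · obtain ⟨r, hr⟩ := Submodule.mem_span_singleton.1 this
            exact ⟨r, hr.symm⟩
          · obtain ⟨r, s, hrs⟩ := canW_mem_span hd hii l
            have h9 : canW k p lam i • q₀ = 0 :=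
              canPath_smul_eq_zero_of_arrow (Q := Q) (hp i) ha
            rw [hrs, add_smul, smul_assoc, smul_assoc, h9, smul_zero, add_zero]
            exact Submodule.smul_mem _ _ (Submodule.mem_span_singleton_self _)
        rw [canRank]
        omega
      · have hpi := hp i
        have h4 := canE_mul_canArrow (k := k) (p := p) (lam := lam) i (p i - 1)
        rw [Nat.sub_add_cancel hpi, canPos_last hp] at h4
        refine hξ.extZ (canE_mul_self _) h4 (canArrow_mul_canE i _) ?_
        intro y hy
        exact hN i _ (by omega) y hy

/-- A finite module has a retract of at least the same rank on which all arrows are injective. -/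
lemma exists_armInjective_retract (hd : IsCanonicalData k t p lam) (X : Type)
    [AddCommGroup X] [Module (CanAlg k t p lam) X] [Module.Finite (CanAlg k t p lam) X] :
    ∃ (N : Type) (_ : AddCommGroup N) (_ : Module (CanAlg k t p lam) N)
      (g : X →ₗ[CanAlg k t p lam] N) (s : N →ₗ[CanAlg k t p lam] X),
      g ∘ₗ s = LinearMap.id ∧ IsArmInjective k p lam N ∧
      canRank k p lam X ≤ canRank k p lam N := by
  have := canAlg_finite (k := k) (lam := lam) hd.pos hd.2.1
  have : IsArtinianRing (CanAlg k t p lam) := IsArtinianRing.of_finite k _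
  induction hn : vdim k (CanAlg k t p lam) 1 X using Nat.strong_induction_on generalizing X with
  | _ n ih =>
    by_cases hX : IsArmInjective k p lam X
    · exact ⟨X, _, _, LinearMap.id, LinearMap.id, rfl, hX, le_rfl⟩
    · obtain ⟨Q, hQ, hr, hE⟩ := exists_submodule_of_not_armInjective hd hX
      have hs := isSES_mkQ Q
      have h1 := vdim_of_isSES (k := k) (mul_one 1) hs
      obtain ⟨q, hq, hq0⟩ := Q.ne_bot_iff.1 hQ
      have h2 : 0 < vdim k (CanAlg k t p lam) 1 Q := by
        refine vdim_pos (x := (⟨q, hq⟩ : Q)) ?_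
        rw [one_smul]
        exact fun h => hq0 (congrArg Subtype.val h)
      obtain ⟨N, _, _, g, s, hgs, hN, hle⟩ := ih _ (by omega) (X ⧸ Q) rfl
      obtain ⟨u, hu⟩ := (hE N hN).lift hs s
      refine ⟨N, _, _, g ∘ₗ Q.mkQ, u, ?_, hN, ?_⟩
      · rw [LinearMap.comp_assoc, hu, hgs]
      · rw [canRank_of_isSES hd hs]
        omega

end ArmInjective

section AddClosure

variable {A : Type} [Ring A]

lemma InAddOf.retract {T : ModuleCat.{0} A} {X Y : Type} [AddCommGroup X] [Module A X]
    [AddCommGroup Y] [Module A Y] (h : InAddOf A T (ModuleCat.of A X)) (a : Y →ₗ[A] X)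
    (b : X →ₗ[A] Y) (hab : b ∘ₗ a = LinearMap.id) : InAddOf A T (ModuleCat.of A Y) := by
  obtain ⟨n, f, g, hfg⟩ := h
  refine ⟨n, f ∘ₗ a, b ∘ₗ g, LinearMap.ext fun y => ?_⟩
  have h1 : g (f (a y)) = a y := LinearMap.congr_fun hfg (a y)
  show b (g (f (a y))) = y
  rw [h1]
  exact LinearMap.congr_fun hab y

lemma inAddOf_self (T : ModuleCat.{0} A) : InAddOf A T T :=
  ⟨1, LinearMap.pi fun _ => LinearMap.id, LinearMap.proj 0, rfl⟩

lemma isSES_rangeRestrict {X Y : Type} [AddCommGroup X] [Module A X] [AddCommGroup Y] [Module A Y]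
    (e : X →ₗ[A] Y) : IsSES A (LinearMap.ker e).subtype e.rangeRestrict :=
  ⟨Submodule.injective_subtype _, LinearMap.surjective_rangeRestrict e,
    (Submodule.range_subtype _).trans (LinearMap.ker_rangeRestrict e).symm⟩

end AddClosure

section PositiveRank

variable {k : Type} [Field k] {t : ℕ} {p : Fin t → ℕ} {lam : Fin t → k}

lemma canRank_pos (hd : IsCanonicalData k t p lam) {T : ModuleCat.{0} (CanAlg k t p lam)}
    (hT : ∀ X : ModuleCat.{0} (CanAlg k t p lam), Module.Finite (CanAlg k t p lam) X →
      Indecomp (CanAlg k t p lam) X → InAddOf (CanAlg k t p lam) T X →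
      vdim k (CanAlg k t p lam) (canIdem k t p lam (canSource t p)) ↥X <
        vdim k (CanAlg k t p lam) (canIdem k t p lam (canSink t p)) ↥X)
    (X : Type) [AddCommGroup X] [Module (CanAlg k t p lam) X]
    [Module.Finite (CanAlg k t p lam) X] [Nontrivial X]
    (hX : InAddOf (CanAlg k t p lam) T (ModuleCat.of _ X)) : 0 < canRank k p lam X := by
  have := canAlg_finite (k := k) (lam := lam) hd.pos hd.2.1
  have : IsArtinianRing (CanAlg k t p lam) := IsArtinianRing.of_finite k _
  induction hn : vdim k (CanAlg k t p lam) 1 X using Nat.strong_induction_on generalizing X with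
  | _ n ih =>
    by_cases hI : Indecomp (CanAlg k t p lam) (ModuleCat.of _ X)
    · have := hT _ ‹_› hI hX
      rw [canRank]
      exact sub_pos.2 (by exact_mod_cast this)
    · have hI' : ¬ ∀ e : X →ₗ[CanAlg k t p lam] X, e ∘ₗ e = e → e = 0 ∨ e = LinearMap.id :=
        fun h => hI ⟨‹Nontrivial X›, h⟩
      push Not at hI'
      obtain ⟨e, he, he0, he1⟩ := hI'
      have hee : ∀ x, e (e x) = e x := fun x => LinearMap.congr_fun he x
      have hs := isSES_rangeRestrict e
      have hnr : Nontrivial (LinearMap.range e) := by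
        rw [Submodule.nontrivial_iff_ne_bot, Ne, LinearMap.range_eq_bot]
        exact he0
      have hnk : Nontrivial (LinearMap.ker e) := by
        rw [Submodule.nontrivial_iff_ne_bot]
        intro h
        refine he1 (LinearMap.ext fun x => ?_)
        exact LinearMap.ker_eq_bot.1 h (hee x)
      have hpos : ∀ (Y : Type) [AddCommGroup Y] [Module (CanAlg k t p lam) Y]
          [Module.Finite (CanAlg k t p lam) Y] [Nontrivial Y],
          0 < vdim k (CanAlg k t p lam) 1 Y := by
        intro Y _ _ _ _
        obtain ⟨y, hy⟩ := exists_ne (0 : Y)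
        exact vdim_pos (x := y) (by rwa [one_smul])
      have h1 := vdim_of_isSES (k := k) (mul_one 1) hs
      have h2 := hpos (LinearMap.range e)
      have h3 := hpos (LinearMap.ker e)
      have h4 := ih _ (by omega) (LinearMap.range e)
        (hX.retract (LinearMap.range e).subtype e.rangeRestrict (by
          ext ⟨_, x, rfl⟩
          exact hee x)) rfl
      have h5 := ih _ (by omega) (LinearMap.ker e)
        (hX.retract (LinearMap.ker e).subtype
          ((LinearMap.id - e).codRestrict (LinearMap.ker e) (fun x => by simp [hee])) (by
          ext ⟨x, hx⟩
          have : e x = 0 := hx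
          simp [this])) rfl
      rw [canRank_of_isSES hd hs]
      omega

/-- All arrows are injective on the tilting module. -/
lemma isArmInjective_of_pos (hd : IsCanonicalData k t p lam) {T : ModuleCat.{0} (CanAlg k t p lam)}
    [Module.Finite (CanAlg k t p lam) T]
    (hT : ∀ X : ModuleCat.{0} (CanAlg k t p lam), Module.Finite (CanAlg k t p lam) X →
      Indecomp (CanAlg k t p lam) X → InAddOf (CanAlg k t p lam) T X →
      vdim k (CanAlg k t p lam) (canIdem k t p lam (canSource t p)) ↥X <
        vdim k (CanAlg k t p lam) (canIdem k t p lam (canSink t p)) ↥X) :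
    IsArmInjective k p lam T := by
  have := canAlg_finite (k := k) (lam := lam) hd.pos hd.2.1
  have : IsArtinianRing (CanAlg k t p lam) := IsArtinianRing.of_finite k _
  obtain ⟨N, _, _, g, s, hgs, hN, hr⟩ := exists_armInjective_retract hd T
  have hs := isSES_ker (g := g) (fun x => ⟨s x, LinearMap.congr_fun hgs x⟩)
  have hker : LinearMap.ker g = ⊥ := by
    by_contra hne
    have : Nontrivial (LinearMap.ker g) := (Submodule.nontrivial_iff_ne_bot).2 hne
    obtain ⟨u, hu⟩ := hs.retraction_of_section hgs
    have h1 := canRank_pos hd hT (LinearMap.ker g)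
      ((inAddOf_self T).retract (LinearMap.ker g).subtype u (LinearMap.ext hu))
    rw [canRank_of_isSES hd hs] at hr
    omega
  intro i j hj x hx
  refine LinearMap.ker_eq_bot.1 hker ?_
  rw [map_smul, map_zero]
  refine hN i j hj _ ?_
  rw [← map_smul, hx, map_zero]

end PositiveRank

section TestModules

variable {A : Type} [Ring A] {T Z X K M P₁ P₀ : Type} [AddCommGroup T] [Module A T]
  [AddCommGroup Z] [Module A Z] [AddCommGroup X] [Module A X] [AddCommGroup K] [Module A K]
  [AddCommGroup M] [Module A M] [AddCommGroup P₁] [Module A P₁] [AddCommGroup P₀] [Module A P₀]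

lemma extZ_ker {i : K →ₗ[A] M} {p : M →ₗ[A] Z} (h : IsSES A i p) (hX : ExtZ A X M)
    (hlift : ∀ v : X →ₗ[A] Z, ∃ w : X →ₗ[A] M, p ∘ₗ w = v) : ExtZ A X K := by
  refine extZ_of_extend fun E _ _ j g hs => ?_
  obtain ⟨u, hu⟩ := hX.extend hs i
  obtain ⟨v, hv⟩ := exists_factor_surj hs.2.1 (p ∘ₗ u) (by
    intro e he
    obtain ⟨y, rfl⟩ := hs.exists_of_eq_zero he
    simp [hu, h.apply_eq_zero])
  obtain ⟨w, hw⟩ := hlift v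
  obtain ⟨r, hr⟩ := exists_factor_inj h.1 (u - w ∘ₗ g) (fun e => h.exists_of_eq_zero (by
    have h1 := LinearMap.congr_fun hv e
    have h2 := LinearMap.congr_fun hw (g e)
    simp only [LinearMap.comp_apply] at h1 h2
    simp [h1, h2]))
  refine ⟨r, fun y => h.1 ?_⟩
  have := LinearMap.congr_fun hr (j y)
  simpa [hs.apply_eq_zero, hu] using this

/-- The mapping cone of two resolutions of the same module. -/
lemma isSES_cone {f : P₁ →ₗ[A] P₀} {g : P₀ →ₗ[A] Z} {i : K →ₗ[A] M} {p : M →ₗ[A] Z}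
    (hs : IsSES A f g) (h : IsSES A i p) {u : P₀ →ₗ[A] M} (hu : p ∘ₗ u = g)
    {c : P₁ →ₗ[A] K} (hc : i ∘ₗ c = u ∘ₗ f) :
    IsSES A ((-c).prod f) (i.coprod u) := by
  have hu' : ∀ x, p (u x) = g x := fun x => LinearMap.congr_fun hu x
  have hc' : ∀ x, i (c x) = u (f x) := fun x => LinearMap.congr_fun hc x
  refine isSES_mk ?_ ?_ ?_ ?_
  · intro x y hxy
    exact hs.1 (Prod.ext_iff.1 hxy).2
  · intro m
    obtain ⟨x, hx⟩ := hs.2.1 (p m)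
    obtain ⟨y, hy⟩ := h.exists_of_eq_zero (y := m - u x) (by simp [hu', hx])
    exact ⟨(y, x), by simp [hy]⟩
  · intro x
    simp [hc']
  · rintro ⟨y, x⟩ hyx
    simp only [LinearMap.coprod_apply] at hyx
    have h1 : g x = 0 := by
      have := congrArg p hyx
      simpa [h.apply_eq_zero, hu'] using this
    obtain ⟨z, rfl⟩ := hs.exists_of_eq_zero h1
    refine ⟨z, Prod.ext (h.1 ?_) rfl⟩
    simpa [hc'] using (eq_neg_of_add_eq_zero_left hyx).symm

lemma extZ_of_mem_fac [Module.Projective A P₁] [Module.Projective A P₀] {f : P₁ →ₗ[A] P₀}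
    {g : P₀ →ₗ[A] T} (hs : IsSES A f g) (hT : ExtZ A T T)
    (hX : Mem (Fac A (ModuleCat.of A T)) X) : ExtZ A T X := by
  obtain ⟨n, q, hq⟩ := mem_fac_iff.1 hX
  refine extZ_of_presentation hs fun u => ?_
  obtain ⟨v, hv⟩ := Module.projective_lifting_property q u hq
  obtain ⟨w, hw⟩ := (hT.pi_right (ι := Fin n)).extend hs v
  refine ⟨q ∘ₗ w, fun x => ?_⟩
  rw [LinearMap.comp_apply, hw]
  exact LinearMap.congr_fun hv x

variable (A T) in
/-- The homological properties of a tilting module used below. -/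
structure IsTilt : Prop where
  finite : Module.Finite A T
  extZ_fac : ∀ (Q : Type) [AddCommGroup Q] [Module A Q], Mem (Fac A (ModuleCat.of A T)) Q →
    ExtZ A T Q
  mem_fac : ∀ (Q : Type) [AddCommGroup Q] [Module A Q], Module.Finite A Q → ExtZ A T Q →
    Mem (Fac A (ModuleCat.of A T)) Q

lemma IsTilt.extZ_self (h : IsTilt A T) : ExtZ A T T := h.extZ_fac T mem_fac_self

lemma map_pi_mem {n : ℕ} (F : (Fin n → X) →ₗ[A] Z) {N : Submodule A Z}
    (hN : ∀ (f : X →ₗ[A] Z) (x : X), f x ∈ N) (x : Fin n → X) : F x ∈ N := by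
  rw [← LinearMap.sum_single_apply (φ := fun _ : Fin n => X) x, map_sum]
  exact Submodule.sum_mem _ fun j _ => hN (F ∘ₗ LinearMap.single A (fun _ => X) j) (x j)

lemma isTilt_of_isTiltingModule {T : ModuleCat.{0} A} (hT : IsTiltingModule A T) :
    IsTilt A T := by
  obtain ⟨hfin, ⟨P₁, P₀, f, g, hP₁, hP₀, hs⟩, hE, T₀, T₁, f', g', hT₀, hT₁, hs'⟩ := hT
  have hE' : ExtZ A T T := extZ_of_not_ext1Nonzero hE
  refine ⟨hfin, fun Q _ _ hQ => extZ_of_mem_fac hs hE' hQ, fun Q _ _ hQ hTQ => ?_⟩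
  obtain ⟨n, a, b, hab⟩ := hT₁
  have h1 : ExtZ A T₁ Q :=
    (hTQ.pi_left (ι := Fin n)).retract_left a b (fun z => LinearMap.congr_fun hab z)
  obtain ⟨m, c, d, hcd⟩ := hT₀
  refine mem_fac_of_trace fun N hN y => ?_
  obtain ⟨u, hu⟩ := h1.extend hs' (LinearMap.toSpanSingleton A Q y)
  have hy : u (f' 1) = y := by rw [hu]; simp
  have hcd' : ∀ x, d (c x) = x := fun x => LinearMap.congr_fun hcd x
  rw [← hy, ← hcd' (f' 1)]
  exact map_pi_mem (u ∘ₗ d) hN _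

/-- A test resolution `0 → K → Tⁿ → Z → 0` of `Z`, with `K` a summand of a power of `T`,
such that all homomorphisms from `T` to `Z` lift to `Tⁿ`. -/
structure TestRes (A T Z : Type) [Ring A] [AddCommGroup T] [Module A T] [AddCommGroup Z]
    [Module A Z] where
  /-- the number of copies of `T` in the middle term -/
  n : ℕ
  /-- the cover -/
  π : (Fin n → T) →ₗ[A] Z
  surj : Function.Surjective π
  exists_lift : ∀ f : T →ₗ[A] Z, ∃ u : T →ₗ[A] (Fin n → T), π ∘ₗ u = f
  /-- the number of copies of `T` needed for the kernel -/
  l : ℕ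
  /-- the inclusion of the kernel in a power of `T` -/
  a : LinearMap.ker π →ₗ[A] (Fin l → T)
  /-- the retraction onto the kernel -/
  b : (Fin l → T) →ₗ[A] LinearMap.ker π
  retract : ∀ x, b (a x) = x

lemma IsTilt.exists_testRes (k : Type) [Field k] [Algebra k A] [FiniteDimensional k A]
    (h : IsTilt A T) [Module.Finite A Z] [Module.Projective A P₁] [Module.Projective A P₀]
    {f : P₁ →ₗ[A] P₀} {g : P₀ →ₗ[A] Z} (hs : IsSES A f g) (hTZ : ExtZ A T Z) :
    Nonempty (TestRes A T Z) := by
  have hT := h.finite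
  have : IsArtinianRing A := IsArtinianRing.of_finite k A
  obtain ⟨n, p, hp⟩ := exists_approx k (A := A) T Z
  have hps : Function.Surjective p := by
    have hZ := h.mem_fac Z inferInstance hTZ
    obtain ⟨m, q, hq⟩ := mem_fac_iff.1 hZ
    intro z
    obtain ⟨x, rfl⟩ := hq z
    refine map_pi_mem (N := LinearMap.range p) q (fun f x => ?_) x
    obtain ⟨u, rfl⟩ := hp f
    exact ⟨u x, rfl⟩
  have hk := isSES_ker hps
  have hTK : ExtZ A T (LinearMap.ker p) := extZ_ker hk h.extZ_self.pi_right hp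
  have hK : Mem (Fac A (ModuleCat.of A T)) (LinearMap.ker p) :=
    h.mem_fac _ inferInstance hTK
  obtain ⟨u, hu⟩ := Module.projective_lifting_property p g hps
  obtain ⟨c, hc⟩ := exists_factor_inj hk.1 (u ∘ₗ f) (fun x => hk.exists_of_eq_zero (by
    rw [LinearMap.comp_apply, ← hs.apply_eq_zero x]
    exact LinearMap.congr_fun hu (f x)))
  have hcone := isSES_cone hs hk hu hc
  obtain ⟨l, q, hq⟩ := exists_approx k (A := A) T (LinearMap.ker p)
  have hqs : Function.Surjective q := by
    obtain ⟨m, q', hq'⟩ := mem_fac_iff.1 hK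
    intro z
    obtain ⟨x, rfl⟩ := hq' z
    refine map_pi_mem (N := LinearMap.range q) q' (fun f x => ?_) x
    obtain ⟨u, rfl⟩ := hq f
    exact ⟨u x, rfl⟩
  have hk' := isSES_ker hqs
  have hK' : Mem (Fac A (ModuleCat.of A T)) (LinearMap.ker q) :=
    h.mem_fac _ inferInstance (extZ_ker hk' h.extZ_self.pi_right hq)
  have hE : ExtZ A (LinearMap.ker p × P₀) (LinearMap.ker q) :=
    ExtZ.of_isSES_left hcone extZ_of_projective (h.extZ_fac _ hK').pi_left
  obtain ⟨s, hs'⟩ := (hE.retract_left (LinearMap.inl A _ P₀) (LinearMap.fst A _ P₀)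
    (fun _ => rfl)) _ _ _ hk'
  exact ⟨⟨n, p, hps, hp, l, s, q, fun x => LinearMap.congr_fun hs' x⟩⟩

end TestModules

section Criterion

lemma extZ_of_comp_exact {R : Type} [Ring R] {P' P V Q : Type} [AddCommGroup P'] [Module R P']
    [AddCommGroup P] [Module R P] [AddCommGroup V] [Module R V] [AddCommGroup Q] [Module R Q]
    [Module.Projective R P'] [Module.Projective R P] {j : P' →ₗ[R] P} {s : P →ₗ[R] V}
    (hs : Function.Surjective s) (hsj : ∀ x, s (j x) = 0) (hj : ∀ x, s x = 0 → ∃ y, j y = x)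
    (hV : ∀ u : P' →ₗ[R] V, ∃ v : P →ₗ[R] V, ∀ y, v (j y) = u y)
    (hQ : Mem (Fac R (ModuleCat.of R V)) Q) : ExtZ R V Q := by
  obtain ⟨m, q, hq⟩ := mem_fac_iff.1 hQ
  refine extZ_of_presentation (isSES_ker hs) fun u => ?_
  obtain ⟨w, hw⟩ := Module.projective_lifting_property q
    (u ∘ₗ j.codRestrict (LinearMap.ker s) hsj) hq
  choose x hx using fun i : Fin m => hV (LinearMap.proj i ∘ₗ w)
  refine ⟨q ∘ₗ LinearMap.pi x, ?_⟩
  rintro ⟨y, hy⟩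
  obtain ⟨z, rfl⟩ := hj y hy
  have h1 : LinearMap.pi x (j z) = w z := funext fun i => hx i z
  simp only [LinearMap.comp_apply, Submodule.subtype_apply, h1]
  exact LinearMap.congr_fun hw z

end Criterion

section EndAlg

variable (A B T : Type) [Ring A] [Ring B] [AddCommGroup T] [Module A T] [Module B T]
  [SMulCommClass B A T]

/-- The ring acting on `Hom(T, Y)` through its action on `T`. -/
@[reducible] def homDomModule (Y : Type) [AddCommGroup Y] [Module A Y] :
    Module Bᵐᵒᵖ (T →ₗ[A] Y) where
  smul x f := f ∘ₗ Module.toModuleEnd A T x.unop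
  one_smul f := LinearMap.ext fun t => congrArg f (one_smul B t)
  mul_smul x y f := LinearMap.ext fun t => congrArg f (mul_smul y.unop x.unop t)
  smul_zero _ := rfl
  smul_add _ _ _ := rfl
  add_smul x y f := LinearMap.ext fun t =>
    (congrArg f (add_smul x.unop y.unop t)).trans (map_add f _ _)
  zero_smul f := LinearMap.ext fun t => (congrArg f (zero_smul B t)).trans (map_zero f)

/-- `B` is the endomorphism ring of `T`. -/
structure IsEndAlg : Prop where
  exists_smul : ∀ f : T →ₗ[A] T, ∃ x : B, ∀ t, f t = x • t
  faithful : ∀ x : B, (∀ t : T, x • t = 0) → x = 0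

attribute [local instance] homDomModule

variable {A B T} {Y Z Z' K : Type} [AddCommGroup Y] [Module A Y] [AddCommGroup Z] [Module A Z]
  [AddCommGroup Z'] [Module A Z'] [AddCommGroup K] [Module A K]

lemma homDom_smul_apply (x : Bᵐᵒᵖ) (f : T →ₗ[A] Y) (t : T) : (x • f) t = f (x.unop • t) := rfl

variable (B T) in
/-- Postcomposition. -/
def homDomPost (g : Y →ₗ[A] Z) : (T →ₗ[A] Y) →ₗ[Bᵐᵒᵖ] (T →ₗ[A] Z) where
  toFun f := g ∘ₗ f
  map_add' _ _ := LinearMap.comp_add _ _ _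
  map_smul' _ _ := rfl

lemma IsEndAlg.exists_equiv_pi (h : IsEndAlg A B T) (n : ℕ) :
    Nonempty ((Fin n → Bᵐᵒᵖ) ≃ₗ[Bᵐᵒᵖ] (T →ₗ[A] (Fin n → T))) := by
  refine ⟨LinearEquiv.ofBijective
    { toFun := fun x => LinearMap.pi fun i => Module.toModuleEnd A T (x i).unop
      map_add' := fun x y => LinearMap.ext fun t => funext fun i => add_smul _ _ _
      map_smul' := fun x y => LinearMap.ext fun t => funext fun i => mul_smul _ _ _ } ⟨?_, ?_⟩⟩
  · intro x y hxy
    funext i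
    refine MulOpposite.unop_injective (sub_eq_zero.1 (h.faithful _ fun t => ?_))
    rw [sub_smul, sub_eq_zero]
    exact congrFun (LinearMap.congr_fun hxy t) i
  · intro f
    choose x hx using fun i => h.exists_smul (LinearMap.proj i ∘ₗ f)
    exact ⟨fun i => MulOpposite.op (x i), LinearMap.ext fun t => funext fun i => (hx i t).symm⟩

lemma IsEndAlg.finite_hom (h : IsEndAlg A B T) (n : ℕ) :
    Module.Finite Bᵐᵒᵖ (T →ₗ[A] (Fin n → T)) :=
  Module.Finite.equiv (h.exists_equiv_pi n).some

lemma IsEndAlg.projective_hom (h : IsEndAlg A B T) (n : ℕ) :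
    Module.Projective Bᵐᵒᵖ (T →ₗ[A] (Fin n → T)) :=
  Module.Projective.of_equiv (h.exists_equiv_pi n).some

lemma IsEndAlg.projective_hom_of_retract (h : IsEndAlg A B T) {n : ℕ} (a : K →ₗ[A] (Fin n → T))
    (b : (Fin n → T) →ₗ[A] K) (hab : ∀ x, b (a x) = x) : Module.Projective Bᵐᵒᵖ (T →ₗ[A] K) := by
  have := h.projective_hom n
  exact Module.Projective.of_split (homDomPost B T a) (homDomPost B T b)
    (LinearMap.ext fun f => LinearMap.ext fun t => hab (f t))

/-- Homomorphisms out of `Hom(T, K)`, for `K` in `add T`, are postcompositions. -/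
lemma IsEndAlg.exists_homDomPost (h : IsEndAlg A B T) {n : ℕ} (a : K →ₗ[A] (Fin n → T))
    (b : (Fin n → T) →ₗ[A] K) (hab : ∀ x, b (a x) = x)
    (F : (T →ₗ[A] K) →ₗ[Bᵐᵒᵖ] (T →ₗ[A] Z)) : ∃ u : K →ₗ[A] Z, ∀ f, F f = u ∘ₗ f := by
  let s (i : Fin n) : T →ₗ[A] K := b ∘ₗ LinearMap.single A (fun _ => T) i
  refine ⟨∑ i, F (s i) ∘ₗ LinearMap.proj i ∘ₗ a, fun f => ?_⟩
  choose x hx using fun i => h.exists_smul (LinearMap.proj i ∘ₗ a ∘ₗ f)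
  have hf : f = ∑ i, MulOpposite.op (x i) • s i := by
    ext t
    rw [LinearMap.sum_apply]
    conv_lhs => rw [← hab (f t), ← LinearMap.sum_single_apply (φ := fun _ : Fin n => T) (a (f t)),
      map_sum]
    refine Finset.sum_congr rfl fun i _ => ?_
    rw [homDom_smul_apply, MulOpposite.unop_op, ← hx]
    rfl
  conv_lhs => rw [hf]
  rw [map_sum]
  ext t
  simp only [LinearMap.sum_apply, LinearMap.comp_apply, map_smul, homDom_smul_apply,
    MulOpposite.unop_op, ← hx]

lemma IsEndAlg.extZ_homDom (h : IsEndAlg A B T) (r : TestRes A T Z) (hZ : ExtZ A Z Z)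
    {Q : Type} [AddCommGroup Q] [Module Bᵐᵒᵖ Q]
    (hQ : Mem (Fac Bᵐᵒᵖ (ModuleCat.of Bᵐᵒᵖ (T →ₗ[A] Z))) Q) : ExtZ Bᵐᵒᵖ (T →ₗ[A] Z) Q := by
  have := h.projective_hom r.n
  have := h.projective_hom_of_retract r.a r.b r.retract
  have hk := isSES_ker r.surj
  refine extZ_of_comp_exact (j := homDomPost B T (LinearMap.ker r.π).subtype)
    (s := homDomPost B T r.π) r.exists_lift (fun f => LinearMap.ext fun t => (f t).2)
    (fun f hf => ⟨f.codRestrict _ fun t => LinearMap.congr_fun hf t, rfl⟩) (fun F => ?_) hQ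
  obtain ⟨u, hu⟩ := h.exists_homDomPost r.a r.b r.retract F
  obtain ⟨v, hv⟩ := hZ.extend hk u
  refine ⟨homDomPost B T v, fun f => ?_⟩
  rw [hu]
  exact LinearMap.ext fun t => hv (f t)

lemma IsEndAlg.homDom_eq_zero (h : IsEndAlg A B T) (r : TestRes A T Z)
    (hZ : ∀ f : Z →ₗ[A] Z', f = 0) (F : (T →ₗ[A] Z) →ₗ[Bᵐᵒᵖ] (T →ₗ[A] Z')) : F = 0 := by
  obtain ⟨u, hu⟩ := h.exists_homDomPost (LinearMap.id : (Fin r.n → T) →ₗ[A] _) LinearMap.id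
    (fun _ => rfl) (F ∘ₗ homDomPost B T r.π)
  have hker : ∀ x, r.π x = 0 → u x = 0 := by
    intro x hx
    have : u ∘ₗ (LinearMap.ker r.π).subtype ∘ₗ r.b = 0 := by
      refine LinearMap.pi_ext' fun i => ?_
      rw [LinearMap.zero_comp, LinearMap.comp_assoc, LinearMap.comp_assoc, ← hu,
        LinearMap.comp_apply]
      convert map_zero F
      exact LinearMap.ext fun t => (r.b (LinearMap.single A (fun _ => T) i t)).2
    have := LinearMap.congr_fun this (r.a ⟨x, hx⟩)
    simpa [r.retract] using this
  obtain ⟨v, hv⟩ := exists_factor_surj r.surj u hker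
  rw [hZ v] at hv
  ext f t
  obtain ⟨w, rfl⟩ := r.exists_lift f
  have := hu w
  rw [← hv] at this
  exact LinearMap.congr_fun this t

lemma IsEndAlg.finite_homDom (h : IsEndAlg A B T) (r : TestRes A T Z) :
    Module.Finite Bᵐᵒᵖ (T →ₗ[A] Z) :=
  have := h.finite_hom r.n
  Module.Finite.of_surjective (homDomPost B T r.π) r.exists_lift

lemma TestRes.nontrivial_hom (r : TestRes A T Z) [Nontrivial Z] : Nontrivial (T →ₗ[A] Z) := by
  by_contra hc
  rw [not_nontrivial_iff_subsingleton] at hc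
  obtain ⟨z, hz⟩ := exists_ne (0 : Z)
  obtain ⟨x, rfl⟩ := r.surj z
  refine hz (map_pi_mem (N := ⊥) r.π (fun f t => ?_) x)
  rw [Subsingleton.elim f 0]
  rfl

end EndAlg

section Additive

lemma additive_of_bijective_ker {R X Y Z : Type} [Ring R] [AddCommGroup X] [Module R X]
    [AddCommGroup Y] [Module R Y] [AddCommGroup Z] [Module R Z] [IsNoetherian R Y]
    {g : Y →ₗ[R] Z} (hg : Function.Surjective g) (f : X →ₗ[R] LinearMap.ker g)
    (hf : Function.Bijective f) : Module.Finite R X ∧ ∀ ℓ : ModuleCat.{0} R → ℤ, IsAdditive ℓ →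
      ℓ (ModuleCat.of R X) = ℓ (ModuleCat.of R Y) - ℓ (ModuleCat.of R Z) := by
  let E := LinearEquiv.ofBijective f hf
  refine ⟨Module.Finite.equiv E.symm, fun ℓ hℓ => ?_⟩
  have h1 := hℓ _ _ _ _ _ (isSES_ker hg) inferInstance
  have h2 := hℓ.equiv E
  omega

end Additive

section DualCorner

variable {k : Type} [Field k] {A B T : Type} [Ring A] [Ring B] [Algebra k A] [AddCommGroup T]
  [Module A T] [Module B T] [Module k T] [IsScalarTower k A T] [SMulCommClass B A T]
  [SMulCommClass B k T]

attribute [local instance] homDomModule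

variable (k B T) in
/-- The dual of `e • T`, as a module over the endomorphism algebra. -/
def dualCorner (e : A) : Submodule Bᵐᵒᵖ (T →ₗ[k] k) where
  carrier := {ζ | ∀ x, ζ (e • x) = ζ x}
  zero_mem' _ := rfl
  add_mem' h h' x := by simp [h x, h' x]
  smul_mem' b ζ h x := by
    rw [homDom_smul_apply, homDom_smul_apply, smul_comm b.unop e x, h]

variable (k B T) in
/-- Composition with `z`. -/
def dualCornerMap {z e : A} (v : A) (hze : z * e = z) :
    dualCorner k B T v →ₗ[Bᵐᵒᵖ] dualCorner k B T e where
  toFun ζ := ⟨ζ.1 ∘ₗ Algebra.lsmul k k T z, fun x => by simp [← mul_smul, hze]⟩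
  map_add' _ _ := rfl
  map_smul' b ζ := Subtype.ext (LinearMap.ext fun x =>
    congrArg ζ.1 (smul_comm b.unop z x))

lemma dualCornerMap_surjective {v z e : A} (hvv : v * v = v) (hvz : v * z = z) (hze : z * e = z)
    (hT : ∀ x : T, z • x = 0 → e • x = 0) :
    Function.Surjective (dualCornerMap k B T v hze) := by
  intro η
  obtain ⟨ζ, hζ⟩ : ∃ ζ : T →ₗ[k] k, ζ ∘ₗ Algebra.lsmul k k T z = η.1 := by
    obtain ⟨u, hu⟩ := exists_factor_surj (R := k)
      (Algebra.lsmul k k T z).surjective_rangeRestrict η.1 (fun x hx => by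
        have hx : z • x = 0 := congrArg Subtype.val hx
        rw [← η.2 x, hT x hx, map_zero])
    obtain ⟨ζ, hζ⟩ := u.exists_extend
    refine ⟨ζ, ?_⟩
    rw [← hu, ← hζ]
    rfl
  refine ⟨⟨ζ ∘ₗ Algebra.lsmul k k T v, fun x => by simp [← mul_smul, hvv]⟩,
    Subtype.ext (LinearMap.ext fun x => ?_)⟩
  rw [← hζ]
  simp [dualCornerMap, ← mul_smul, hvz]

variable {Q : Type} [AddCommGroup Q] [Module A Q] [Module k Q] [IsScalarTower k A Q]
  {ξ : Q →ₗ[k] k} {v z e : A}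

variable (B T) in
/-- The functional on `T` corresponding to a homomorphism to a coinduced module. -/
def IsCoinduced.toDual (h : IsCoinduced k v z ξ) (hvv : v * v = v) (hze : z * e = z) :
    (T →ₗ[A] Q) →ₗ[Bᵐᵒᵖ] LinearMap.ker (dualCornerMap k B T v hze) where
  toFun f := ⟨⟨ξ ∘ₗ Algebra.lsmul k k Q v ∘ₗ f.restrictScalars k, fun x => by
      simp [← mul_smul, hvv]⟩, Subtype.ext (LinearMap.ext fun x => by
      simp [dualCornerMap, h.smul_eq_zero])⟩
  map_add' f g := Subtype.ext (Subtype.ext (LinearMap.ext fun x => by simp))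
  map_smul' b f := rfl

lemma IsCoinduced.toDual_bijective (h : IsCoinduced k v z ξ) (hvv : v * v = v)
    (hze : z * e = z) : Function.Bijective (h.toDual B T hvv hze) := by
  constructor
  · intro f g hfg
    have hfg : ∀ x, ξ (v • f x) = ξ (v • g x) := fun x =>
      LinearMap.congr_fun (congrArg (fun y => y.1.1) hfg) x
    refine LinearMap.ext fun x => h.ext fun c => ?_
    rw [mul_smul, mul_smul, ← map_smul f, ← map_smul g, hfg]
  · intro ζ
    obtain ⟨r, hr⟩ := h.exists_hom ζ.1.1 ζ.1.2 (fun x =>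
      LinearMap.congr_fun (congrArg Subtype.val ζ.2) x)
    refine ⟨r, Subtype.ext (Subtype.ext (LinearMap.ext fun x => ?_))⟩
    have := hr 1 x
    rw [mul_one, one_smul] at this
    exact this

omit [Algebra k A] [IsScalarTower k A T] in
lemma isNoetherian_dualCorner [Algebra k B] [IsScalarTower k B T] [FiniteDimensional k T] (e : A) :
    IsNoetherian Bᵐᵒᵖ (dualCorner k B T e) := by
  have : IsScalarTower k Bᵐᵒᵖ (T →ₗ[k] k) := ⟨fun c b ζ => LinearMap.ext fun t => by
    rw [homDom_smul_apply, LinearMap.smul_apply, homDom_smul_apply, MulOpposite.unop_smul,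
      smul_assoc, map_smul]⟩
  have : IsNoetherian k (dualCorner k B T e) :=
    inferInstanceAs (IsNoetherian k ((dualCorner k B T e).restrictScalars k))
  exact isNoetherian_of_tower k this

/-- The class of `Hom(T, Q)` for a kernel `Q` of a map between coinduced modules. -/
lemma IsCoinduced.additive_hom [Algebra k B] [IsScalarTower k B T] [FiniteDimensional k T]
    (h : IsCoinduced k v z ξ) (hvv : v * v = v) (hvz : v * z = z) {e : A} (hze : z * e = z)
    (hT : ∀ x : T, z • x = 0 → e • x = 0) :
    Module.Finite Bᵐᵒᵖ (T →ₗ[A] Q) ∧ ∀ ℓ : ModuleCat.{0} Bᵐᵒᵖ → ℤ, IsAdditive ℓ →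
      ℓ (ModuleCat.of Bᵐᵒᵖ (T →ₗ[A] Q)) = ℓ (ModuleCat.of Bᵐᵒᵖ (dualCorner k B T v)) -
        ℓ (ModuleCat.of Bᵐᵒᵖ (dualCorner k B T e)) := by
  have := isNoetherian_dualCorner (k := k) (B := B) (T := T) v
  exact additive_of_bijective_ker (R := Bᵐᵒᵖ) (X := T →ₗ[A] Q) (Y := dualCorner k B T v)
    (Z := dualCorner k B T e) (dualCornerMap_surjective hvv hvz hze hT) _
    (h.toDual_bijective hvv hze)

end DualCorner

section EndAlgCod

variable {A B T : Type} [Ring A] [Ring B] [AddCommGroup T] [Module A T] [Module B T]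
  [SMulCommClass A B T] {Y Z Z' K M P₁ P₀ : Type} [AddCommGroup Y] [Module A Y] [AddCommGroup Z]
  [Module A Z] [AddCommGroup Z'] [Module A Z'] [AddCommGroup K] [Module A K]
  [AddCommGroup M] [Module A M] [AddCommGroup P₁] [Module A P₁] [AddCommGroup P₀] [Module A P₀]

variable (B T) in
/-- Precomposition. -/
def homCodPre (g : Y →ₗ[A] Z) : (Z →ₗ[A] T) →ₗ[B] (Y →ₗ[A] T) where
  toFun f := f ∘ₗ g
  map_add' _ _ := rfl
  map_smul' _ _ := rfl

lemma homCodPre_apply (g : Y →ₗ[A] Z) (f : Z →ₗ[A] T) : homCodPre B T g f = f ∘ₗ g := rfl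

lemma pi_eq_sum_single {n : ℕ} (f : (Fin n → T) →ₗ[A] Z) (x : Fin n → T) :
    f x = ∑ i, f (LinearMap.single A (fun _ => T) i (x i)) := by
  conv_lhs => rw [← LinearMap.sum_single_apply (φ := fun _ : Fin n => T) x, map_sum]
  rfl

lemma exists_equiv_pi_cod (h1 : ∀ f : T →ₗ[A] T, ∃ x : B, ∀ t, f t = x • t)
    (h2 : ∀ x : B, (∀ t : T, x • t = 0) → x = 0) (n : ℕ) :
    Nonempty ((Fin n → B) ≃ₗ[B] ((Fin n → T) →ₗ[A] T)) := by
  let F : (Fin n → B) →ₗ[B] ((Fin n → T) →ₗ[A] T) :=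
    ∑ i, (LinearMap.toSpanSingleton B ((Fin n → T) →ₗ[A] T) (LinearMap.proj i)) ∘ₗ
      LinearMap.proj i
  have hF : ∀ x t, F x t = ∑ i, x i • t i := fun x t => by
    simp [F, LinearMap.sum_apply]
  refine ⟨LinearEquiv.ofBijective F ⟨?_, ?_⟩⟩
  · intro x y hxy
    funext i
    refine sub_eq_zero.1 (h2 _ fun t => ?_)
    have := LinearMap.congr_fun hxy (Pi.single i t)
    rw [hF, hF, Finset.sum_eq_single i, Finset.sum_eq_single i] at this
    · rw [sub_smul, sub_eq_zero]
      simpa using this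
    · intro j _ hj; simp [hj]
    · simp
    · intro j _ hj; simp [hj]
    · simp
  · intro f
    choose x hx using fun i => h1 (f ∘ₗ LinearMap.single A (fun _ => T) i)
    refine ⟨x, LinearMap.ext fun t => ?_⟩
    rw [hF, pi_eq_sum_single f t]
    exact Finset.sum_congr rfl fun i _ => (hx i (t i)).symm

lemma projective_homCod (h1 : ∀ f : T →ₗ[A] T, ∃ x : B, ∀ t, f t = x • t)
    (h2 : ∀ x : B, (∀ t : T, x • t = 0) → x = 0) {n : ℕ} (a : K →ₗ[A] (Fin n → T))
    (b : (Fin n → T) →ₗ[A] K) (hab : ∀ x, b (a x) = x) : Module.Projective B (K →ₗ[A] T) := by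
  obtain ⟨E⟩ := exists_equiv_pi_cod h1 h2 n
  have : Module.Projective B ((Fin n → T) →ₗ[A] T) := Module.Projective.of_equiv E
  exact Module.Projective.of_split (homCodPre B T b) (homCodPre B T a)
    (LinearMap.ext fun f => LinearMap.ext fun x => congrArg f (hab x))

/-- Homomorphisms out of `Hom(K, T)`, for `K` in `add T`, are precompositions. -/
lemma exists_homCodPre (h1 : ∀ f : T →ₗ[A] T, ∃ x : B, ∀ t, f t = x • t) {n : ℕ}
    (a : K →ₗ[A] (Fin n → T)) (b : (Fin n → T) →ₗ[A] K) (hab : ∀ x, b (a x) = x)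
    (F : (K →ₗ[A] T) →ₗ[B] (M →ₗ[A] T)) : ∃ u : M →ₗ[A] K, ∀ f, F f = f ∘ₗ u := by
  refine ⟨b ∘ₗ LinearMap.pi fun i => F (LinearMap.proj i ∘ₗ a), fun f => ?_⟩
  choose x hx using fun i => h1 (f ∘ₗ b ∘ₗ LinearMap.single A (fun _ => T) i)
  have hf : f = ∑ i, x i • (LinearMap.proj i ∘ₗ a) := by
    ext y
    rw [LinearMap.sum_apply]
    conv_lhs => rw [← hab y]
    exact (pi_eq_sum_single (f ∘ₗ b) (a y)).trans
      (Finset.sum_congr rfl fun i _ => hx i _)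
  conv_lhs => rw [hf]
  rw [map_sum]
  ext y
  rw [LinearMap.sum_apply]
  refine Eq.trans ?_ (pi_eq_sum_single (f ∘ₗ b) _).symm
  exact Finset.sum_congr rfl fun i _ => by
    rw [map_smul, LinearMap.smul_apply, ← hx]
    rfl

variable (B) in
/-- The transpose of a test resolution: the cokernel of `Hom(Tⁿ, T) → Hom(K, T)`. -/
abbrev TestRes.coker (r : TestRes A T Z) : Type :=
  (LinearMap.ker r.π →ₗ[A] T) ⧸
    LinearMap.range (homCodPre B T (LinearMap.ker r.π).subtype)

lemma TestRes.exists_lift_pi (r : TestRes A T Z) {m : ℕ} (f : (Fin m → T) →ₗ[A] Z) :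
    ∃ u : (Fin m → T) →ₗ[A] (Fin r.n → T), ∀ x, r.π (u x) = f x := by
  choose u hu using fun i => r.exists_lift (f ∘ₗ LinearMap.single A (fun _ => T) i)
  refine ⟨∑ i, u i ∘ₗ LinearMap.proj i, fun x => ?_⟩
  rw [pi_eq_sum_single f, LinearMap.sum_apply, map_sum]
  exact Finset.sum_congr rfl fun i _ => LinearMap.congr_fun (hu i) (x i)

lemma TestRes.extZ_coker (h1 : ∀ f : T →ₗ[A] T, ∃ x : B, ∀ t, f t = x • t)
    (h2 : ∀ x : B, (∀ t : T, x • t = 0) → x = 0) (r : TestRes A T Z) (hZ : ExtZ A Z Z)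
    {Q : Type} [AddCommGroup Q] [Module B Q]
    (hQ : Mem (Fac B (ModuleCat.of B (r.coker B))) Q) : ExtZ B (r.coker B) Q := by
  have := projective_homCod h1 h2 (LinearMap.id : (Fin r.n → T) →ₗ[A] _) LinearMap.id
    (fun _ => rfl)
  have := projective_homCod h1 h2 r.a r.b r.retract
  have hk := isSES_ker r.surj
  let j := homCodPre B T (LinearMap.ker r.π).subtype
  have hj : ∀ y, (LinearMap.range j).mkQ (j y) = 0 := fun y => by
    rw [Submodule.mkQ_apply, Submodule.Quotient.mk_eq_zero]
    exact ⟨y, rfl⟩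
  refine extZ_of_comp_exact (j := j) (s := (LinearMap.range j).mkQ) (Submodule.mkQ_surjective _)
    hj (fun x hx => (Submodule.Quotient.mk_eq_zero _).1 hx) (fun u => ?_) hQ
  obtain ⟨u', hu'⟩ := Module.projective_lifting_property (LinearMap.range j).mkQ u
    (Submodule.mkQ_surjective _)
  obtain ⟨φ, hφ⟩ := exists_homCodPre h1 (LinearMap.id : (Fin r.n → T) →ₗ[A] _) LinearMap.id
    (fun _ => rfl) u'
  obtain ⟨w, hw⟩ := hZ.extend hk (r.π ∘ₗ φ)
  obtain ⟨c, hc⟩ := r.exists_lift_pi w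
  obtain ⟨d, hd⟩ := exists_factor_inj hk.1 (φ - c ∘ₗ (LinearMap.ker r.π).subtype) (fun x =>
    hk.exists_of_eq_zero (by
      rw [LinearMap.sub_apply, map_sub, LinearMap.comp_apply, hc, hw, LinearMap.comp_apply,
        sub_self]))
  refine ⟨(LinearMap.range j).mkQ ∘ₗ homCodPre B T d, fun y => ?_⟩
  have h3 : homCodPre B T d (j y) = u' y - j (y ∘ₗ c) := by
    rw [hφ, homCodPre_apply, homCodPre_apply, homCodPre_apply, LinearMap.comp_assoc, hd,
      LinearMap.comp_sub, LinearMap.comp_assoc]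
  rw [LinearMap.comp_apply, h3, map_sub, hj, sub_zero]
  exact LinearMap.congr_fun hu' y

lemma TestRes.hom_coker_eq_zero (h1 : ∀ f : T →ₗ[A] T, ∃ x : B, ∀ t, f t = x • t)
    (h2 : ∀ x : B, (∀ t : T, x • t = 0) → x = 0) (r : TestRes A T Z) (r' : TestRes A T Z')
    (h : ∀ f : Z' →ₗ[A] Z, f = 0) (F : r.coker B →ₗ[B] r'.coker B) : F = 0 := by
  have := projective_homCod h1 h2 r.a r.b r.retract
  have hk := isSES_ker r.surj
  have hk' := isSES_ker r'.surj
  let j := homCodPre B T (LinearMap.ker r.π).subtype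
  let j' := homCodPre B T (LinearMap.ker r'.π).subtype
  obtain ⟨G, hG⟩ := Module.projective_lifting_property (LinearMap.range j').mkQ
    (F ∘ₗ (LinearMap.range j).mkQ) (Submodule.mkQ_surjective _)
  obtain ⟨ψ, hψ⟩ := exists_homCodPre h1 r.a r.b r.retract G
  have hjG : ∀ g, ∃ g', j' g' = G (j g) := by
    intro g
    have := LinearMap.congr_fun hG (j g)
    have hz : (LinearMap.range j).mkQ (j g) = 0 := (Submodule.Quotient.mk_eq_zero _).2 ⟨g, rfl⟩
    rw [LinearMap.comp_apply, LinearMap.comp_apply, hz, map_zero] at this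
    exact (Submodule.Quotient.mk_eq_zero _).1 this
  choose θ hθ using fun i : Fin r.n => hjG (LinearMap.proj i)
  have hθψ : ∀ x, LinearMap.pi θ ((LinearMap.ker r'.π).subtype x) =
      (LinearMap.ker r.π).subtype (ψ x) := fun x => funext fun i => by
    have := LinearMap.congr_fun (hθ i) x
    rw [hψ] at this
    exact this
  obtain ⟨u, hu⟩ := exists_factor_surj r'.surj (r.π ∘ₗ LinearMap.pi θ) (fun x hx => by
    obtain ⟨y, rfl⟩ := hk'.exists_of_eq_zero hx
    rw [LinearMap.comp_apply, hθψ, hk.apply_eq_zero])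
  rw [h u, LinearMap.zero_comp] at hu
  obtain ⟨χ, hχ⟩ := exists_factor_inj hk.1 (LinearMap.pi θ) (fun x =>
    hk.exists_of_eq_zero (LinearMap.congr_fun hu x).symm)
  have hψχ : ∀ x, ψ x = χ ((LinearMap.ker r'.π).subtype x) := fun x => hk.1 (by
    rw [← hθψ, ← hχ, LinearMap.comp_apply])
  refine LinearMap.ext fun y => ?_
  obtain ⟨f, rfl⟩ := (LinearMap.range j).mkQ_surjective y
  have h3 := LinearMap.congr_fun hG f
  rw [LinearMap.comp_apply, LinearMap.comp_apply] at h3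
  rw [← h3, hψ, LinearMap.zero_apply]
  exact (Submodule.Quotient.mk_eq_zero _).2 ⟨f ∘ₗ χ, LinearMap.ext fun x =>
    congrArg f (hψχ x).symm⟩

lemma TestRes.nontrivial_coker (r : TestRes A T Z) (hZ : ∀ f : Z →ₗ[A] T, f = 0)
    [Nontrivial Z] : Nontrivial (r.coker B) := by
  by_contra hc
  rw [not_nontrivial_iff_subsingleton] at hc
  have hk := isSES_ker r.surj
  have h3 : ∀ f : LinearMap.ker r.π →ₗ[A] T, ∃ g : (Fin r.n → T) →ₗ[A] T,
      homCodPre B T (LinearMap.ker r.π).subtype g = f := fun f =>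
    (Submodule.Quotient.mk_eq_zero _).1 (Subsingleton.elim (α := r.coker B) _ _)
  choose g hg using fun i => h3 (LinearMap.proj i ∘ₗ r.a)
  obtain ⟨s, hs⟩ := hk.section_of_retraction (r := r.b ∘ₗ LinearMap.pi g) (fun y => by
    rw [LinearMap.comp_apply]
    convert r.retract y using 2
    exact funext fun i => LinearMap.congr_fun (hg i) y)
  have hs0 : s = 0 := LinearMap.ext fun z => funext fun i =>
    LinearMap.congr_fun (hZ (LinearMap.proj i ∘ₗ s)) z
  obtain ⟨z, hz⟩ := exists_ne (0 : Z)
  refine hz ?_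
  have := LinearMap.congr_fun hs z
  rw [hs0] at this
  simpa using this.symm

lemma TestRes.additive_coker (k : Type) [Field k] [Algebra k A] [Algebra k B]
    [FiniteDimensional k A] [Module k T] [IsScalarTower k A T] [IsScalarTower k B T]
    [FiniteDimensional k T]
    [Module.Projective A P₁] [Module.Projective A P₀] [Module.Finite A P₀]
    {f : P₁ →ₗ[A] P₀} {g : P₀ →ₗ[A] Z} (hs : IsSES A f g) (r : TestRes A T Z)
    (hT : ExtZ A T T) (hZ : ∀ f : Z →ₗ[A] T, f = 0) :
    Module.Finite B (r.coker B) ∧ ∀ ℓ : ModuleCat.{0} B → ℤ, IsAdditive ℓ →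
      ℓ (ModuleCat.of B (r.coker B)) = ℓ (ModuleCat.of B (P₁ →ₗ[A] T)) -
        ℓ (ModuleCat.of B (P₀ →ₗ[A] T)) := by
  have hk := isSES_ker r.surj
  obtain ⟨u, hu⟩ := Module.projective_lifting_property r.π g r.surj
  obtain ⟨c, hc⟩ := exists_factor_inj hk.1 (u ∘ₗ f) (fun x => hk.exists_of_eq_zero (by
    rw [LinearMap.comp_apply, ← hs.apply_eq_zero x]
    exact LinearMap.congr_fun hu (f x)))
  have hcone := isSES_cone hs hk hu hc
  have hfin : ∀ (X : Type) [AddCommGroup X] [Module A X] [Module.Finite A X],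
      Module.Finite B (X →ₗ[A] T) := by
    intro X _ _ _
    let _ := kmod k A X
    have := kmod_tower k A X
    have : FiniteDimensional k X := Module.Finite.trans A X
    have := TorsionLattice.finite_hom (k := k) (A := A) X T
    exact Module.Finite.of_restrictScalars_finite k B _
  have : IsArtinianRing A := IsArtinianRing.of_finite k A
  have : Module.Finite A T := Module.Finite.of_restrictScalars_finite k A T
  have := hfin (LinearMap.ker r.π)
  have := hfin P₀
  have := hfin (LinearMap.ker r.π × P₀)
  refine ⟨inferInstance, fun ℓ hℓ => ?_⟩
  have e1 := hℓ _ _ _ (homCodPre B T (LinearMap.ker r.π).subtype) (Submodule.mkQ _)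
    ⟨fun f₁ f₂ h => ?_, Submodule.mkQ_surjective _, (Submodule.ker_mkQ _).symm⟩ inferInstance
  · have e2 := hℓ _ _ _ (homCodPre B T ((LinearMap.ker r.π).subtype.coprod u))
      (homCodPre B T ((-c).prod f)) (isSES_mk (fun f₁ f₂ h => ?_) (fun v => ?_) (fun v => ?_)
        (fun v hv => ?_)) inferInstance
    · have e3 := hℓ.prod (LinearMap.ker r.π →ₗ[A] T) (P₀ →ₗ[A] T)
      have e4 := hℓ.equiv (LinearMap.coprodEquiv B (M := LinearMap.ker r.π) (M₂ := P₀) (M₃ := T)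
        (R := A))
      replace e1 : ℓ (ModuleCat.of B (LinearMap.ker r.π →ₗ[A] T)) =
        ℓ (ModuleCat.of B ((Fin r.n → T) →ₗ[A] T)) + ℓ (ModuleCat.of B (r.coker B)) := e1
      rw [← e4, e3, e1] at e2
      linarith
    · refine LinearMap.ext fun x => ?_
      obtain ⟨y, rfl⟩ := hcone.2.1 x
      exact LinearMap.congr_fun h y
    · obtain ⟨w, hw⟩ := (hT.pi_left (ι := Fin r.n)).extend hcone v
      exact ⟨w, LinearMap.ext hw⟩
    · refine LinearMap.ext fun x => ?_
      rw [homCodPre_apply, homCodPre_apply, LinearMap.comp_apply, LinearMap.comp_apply,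
        hcone.apply_eq_zero, map_zero, LinearMap.zero_apply]
    · obtain ⟨w, hw⟩ := exists_factor_surj hcone.2.1 v (fun e he => by
        obtain ⟨x, rfl⟩ := hcone.exists_of_eq_zero he
        exact LinearMap.congr_fun hv x)
      exact ⟨w, hw⟩
  · obtain ⟨w, hw⟩ := exists_factor_surj r.surj (f₁ - f₂) (fun e he => by
      have := LinearMap.congr_fun h ⟨e, he⟩
      rw [LinearMap.sub_apply, sub_eq_zero]
      exact this)
    rw [hZ w, LinearMap.zero_comp] at hw
    exact sub_eq_zero.1 hw.symm

end EndAlgCod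

section Arms

variable {k : Type} [Field k] {A B T : Type} [Ring A] [Ring B] [Algebra k A]
  [AddCommGroup T] [Module A T]

lemma projective_span_idem {s : A} (hs : s * s = s) :
    Module.Projective A (Submodule.span A {s}) := by
  refine projective_of_retract (Submodule.span A {s})
    ((LinearMap.toSpanSingleton A A s).codRestrict _ fun x =>
      Submodule.smul_mem _ x (Submodule.mem_span_singleton_self s)) fun x => Subtype.ext ?_
  obtain ⟨y, hy⟩ := Submodule.mem_span_singleton.1 x.2
  change x.1 * s = x.1
  rw [← hy, smul_eq_mul, mul_assoc, hs]

variable (k A T) in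
/-- Test modules `E` and `Y` attached to an arm of a canonical algebra. -/
structure ArmData (s w : A) where
  /-- the idempotent at the end of the arm -/
  c : A
  /-- the idempotent at the beginning of the arm -/
  d : A
  /-- the last arrow -/
  zE : A
  /-- the other arrows -/
  zY : A
  hc : c * c = c
  hd : d * d = d
  w_mul : w * zE = zE
  mul_c : zE * c = zE
  c_mul : c * zY = zY
  mul_s : zY * s = zY
  inj_c : ∀ x : T, zE • x = 0 → c • x = 0
  inj_s : ∀ x : T, zY • x = 0 → s • x = 0
  /-- the first test module -/
  E : ModuleCat.{0} A
  /-- the second test module -/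
  Y : ModuleCat.{0} A
  coindE : letI := kmod k A E; ∃ ξ : E →ₗ[k] k, IsCoinduced k w zE ξ
  coindY : letI := kmod k A Y; ∃ ξ : Y →ₗ[k] k, IsCoinduced k c zY ξ
  sesE : ∃ (f : Submodule.span A {d} →ₗ[A] Submodule.span A {s})
    (g : Submodule.span A {s} →ₗ[A] E), IsSES A f g
  sesY : ∃ (f : Submodule.span A {w} →ₗ[A] Submodule.span A {d})
    (g : Submodule.span A {d} →ₗ[A] Y), IsSES A f g
  homE : ∀ f : E →ₗ[A] T, f = 0
  homY : ∀ f : Y →ₗ[A] T, f = 0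


section

variable {s w : A} (X X' : ArmData k A T s w)

lemma ArmData.finite_E [FiniteDimensional k A] : Module.Finite A X.E := by
  have : IsArtinianRing A := IsArtinianRing.of_finite k A
  obtain ⟨f, g, hs⟩ := X.sesE
  exact Module.Finite.of_surjective g hs.2.1

lemma ArmData.finite_Y [FiniteDimensional k A] : Module.Finite A X.Y := by
  have : IsArtinianRing A := IsArtinianRing.of_finite k A
  obtain ⟨f, g, hs⟩ := X.sesY
  exact Module.Finite.of_surjective g hs.2.1

lemma ArmData.exists_testRes_E [FiniteDimensional k A] (hs : s * s = s) (hw : w * w = w) (hT : IsTilt A T) :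
    Nonempty (TestRes A T X.E) := by
  have := X.finite_E
  have := projective_span_idem hs
  have := projective_span_idem X.hd
  obtain ⟨f, g, h⟩ := X.sesE
  let _ := kmod k A X.E
  have := kmod_tower k A X.E
  obtain ⟨ξ, hξ⟩ := X.coindE
  exact hT.exists_testRes k h (hξ.extZ hw X.w_mul X.mul_c X.inj_c)

lemma ArmData.exists_testRes_Y [FiniteDimensional k A] (hw : w * w = w) (hT : IsTilt A T) :
    Nonempty (TestRes A T X.Y) := by
  have := X.finite_Y
  have := projective_span_idem hw
  have := projective_span_idem X.hd
  obtain ⟨f, g, h⟩ := X.sesY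
  let _ := kmod k A X.Y
  have := kmod_tower k A X.Y
  obtain ⟨ξ, hξ⟩ := X.coindY
  exact hT.exists_testRes k h (hξ.extZ X.hc X.c_mul X.mul_s X.inj_s)

end

section

attribute [local instance] homDomModule

variable [Algebra k B] [FiniteDimensional k A] [FiniteDimensional k B] [Module B T] [Module k T]
  [IsScalarTower k A T] [IsScalarTower k B T] [SMulCommClass B A T] [SMulCommClass B k T]
  [FiniteDimensional k T] {s w : A}

omit [FiniteDimensional k A] [FiniteDimensional k B] in
lemma ArmData.additive_hom (hw : w * w = w) (X : ArmData k A T s w)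
    (ℓ : ModuleCat.{0} Bᵐᵒᵖ → ℤ) (hℓ : IsAdditive ℓ) :
    ℓ (ModuleCat.of Bᵐᵒᵖ (T →ₗ[A] X.E)) + ℓ (ModuleCat.of Bᵐᵒᵖ (T →ₗ[A] X.Y)) =
      ℓ (ModuleCat.of Bᵐᵒᵖ (dualCorner k B T w)) -
        ℓ (ModuleCat.of Bᵐᵒᵖ (dualCorner k B T s)) := by
  let _ := kmod k A X.E
  have := kmod_tower k A X.E
  obtain ⟨ξ, hξ⟩ := X.coindE
  let _ := kmod k A X.Y
  have := kmod_tower k A X.Y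
  obtain ⟨ξ', hξ'⟩ := X.coindY
  rw [(hξ.additive_hom (B := B) hw X.w_mul X.mul_c X.inj_c).2 ℓ hℓ,
    (hξ'.additive_hom (B := B) X.hc X.c_mul X.mul_s X.inj_s).2 ℓ hℓ]
  ring

/-- Two test arms give two torsion classes without join over the opposite of the endomorphism
algebra of the tilting module. -/
lemma ArmData.not_isJoinSemilatticePoset_op (hs : s * s = s) (hw : w * w = w) (hT : IsTilt A T)
    (hB : IsEndAlg A B T) (X X' : ArmData k A T s w) (hE : ExtZ A X.E X.E) (hY : ExtZ A X.Y X.Y)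
    [Nontrivial X.E]
    (h11 : ∀ f : X.E →ₗ[A] X'.E, f = 0) (h12 : ∀ f : X.E →ₗ[A] X'.Y, f = 0)
    (h21 : ∀ f : X.Y →ₗ[A] X'.E, f = 0) (h22 : ∀ f : X.Y →ₗ[A] X'.Y, f = 0) :
    ¬ IsJoinSemilatticePoset (FTors Bᵐᵒᵖ) := by
  obtain ⟨r⟩ := X.exists_testRes_E hs hw hT
  obtain ⟨r'⟩ := X.exists_testRes_Y hw hT
  obtain ⟨q⟩ := X'.exists_testRes_E hs hw hT
  obtain ⟨q'⟩ := X'.exists_testRes_Y hw hT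
  have := hB.finite_homDom r
  have := hB.finite_homDom r'
  have := hB.finite_homDom q
  have := hB.finite_homDom q'
  have := r.nontrivial_hom
  exact not_isJoinSemilatticePoset k (A := Bᵐᵒᵖ) (V₁ := T →ₗ[A] X.E) (V₂ := T →ₗ[A] X.Y)
    (W₁ := T →ₗ[A] X'.E) (W₂ := T →ₗ[A] X'.Y)
    (fun Q _ _ hQ => hB.extZ_homDom r hE hQ) (fun Q _ _ hQ => hB.extZ_homDom r' hY hQ)
    (hB.homDom_eq_zero r h11) (hB.homDom_eq_zero r h12) (hB.homDom_eq_zero r' h21)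
    (hB.homDom_eq_zero r' h22)
    (fun ℓ hℓ => (X.additive_hom hw ℓ hℓ).trans (X'.additive_hom hw ℓ hℓ).symm)

end

section

variable [Algebra k B] [FiniteDimensional k A] [FiniteDimensional k B] [Module B T] [Module k T]
  [IsScalarTower k A T] [IsScalarTower k B T] [SMulCommClass B A T] [SMulCommClass A B T]
  [FiniteDimensional k T] {s w : A}

omit [SMulCommClass B A T] in
/-- Two test arms give two torsion classes without join over the endomorphism algebra of the
tilting module. -/
lemma ArmData.not_isJoinSemilatticePoset (hs : s * s = s) (hw : w * w = w) (hT : IsTilt A T)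
    (hB : IsEndAlg A B T) (X X' : ArmData k A T s w) (hE : ExtZ A X.E X.E) (hY : ExtZ A X.Y X.Y)
    [Nontrivial X.E]
    (h11 : ∀ f : X'.E →ₗ[A] X.E, f = 0) (h12 : ∀ f : X'.Y →ₗ[A] X.E, f = 0)
    (h21 : ∀ f : X'.E →ₗ[A] X.Y, f = 0) (h22 : ∀ f : X'.Y →ₗ[A] X.Y, f = 0) :
    ¬ IsJoinSemilatticePoset (FTors B) := by
  have hB1 := hB.exists_smul
  have hB2 := hB.faithful
  obtain ⟨r⟩ := X.exists_testRes_E hs hw hT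
  obtain ⟨r'⟩ := X.exists_testRes_Y hw hT
  obtain ⟨q⟩ := X'.exists_testRes_E hs hw hT
  obtain ⟨q'⟩ := X'.exists_testRes_Y hw hT
  have : IsArtinianRing A := IsArtinianRing.of_finite k A
  have := projective_span_idem hs
  have := projective_span_idem hw
  have := projective_span_idem X.hd
  have := projective_span_idem X'.hd
  obtain ⟨_, _, hs1⟩ := X.sesE
  obtain ⟨_, _, hs2⟩ := X.sesY
  obtain ⟨_, _, hs3⟩ := X'.sesE
  obtain ⟨_, _, hs4⟩ := X'.sesY
  obtain ⟨f1, l1⟩ := TestRes.additive_coker (B := B) k hs1 r hT.extZ_self X.homE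
  obtain ⟨f2, l2⟩ := TestRes.additive_coker (B := B) k hs2 r' hT.extZ_self X.homY
  obtain ⟨f3, l3⟩ := TestRes.additive_coker (B := B) k hs3 q hT.extZ_self X'.homE
  obtain ⟨f4, l4⟩ := TestRes.additive_coker (B := B) k hs4 q' hT.extZ_self X'.homY
  have := r.nontrivial_coker (B := B) X.homE
  refine TorsionLattice.not_isJoinSemilatticePoset k (A := B) (V₁ := r.coker B)
    (V₂ := r'.coker B) (W₁ := q.coker B) (W₂ := q'.coker B)
    (fun Q _ _ hQ => r.extZ_coker hB1 hB2 hE hQ) (fun Q _ _ hQ => r'.extZ_coker hB1 hB2 hY hQ)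
    (r.hom_coker_eq_zero hB1 hB2 q h11) (r.hom_coker_eq_zero hB1 hB2 q' h12)
    (r'.hom_coker_eq_zero hB1 hB2 q h21) (r'.hom_coker_eq_zero hB1 hB2 q' h22)
    fun ℓ hℓ => ?_
  rw [l1 ℓ hℓ, l2 ℓ hℓ, l3 ℓ hℓ, l4 ℓ hℓ]
  ring

end

end Arms

section CyclicQuotients

variable {A : Type} [Ring A] {s d x : A}

/-- The quotient of the left ideal of `s` by the left ideal of `x`. -/
def cycQuot (s x : A) : ModuleCat.{0} A :=
  ModuleCat.of A (Submodule.span A {s} ⧸ (Submodule.span A {x}).submoduleOf (Submodule.span A {s}))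

/-- The generator of the cyclic quotient. -/
def cycGen (s x : A) : cycQuot s x :=
  Submodule.Quotient.mk (⟨s, Submodule.mem_span_singleton_self s⟩ : Submodule.span A {s})

lemma smul_cycGen (c : A) : c • cycGen s x = Submodule.Quotient.mk
    (⟨c * s, Submodule.smul_mem _ c (Submodule.mem_span_singleton_self s)⟩ :
      Submodule.span A {s}) := rfl

lemma exists_eq_smul_cycGen (q : cycQuot s x) : ∃ c : A, q = c • cycGen s x := by
  obtain ⟨⟨y, hy⟩, rfl⟩ := Submodule.Quotient.mk_surjective _ q
  obtain ⟨c, rfl⟩ := Submodule.mem_span_singleton.1 hy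
  exact ⟨c, rfl⟩

lemma smul_cycGen_eq_zero_iff (c : A) : c • cycGen s x = 0 ↔ ∃ b, c * s = b * x := by
  rw [smul_cycGen]
  refine (Submodule.Quotient.mk_eq_zero _).trans ?_
  refine (Submodule.mem_span_singleton (R := A) (x := c * s) (y := x)).trans ?_
  simp only [smul_eq_mul, eq_comm]

lemma self_smul_cycGen (hs : s * s = s) : s • cycGen s x = cycGen s x := by
  rw [smul_cycGen]
  simp only [hs]
  rfl

lemma right_smul_cycGen (hx : x * s = x) : x • cycGen s x = 0 :=
  (smul_cycGen_eq_zero_iff x).2 ⟨1, by rw [hx, one_mul]⟩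

lemma hom_cycQuot_eq_zero {M : Type} [AddCommGroup M] [Module A M] (f : cycQuot s x →ₗ[A] M)
    (hf : f (cycGen s x) = 0) : f = 0 := by
  ext q
  obtain ⟨c, rfl⟩ := exists_eq_smul_cycGen q
  rw [map_smul, hf, smul_zero, LinearMap.zero_apply]

lemma hom_span_eq_zero {M : Type} [AddCommGroup M] [Module A M]
    (f : Submodule.span A {d} →ₗ[A] M)
    (hf : f ⟨d, Submodule.mem_span_singleton_self d⟩ = 0) : f = 0 := by
  ext ⟨q, hq⟩
  obtain ⟨c, rfl⟩ := Submodule.mem_span_singleton.1 hq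
  have := map_smul f c ⟨d, Submodule.mem_span_singleton_self d⟩
  rw [hf, smul_zero] at this
  exact this

lemma exists_isSES_cycQuot (hx : x * s = x) (hd : d * d = d) (hdx : d * x = x)
    (hinj : ∀ y, y * d = y → y * x = 0 → y = 0) :
    ∃ (f : Submodule.span A {d} →ₗ[A] Submodule.span A {s})
      (g : Submodule.span A {s} →ₗ[A] cycQuot s x), IsSES A f g := by
  have hxs : ∀ y, y * x ∈ Submodule.span A {s} := fun y =>
    Submodule.mem_span_singleton.2 ⟨y * x, by rw [smul_eq_mul, mul_assoc, hx]⟩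
  refine ⟨((LinearMap.toSpanSingleton A A x).codRestrict _ hxs) ∘ₗ
    (Submodule.span A {d}).subtype, Submodule.mkQ _, isSES_mk ?_ (Submodule.mkQ_surjective _) ?_ ?_⟩
  · rw [← LinearMap.ker_eq_bot, LinearMap.ker_eq_bot']
    rintro ⟨y, hy⟩ h
    obtain ⟨c, rfl⟩ := Submodule.mem_span_singleton.1 hy
    have h : c * d * x = 0 := congrArg Subtype.val h
    exact Subtype.ext (hinj _ (show c * d * d = c * d by rw [mul_assoc, hd]) h)
  · rintro ⟨y, hy⟩
    refine (Submodule.Quotient.mk_eq_zero _).2 ?_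
    exact (Submodule.mem_span_singleton (R := A) (x := y * x) (y := x)).2 ⟨y, rfl⟩
  · rintro ⟨y, hy⟩ h
    obtain ⟨c, hc⟩ := (Submodule.mem_span_singleton (R := A) (x := y) (y := x)).1
      ((Submodule.Quotient.mk_eq_zero (x := (⟨y, hy⟩ : Submodule.span A {s})) _).1 h)
    refine ⟨⟨c * d, Submodule.smul_mem _ c (Submodule.mem_span_singleton_self d)⟩,
      Subtype.ext ?_⟩
    change c * d * x = y
    rw [mul_assoc, hdx]
    exact hc

lemma extZ_cycQuot {M : Type} [AddCommGroup M] [Module A M] (hs : s * s = s) (hx : x * s = x)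
    (hd : d * d = d) (hdx : d * x = x) (hinj : ∀ y, y * d = y → y * x = 0 → y = 0)
    (hM : ∀ m : M, d • m = m → m = 0) : ExtZ A (cycQuot s x) M := by
  have := projective_span_idem hs
  obtain ⟨f, g, h⟩ := exists_isSES_cycQuot hx hd hdx hinj
  refine extZ_of_presentation h fun u => ⟨0, fun w => ?_⟩
  rw [hom_span_eq_zero u, LinearMap.zero_apply, LinearMap.zero_apply]
  refine hM _ ?_
  rw [← map_smul]
  congr 1
  exact Subtype.ext hd

end CyclicQuotients

section CanonicalArms

variable {k : Type} [Field k] {t : ℕ} {p : Fin t → ℕ} {lam : Fin t → k}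

variable (k p lam) in
/-- The module `E` of an arm. -/
abbrev armE (i : Fin t) : ModuleCat.{0} (CanAlg k t p lam) :=
  cycQuot (canE k lam (canSource t p)) (canArrow k p lam i 0)

variable (k p lam) in
/-- The module `Y` of an arm. -/
abbrev armY (i : Fin t) : ModuleCat.{0} (CanAlg k t p lam) :=
  cycQuot (canE k lam (canPos p i 1)) (canPath k p lam i 1 (p i - 1))

lemma canArrow_zero_mul_source (i : Fin t) :
    canArrow k p lam i 0 * canE k lam (canSource t p) = canArrow k p lam i 0 := by
  rw [← canPos_zero i, canArrow_mul_canE]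

lemma canPath_mul_arrow (hp : ∀ i, 1 ≤ p i) (i : Fin t) :
    canPath k p lam i 1 (p i - 1) * canArrow k p lam i 0 = canW k p lam i := by
  have h := canPath_mul (k := k) (p := p) (lam := lam) i 0 1 (p i - 1)
  rw [zero_add, canPath_one] at h
  rw [h, canW]
  congr 1
  have := hp i
  omega

lemma sink_mul_canPath (hp : ∀ i, 1 ≤ p i) (i : Fin t) :
    canE k lam (canSink t p) * canPath k p lam i 1 (p i - 1) = canPath k p lam i 1 (p i - 1) := by
  have h := canE_mul_canPath (k := k) (p := p) (lam := lam) i 1 (p i - 1)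
  have := hp i
  rwa [show 1 + (p i - 1) = p i by omega, canPos_last hp] at h

lemma canE_mul_arrow (i : Fin t) :
    canE k lam (canPos p i 1) * canArrow k p lam i 0 = canArrow k p lam i 0 :=
  canE_mul_canArrow i 0

lemma injective_arrow (hd : IsCanonicalData k t p lam) (i : Fin t) (y : CanAlg k t p lam)
    (h : y * canE k lam (canPos p i 1) = y) (h0 : y * canArrow k p lam i 0 = 0) : y = 0 :=
  mul_canPath_injective hd i (a := 0) (n := 1) (by omega) (hd.2.1 i) h (by rwa [canPath_one])

lemma injective_path (hd : IsCanonicalData k t p lam) (i : Fin t) (y : CanAlg k t p lam)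
    (h : y * canE k lam (canSink t p) = y) (h0 : y * canPath k p lam i 1 (p i - 1) = 0) :
    y = 0 := by
  have := hd.2.1 i
  have h1 : 1 + (p i - 1) = p i := by omega
  exact mul_canPath_injective hd i (by omega) (by omega)
    (by rw [h1, canPos_last hd.2.1]; exact h) h0

lemma canW_smul_ne_zero (hd : IsCanonicalData k t p lam) {i j : Fin t} (hij : i ≠ j) :
    canW k p lam i • cycGen (canE k lam (canSource t p)) (canArrow k p lam j 0) ≠ 0 := by
  rw [Ne, smul_cycGen_eq_zero_iff]
  rintro ⟨b, hb⟩
  have hp := hd.2.1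
  have h1 : canW k p lam i * canE k lam (canSource t p) = canW k p lam i := by
    rw [← canPos_zero i, canPath_mul_canE]
  have h2 : canE k lam (canSink t p) * canW k p lam i = canW k p lam i := by
    have := canE_mul_canPath (k := k) (p := p) (lam := lam) i 0 (p i)
    rwa [zero_add, canPos_last hp] at this
  have h3 : canW k p lam i = canE k lam (canSink t p) * b * canE k lam (canPos p j 1) *
      canArrow k p lam j 0 := by
    rw [mul_assoc _ (canE k lam (canPos p j 1)), canE_mul_arrow, mul_assoc, ← hb, h1, h2]
  rcases corner_internal hd j le_rfl (hp j) (canSink t p) b with h | ⟨r, n, hn, hn', h⟩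
  · rw [h, zero_mul] at h3
    exact canW_ne_zero hd i h3
  · have := canPos_eq_sink hp hn hn'
    obtain rfl : n = p j - 1 := by omega
    rw [h, smul_mul_assoc, canPath_mul_arrow hp] at h3
    exact canW_ne_smul hd hij r h3

lemma source_corner (hd : IsCanonicalData k t p lam) (c : CanAlg k t p lam) :
    ∃ r : k, canE k lam (canSource t p) * c * canE k lam (canSource t p) =
      r • canE k lam (canSource t p) := by
  obtain ⟨r, hr⟩ := Submodule.mem_span_singleton.1 (corner_mem hd.pos hd.2.1 (canSource t p)
    (canSource t p) (Submodule.span k {canE k lam (canSource t p)}) (fun i j n hn h1 h2 => by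
      obtain rfl := canPos_eq_source hd.2.1 (by omega) h1
      have := canPos_eq_source hd.2.1 hn h2
      obtain rfl : n = 0 := by omega
      rw [canPath, canPos_zero]
      exact Submodule.mem_span_singleton_self _) c)
  exact ⟨r, hr.symm⟩

lemma arrow_corner (hd : IsCanonicalData k t p lam) {i : Fin t} (hi : 2 ≤ p i)
    (c : CanAlg k t p lam) :
    ∃ r : k, canE k lam (canPos p i 1) * c * canE k lam (canSource t p) =
      r • canArrow k p lam i 0 := by
  obtain ⟨r, hr⟩ := Submodule.mem_span_singleton.1 (corner_mem hd.pos hd.2.1 (canSource t p)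
    (canPos p i 1) (Submodule.span k {canArrow k p lam i 0}) (fun i' j n hn h1 h2 => by
      obtain rfl := canPos_eq_source hd.2.1 (by omega) h1
      rcases canPos_eq hd.2.1 hn (by omega) h2 with h | h | ⟨rfl, h⟩
      · omega
      · omega
      · obtain rfl : n = 1 := by omega
        rw [canPath_one]
        exact Submodule.mem_span_singleton_self _) c)
  exact ⟨r, hr.symm⟩

lemma source_corner_eq_zero (hd : IsCanonicalData k t p lam) (i : Fin t) (c : CanAlg k t p lam) :
    canE k lam (canSource t p) * c * canE k lam (canPos p i 1) = 0 := by
  refine (corner_internal hd i le_rfl (hd.2.1 i) _ c).resolve_right ?_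
  rintro ⟨r, n, hn, h, -⟩
  have := canPos_eq_source hd.2.1 hn h
  omega

lemma arrow_corner_eq_zero (hd : IsCanonicalData k t p lam) {i j : Fin t} (hij : i ≠ j)
    (hi : 2 ≤ p i) (c : CanAlg k t p lam) :
    canE k lam (canPos p i 1) * c * canE k lam (canPos p j 1) = 0 := by
  refine (corner_internal hd j le_rfl (hd.2.1 j) _ c).resolve_right ?_
  rintro ⟨r, n, hn, h, -⟩
  rcases canPos_eq hd.2.1 hn (by omega) h with h | h | ⟨h, -⟩
  · omega
  · omega
  · exact hij h.symm

lemma sink_corner (hd : IsCanonicalData k t p lam) (i : Fin t) (c : CanAlg k t p lam) :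
    ∃ r : k, canE k lam (canSink t p) * c * canE k lam (canPos p i 1) =
      r • canPath k p lam i 1 (p i - 1) := by
  rcases corner_internal hd i le_rfl (hd.2.1 i) (canSink t p) c with h | ⟨r, n, hn, hx, hr⟩
  · exact ⟨0, by rw [h, zero_smul]⟩
  · have := canPos_eq_sink hd.2.1 hn hx
    obtain rfl : n = p i - 1 := by omega
    exact ⟨r, hr⟩

/-- A vertex component of a module generated by an element of another vertex component. -/
lemma eq_corner_smul {A Q : Type} [Ring A] [AddCommGroup Q] [Module A Q] {s y : A} {q₀ q : Q}
    (hq₀ : s • q₀ = q₀) (hq : y • q = q) (hgen : ∃ c : A, q = c • q₀) :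
    ∃ c : A, q = (y * c * s) • q₀ := by
  obtain ⟨c, rfl⟩ := hgen
  exact ⟨c, by rw [mul_smul, mul_smul, hq₀, hq]⟩

lemma algebra_smul_eq {Q : Type} [AddCommGroup Q] [Module (CanAlg k t p lam) Q]
    (r : k) (x : CanAlg k t p lam) (q : Q) :
    (r • x) • q = algebraMap k (CanAlg k t p lam) r • x • q := by
  rw [Algebra.smul_def, mul_smul]

lemma smul_smul_eq_zero {A Q : Type} [Ring A] [Algebra k A] [AddCommGroup Q] [Module A Q]
    {r : k} {q : Q} (h : algebraMap k A r • q = 0) : r = 0 ∨ q = 0 := by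
  let _ := kmod k A Q
  exact smul_eq_zero.1 (show r • q = 0 from h)

/-- A vertex component of the image of the generator. -/
lemma smul_map_cycGen {A M : Type} [Ring A] [AddCommGroup M] [Module A M] {s x : A}
    (hs : s * s = s) (f : cycQuot s x →ₗ[A] M) : s • f (cycGen s x) = f (cycGen s x) := by
  rw [← map_smul, self_smul_cycGen hs]

lemma source_gen (i : Fin t) : canE k lam (canSource t p) •
    cycGen (canE k lam (canSource t p)) (canArrow k p lam i 0) =
      cycGen (canE k lam (canSource t p)) (canArrow k p lam i 0) :=
  self_smul_cycGen (canE_mul_self _)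

lemma arrow_gen (i : Fin t) : canE k lam (canPos p i 1) •
    cycGen (canE k lam (canPos p i 1)) (canPath k p lam i 1 (p i - 1)) =
      cycGen (canE k lam (canPos p i 1)) (canPath k p lam i 1 (p i - 1)) :=
  self_smul_cycGen (canE_mul_self _)

lemma arrow_smul_gen (i : Fin t) : canArrow k p lam i 0 •
    cycGen (canE k lam (canSource t p)) (canArrow k p lam i 0) = 0 :=
  right_smul_cycGen (canArrow_zero_mul_source i)

lemma path_smul_gen (i : Fin t) : canPath k p lam i 1 (p i - 1) •
    cycGen (canE k lam (canPos p i 1)) (canPath k p lam i 1 (p i - 1)) = 0 :=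
  right_smul_cycGen (canPath_mul_canE i 1 _)

lemma subsingleton_armY {i : Fin t} (hi : p i = 1) : Subsingleton (armY k p lam i) := by
  have h0 : cycGen (canE k lam (canPos p i 1)) (canPath k p lam i 1 (p i - 1)) = 0 := by
    have h := path_smul_gen (k := k) (p := p) (lam := lam) i
    have : canPath k p lam i 1 (p i - 1) = canE k lam (canPos p i 1) := by
      rw [hi]; rfl
    rw [← arrow_gen, ← h]
    congr 1
    exact this.symm
  refine subsingleton_of_forall_eq 0 fun q => ?_
  obtain ⟨c, rfl⟩ := exists_eq_smul_cycGen q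
  rw [h0, smul_zero]

lemma nontrivial_armE (hd : IsCanonicalData k t p lam) (i : Fin t) :
    Nontrivial (armE k p lam i) := by
  obtain ⟨j, hij⟩ := exists_arm_ne hd i
  exact ⟨_, _, canW_smul_ne_zero hd hij.symm⟩

section Homs

variable (hd : IsCanonicalData k t p lam) {i j : Fin t}
include hd

lemma hom_armE_armE (hij : i ≠ j) (f : armE k p lam i →ₗ[CanAlg k t p lam] armE k p lam j) :
    f = 0 := by
  refine hom_cycQuot_eq_zero f ?_
  obtain ⟨c, hc⟩ := eq_corner_smul (source_gen j) (smul_map_cycGen (canE_mul_self _) f)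
    (exists_eq_smul_cycGen _)
  obtain ⟨r, hr⟩ := source_corner hd c
  have h0 : canW k p lam i • f (cycGen _ _) = 0 := by
    rw [← canPath_mul_arrow hd.2.1, mul_smul, ← map_smul, arrow_smul_gen, map_zero, smul_zero]
  rw [hc, hr, algebra_smul_eq, ← mul_smul, ← Algebra.commutes, mul_smul, source_gen] at h0
  rw [hc, hr, algebra_smul_eq]
  rcases smul_smul_eq_zero h0 with h | h
  · rw [h, map_zero, zero_smul]
  · exact (canW_smul_ne_zero hd hij h).elim

lemma hom_armE_armY (f : armE k p lam i →ₗ[CanAlg k t p lam] armY k p lam j) : f = 0 := by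
  refine hom_cycQuot_eq_zero f ?_
  obtain ⟨c, hc⟩ := eq_corner_smul (arrow_gen j) (smul_map_cycGen (canE_mul_self _) f)
    (exists_eq_smul_cycGen _)
  rw [hc, source_corner_eq_zero hd, zero_smul]

lemma hom_armY_armE (hij : i ≠ j) (f : armY k p lam i →ₗ[CanAlg k t p lam] armE k p lam j) :
    f = 0 := by
  by_cases hi : 2 ≤ p i
  · refine hom_cycQuot_eq_zero f ?_
    obtain ⟨c, hc⟩ := eq_corner_smul (source_gen j) (smul_map_cycGen (canE_mul_self _) f)
      (exists_eq_smul_cycGen _)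
    obtain ⟨r, hr⟩ := arrow_corner hd hi c
    have h0 : canPath k p lam i 1 (p i - 1) • f (cycGen _ _) = 0 := by
      rw [← map_smul, path_smul_gen, map_zero]
    rw [hc, hr, algebra_smul_eq, ← mul_smul, ← Algebra.commutes, mul_smul,
      ← mul_smul (canPath k p lam i 1 (p i - 1)), canPath_mul_arrow hd.2.1] at h0
    rw [hc, hr, algebra_smul_eq]
    rcases smul_smul_eq_zero h0 with h | h
    · rw [h, map_zero, zero_smul]
    · exact (canW_smul_ne_zero hd hij h).elim
  · have := hd.2.1 i
    have := subsingleton_armY (k := k) (lam := lam) (p := p) (i := i) (by omega)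
    ext q
    rw [Subsingleton.elim q 0, map_zero, map_zero]

lemma hom_armY_armY (hij : i ≠ j) (f : armY k p lam i →ₗ[CanAlg k t p lam] armY k p lam j) :
    f = 0 := by
  by_cases hi : 2 ≤ p i
  · refine hom_cycQuot_eq_zero f ?_
    obtain ⟨c, hc⟩ := eq_corner_smul (arrow_gen j) (smul_map_cycGen (canE_mul_self _) f)
      (exists_eq_smul_cycGen _)
    rw [hc, arrow_corner_eq_zero hd hij hi, zero_smul]
  · have := hd.2.1 i
    have := subsingleton_armY (k := k) (lam := lam) (p := p) (i := i) (by omega)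
    ext q
    rw [Subsingleton.elim q 0, map_zero, map_zero]

lemma extZ_armE (hi : 2 ≤ p i) : ExtZ (CanAlg k t p lam) (armE k p lam i) (armE k p lam i) := by
  refine extZ_cycQuot (canE_mul_self _) (canArrow_zero_mul_source i) (canE_mul_self _)
    (canE_mul_arrow i) (injective_arrow hd i) fun m hm => ?_
  obtain ⟨c, hc⟩ := eq_corner_smul (source_gen i) hm (exists_eq_smul_cycGen _)
  obtain ⟨r, hr⟩ := arrow_corner hd hi c
  rw [hc, hr, algebra_smul_eq, arrow_smul_gen, smul_zero]

lemma extZ_armY : ExtZ (CanAlg k t p lam) (armY k p lam i) (armY k p lam i) := by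
  refine extZ_cycQuot (canE_mul_self _) (canPath_mul_canE i 1 _) (canE_mul_self _)
    (sink_mul_canPath hd.2.1 i) (injective_path hd i) fun m hm => ?_
  obtain ⟨c, hc⟩ := eq_corner_smul (arrow_gen i) hm (exists_eq_smul_cycGen _)
  obtain ⟨r, hr⟩ := sink_corner hd i c
  rw [hc, hr, algebra_smul_eq, path_smul_gen, smul_zero]

lemma exists_isCoinduced_armE (i : Fin t) :
    letI := kmod k (CanAlg k t p lam) (armE k p lam i)
    ∃ ξ : armE k p lam i →ₗ[k] k,
      IsCoinduced k (canE k lam (canSink t p)) (canArrow k p lam i (p i - 1)) ξ := by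
  let _ := kmod k (CanAlg k t p lam) (armE k p lam i)
  have := kmod_tower k (CanAlg k t p lam) (armE k p lam i)
  obtain ⟨j, hij⟩ := exists_arm_ne hd i
  exact isCoinduced_top (Q := armE k p lam i) hd hij.symm exists_eq_smul_cycGen (source_gen i)
    (arrow_smul_gen i) (canW_smul_ne_zero hd hij.symm)

lemma exists_isCoinduced_armY (i : Fin t) :
    letI := kmod k (CanAlg k t p lam) (armY k p lam i)
    ∃ ξ : armY k p lam i →ₗ[k] k,
      IsCoinduced k (canE k lam (canPos p i (p i - 1))) (canPath k p lam i 0 (p i - 1)) ξ := by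
  let _ := kmod k (CanAlg k t p lam) (armY k p lam i)
  have := kmod_tower k (CanAlg k t p lam) (armY k p lam i)
  by_cases hi : 2 ≤ p i
  · obtain ⟨m, hm⟩ : ∃ m, p i = m + 2 := ⟨p i - 2, by omega⟩
    have h := isCoinduced_interval (Q := armY k p lam i) (i := i) (a := 0) (m := m) hd (by omega)
      exists_eq_smul_cycGen (arrow_gen i)
      (by
        have e : canPath k p lam i (0 + 1) (m + 1) = canPath k p lam i 1 (p i - 1) := by
          rw [show p i - 1 = m + 1 by omega]
        rw [e]
        exact path_smul_gen i)
      (by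
        rw [Ne, smul_cycGen_eq_zero_iff]
        rintro ⟨b, hb⟩
        have h0 := canPath_mul_canE (k := k) (p := p) (lam := lam) i (0 + 1) m
        have h1 := canE_mul_canPath (k := k) (p := p) (lam := lam) i (0 + 1) m
        refine canPath_ne_zero (n := m) (j := 0 + 1) hd (by omega : 0 + 1 + m ≤ p i) ?_
        rw [← h1, ← h0, zero_add, ← zero_add 1, hb, ← sink_mul_canPath hd.2.1 i, ← mul_assoc,
          ← mul_assoc, ← canPos_last hd.2.1 i]
        rcases corner_internal hd i (hd.2.1 i) le_rfl (canPos p i (0 + 1 + m)) b with h | h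
        · rw [h, zero_mul]
        · obtain ⟨r, n, hn, hx, -⟩ := h
          rw [show n = 0 by omega, add_zero, canPos_last hd.2.1] at hx
          have := canPos_eq_sink hd.2.1 (by omega) hx.symm
          omega)
    rw [show p i - 1 = m + 1 by omega]
    simpa only [zero_add] using h
  · have := hd.2.1 i
    have hi : p i = 1 := by omega
    have := subsingleton_armY (k := k) (lam := lam) hi
    exact ⟨0, isCoinduced_of_subsingleton (by rw [hi]; rfl) 0⟩

/-- The test modules of an arm. -/
def armData {T : Type} [AddCommGroup T] [Module (CanAlg k t p lam) T]
    (hT : IsArmInjective k p lam T) (i : Fin t) :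
    ArmData k (CanAlg k t p lam) T (canE k lam (canSource t p)) (canE k lam (canSink t p)) where
  c := canE k lam (canPos p i (p i - 1))
  d := canE k lam (canPos p i 1)
  zE := canArrow k p lam i (p i - 1)
  zY := canPath k p lam i 0 (p i - 1)
  hc := canE_mul_self _
  hd := canE_mul_self _
  w_mul := by
    have := canE_mul_canArrow (k := k) (p := p) (lam := lam) i (p i - 1)
    rwa [Nat.sub_add_cancel (hd.2.1 i), canPos_last hd.2.1] at this
  mul_c := canArrow_mul_canE i _
  c_mul := by
    have := canE_mul_canPath (k := k) (p := p) (lam := lam) i 0 (p i - 1)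
    rwa [zero_add] at this
  mul_s := by rw [← canPos_zero i, canPath_mul_canE]
  inj_c := hT i _ (Nat.sub_lt (hd.2.1 i) one_pos)
  inj_s x hx := by
    have := hT.path (by omega) hx
    rwa [canPos_zero] at this
  E := armE k p lam i
  Y := armY k p lam i
  coindE := exists_isCoinduced_armE hd i
  coindY := exists_isCoinduced_armY hd i
  sesE := exists_isSES_cycQuot (canArrow_zero_mul_source i) (canE_mul_self _)
    (canE_mul_arrow i) (injective_arrow hd i)
  sesY := exists_isSES_cycQuot (canPath_mul_canE i 1 _) (canE_mul_self _)
    (sink_mul_canPath hd.2.1 i) (injective_path hd i)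
  homE f := by
    refine hom_cycQuot_eq_zero f ?_
    have h := hT i 0 (hd.2.1 i) (f (cycGen _ _)) (by rw [← map_smul, arrow_smul_gen, map_zero])
    rwa [canPos_zero, smul_map_cycGen (canE_mul_self _)] at h
  homY f := by
    refine hom_cycQuot_eq_zero f ?_
    have := hd.2.1 i
    have h := hT.path (i := i) (j := 1) (n := p i - 1) (by omega) (x := f (cycGen _ _))
      (by rw [← map_smul, path_smul_gen, map_zero])
    rwa [smul_map_cycGen (canE_mul_self _)] at h

end Homs

end CanonicalArms

section Euler

variable (k : Type) [Field k] {A : Type} [Ring A] [Algebra k A] [FiniteDimensional k A]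
  {S X Y Z : Type} [AddCommGroup S] [Module A S] [Module.Finite A S] [AddCommGroup X] [Module A X]
  [AddCommGroup Y] [Module A Y] [AddCommGroup Z] [Module A Z]

variable (S) in
lemma dimHom_of_extend [Module.Finite A Y] {f : X →ₗ[A] Y} {g : Y →ₗ[A] Z} (h : IsSES A f g)
    (hu : ∀ u : X →ₗ[A] S, ∃ v : Y →ₗ[A] S, v ∘ₗ f = u) :
    dimHom k A Y S = dimHom k A X S + dimHom k A Z S := by
  let _ := kmod k A S
  have := kmod_tower k A S
  let _ := kmod k A Y
  have := kmod_tower k A Y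
  have : FiniteDimensional k S := Module.Finite.trans A S
  have : FiniteDimensional k Y := Module.Finite.trans A Y
  have := finite_hom (k := k) (A := A) Y S
  have h1 : IsSES k (homPre k S g) (homPre k S f) := isSES_homPre h hu
  rw [dimHom, dimHom, dimHom, finrank_of_isSES h1, add_comm]

variable (S) in
lemma dimHom_of_projective [Module.Finite A Y] [Module.Projective A Z] {f : X →ₗ[A] Y}
    {g : Y →ₗ[A] Z} (h : IsSES A f g) : dimHom k A Y S = dimHom k A X S + dimHom k A Z S :=
  dimHom_of_extend k S h fun u => by
    obtain ⟨v, hv⟩ := (extZ_of_projective (X := Z) (Y := S)).extend h u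
    exact ⟨v, LinearMap.ext hv⟩

variable (S) in
lemma dimHom_prod [Module.Finite A X] [Module.Finite A Y] :
    dimHom k A (X × Y) S = dimHom k A X S + dimHom k A Y S :=
  dimHom_of_extend k S isSES_prod fun u => ⟨u ∘ₗ LinearMap.fst A X Y, rfl⟩

variable (S) in
lemma dimHom_pi [Module.Finite A X] (n : ℕ) :
    dimHom k A (Fin n → X) S = n * dimHom k A X S := by
  let _ := kmod k A S
  have := kmod_tower k A S
  let _ := kmod k A X
  have := kmod_tower k A X
  have : FiniteDimensional k S := Module.Finite.trans A S
  have : FiniteDimensional k X := Module.Finite.trans A X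
  have := finite_hom (k := k) (A := A) X S
  rw [dimHom, dimHom, ← (LinearMap.lsum A (fun _ : Fin n => X) (M := S) k).finrank_eq,
    Module.finrank_pi_fintype]
  simp

/-- The value at `Y` of the Euler form, computed by homomorphisms to `S` from a projective cover
and its kernel. -/
def HasEuler (S Y : Type) [AddCommGroup S] [Module A S] [AddCommGroup Y] [Module A Y]
    (c : ℤ) : Prop :=
  ∃ (K F : ModuleCat.{0} A) (i : K →ₗ[A] F) (g : F →ₗ[A] Y), Module.Finite A F ∧
    Module.Projective A F ∧ IsSES A i g ∧ c = dimHom k A F S - dimHom k A K S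

variable {k}

lemma HasEuler.unique {c d : ℤ} (hc : HasEuler k (A := A) S Y c) (hd : HasEuler k (A := A) S Y d) :
    c = d := by
  obtain ⟨K, F, i, g, _, _, hs, rfl⟩ := hc
  obtain ⟨K', F', i', g', _, _, hs', rfl⟩ := hd
  have : IsArtinianRing A := IsArtinianRing.of_finite k A
  let D : Submodule A (F × F') :=
    LinearMap.ker (g ∘ₗ LinearMap.fst A F F' - g' ∘ₗ LinearMap.snd A F F')
  have hD : ∀ x : F × F', x ∈ D ↔ g x.1 = g' x.2 := fun x => by
    simp [D, sub_eq_zero]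
  have h1 : IsSES A ((LinearMap.inl A F F' ∘ₗ i).codRestrict D fun x => by
      rw [hD]; simp [hs.apply_eq_zero]) (LinearMap.snd A F F' ∘ₗ D.subtype) := by
    refine isSES_mk (fun x y hxy => ?_) (fun y => ?_) (fun x => rfl) ?_
    · exact hs.1 (congrArg (fun z : D => z.1.1) hxy)
    · obtain ⟨x, hx⟩ := hs.2.1 (g' y)
      exact ⟨⟨(x, y), (hD _).2 hx⟩, rfl⟩
    · rintro ⟨⟨x, y⟩, hxy⟩ (h : y = 0)
      subst h
      rw [hD, map_zero] at hxy
      obtain ⟨z, rfl⟩ := hs.exists_of_eq_zero hxy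
      exact ⟨z, rfl⟩
  have h2 : IsSES A ((LinearMap.inr A F F' ∘ₗ i').codRestrict D fun x => by
      rw [hD]; simp [hs'.apply_eq_zero]) (LinearMap.fst A F F' ∘ₗ D.subtype) := by
    refine isSES_mk (fun x y hxy => ?_) (fun y => ?_) (fun x => rfl) ?_
    · exact hs'.1 (congrArg (fun z : D => z.1.2) hxy)
    · obtain ⟨x, hx⟩ := hs'.2.1 (g y)
      exact ⟨⟨(y, x), (hD _).2 hx.symm⟩, rfl⟩
    · rintro ⟨⟨x, y⟩, hxy⟩ (h : x = 0)
      subst h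
      rw [hD, map_zero] at hxy
      obtain ⟨z, rfl⟩ := hs'.exists_of_eq_zero hxy.symm
      exact ⟨z, rfl⟩
  have e1 := dimHom_of_projective k S h1
  have e2 := dimHom_of_projective k S h2
  omega

omit [FiniteDimensional k A] [Module.Finite A S] in
variable (k S) in
lemma exists_hasEuler (Y : Type) [AddCommGroup Y] [Module A Y] [Module.Finite A Y] :
    ∃ c : ℤ, HasEuler k (A := A) S Y c := by
  obtain ⟨n, f, hf⟩ := Module.Finite.exists_fin' A Y
  exact ⟨_, ModuleCat.of A (LinearMap.ker f), ModuleCat.of A (Fin n → A), _, f,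
    inferInstanceAs (Module.Finite A (Fin n → A)), inferInstanceAs (Module.Projective A (Fin n → A)),
    isSES_ker hf, rfl⟩

lemma HasEuler.prod {c d : ℤ} (hc : HasEuler k (A := A) S Y c) (hd : HasEuler k (A := A) S Z d) :
    HasEuler k (A := A) S (Y × Z) (c + d) := by
  obtain ⟨K, F, i, g, _, _, hs, rfl⟩ := hc
  obtain ⟨K', F', i', g', _, _, hs', rfl⟩ := hd
  have : IsArtinianRing A := IsArtinianRing.of_finite k A
  have : Module.Finite A K := Module.Finite.of_injective i hs.1
  have : Module.Finite A K' := Module.Finite.of_injective i' hs'.1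
  have hs2 : IsSES A (i.prodMap i') (g.prodMap g') := by
    refine isSES_mk (hs.1.prodMap hs'.1) (hs.2.1.prodMap hs'.2.1)
      (fun x => Prod.ext (hs.apply_eq_zero _) (hs'.apply_eq_zero _)) ?_
    rintro ⟨x, y⟩ hxy
    obtain ⟨a, rfl⟩ := hs.exists_of_eq_zero (congrArg Prod.fst hxy)
    obtain ⟨b, rfl⟩ := hs'.exists_of_eq_zero (congrArg Prod.snd hxy)
    exact ⟨(a, b), rfl⟩
  refine ⟨ModuleCat.of A (K × K'), ModuleCat.of A (F × F'), _, _,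
    inferInstanceAs (Module.Finite A (F × F')), inferInstanceAs (Module.Projective A (F × F')),
    hs2, ?_⟩
  show _ = (dimHom k A (F × F') S : ℤ) - dimHom k A (K × K') S
  rw [dimHom_prod, dimHom_prod]
  push_cast
  ring

lemma projective_pi [Module.Projective A Y] (n : ℕ) : Module.Projective A (Fin n → Y) :=
  Module.Projective.of_equiv (DFinsupp.linearEquivFunOnFintype (R := A) (M := fun _ : Fin n => Y))

lemma HasEuler.pi {c : ℤ} (hc : HasEuler k (A := A) S Y c) (n : ℕ) :
    HasEuler k (A := A) S (Fin n → Y) (n * c) := by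
  obtain ⟨K, F, i, g, _, _, hs, rfl⟩ := hc
  have : IsArtinianRing A := IsArtinianRing.of_finite k A
  have : Module.Finite A K := Module.Finite.of_injective i hs.1
  have hs2 : IsSES A (LinearMap.pi fun j : Fin n => i ∘ₗ LinearMap.proj j)
      (LinearMap.pi fun j : Fin n => g ∘ₗ LinearMap.proj j) := by
    refine isSES_mk (fun x y hxy => funext fun j => hs.1 (congrFun hxy j)) (fun y => ?_)
      (fun x => funext fun j => hs.apply_eq_zero _) (fun y hy => ?_)
    · choose x hx using fun j => hs.2.1 (y j)
      exact ⟨x, funext hx⟩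
    · choose x hx using fun j => hs.exists_of_eq_zero (congrFun hy j)
      exact ⟨x, funext hx⟩
  refine ⟨ModuleCat.of A (Fin n → K), ModuleCat.of A (Fin n → F), _, _,
    inferInstanceAs (Module.Finite A (Fin n → F)),
    projective_pi n, hs2, ?_⟩
  show _ = (dimHom k A (Fin n → F) S : ℤ) - dimHom k A (Fin n → K) S
  rw [dimHom_pi, dimHom_pi]
  push_cast
  ring

/-- Additivity of the Euler form along a projective kernel. -/
lemma HasEuler.of_isSES {P : Type} [AddCommGroup P] [Module A P] [Module.Finite A P]
    [Module.Projective A P] {f : P →ₗ[A] Y} {g : Y →ₗ[A] Z} (h : IsSES A f g) {c : ℤ}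
    (hc : HasEuler k (A := A) S Z c) : HasEuler k (A := A) S Y (dimHom k A P S + c) := by
  obtain ⟨K, F, i, π, _, _, hs, rfl⟩ := hc
  obtain ⟨l, hl⟩ := Module.projective_lifting_property g π h.2.1
  obtain ⟨m, hm⟩ := exists_factor_inj h.1 (l ∘ₗ i) fun w => h.exists_of_eq_zero (by
    rw [LinearMap.comp_apply, ← LinearMap.comp_apply g, hl, hs.apply_eq_zero])
  have hl' : ∀ x, g (l x) = π x := LinearMap.congr_fun hl
  have hm' : ∀ x, f (m x) = l (i x) := LinearMap.congr_fun hm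
  have hs2 : IsSES A ((-m).prod i) (f.coprod l) := by
    refine isSES_mk (fun x y hxy => hs.1 (congrArg Prod.snd hxy)) (fun y => ?_) (fun x => ?_) ?_
    · obtain ⟨x, hx⟩ := hs.2.1 (g y)
      obtain ⟨z, hz⟩ := h.exists_of_eq_zero (y := y - l x) (by rw [map_sub, hl', hx, sub_self])
      exact ⟨(z, x), by simp [hz]⟩
    · simp [hm']
    · rintro ⟨z, x⟩ hzx
      have hzx' : f z + l x = 0 := by simpa using hzx
      have h1 : π x = 0 := by
        have := congrArg g hzx'
        rwa [map_add, h.apply_eq_zero, zero_add, hl', map_zero] at this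
      obtain ⟨y, rfl⟩ := hs.exists_of_eq_zero h1
      refine ⟨y, Prod.ext (h.1 ?_) rfl⟩
      simp [hm', eq_neg_of_add_eq_zero_left hzx']
  refine ⟨K, ModuleCat.of A (P × F), _, _, inferInstanceAs (Module.Finite A (P × F)),
    inferInstanceAs (Module.Projective A (P × F)), hs2, ?_⟩
  show _ = (dimHom k A (P × F) S : ℤ) - _
  rw [dimHom_prod]
  push_cast
  ring

end Euler

section TwoSimples

/-- A `3 × 3` integer matrix of rank at most two is not diagonal and invertible. -/
lemma false_of_diagonal {x y c d : Fin 3 → ℤ} (h : ∀ j l, j ≠ l → x j * c l + y j * d l = 0)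
    (h' : ∀ j, x j * c j + y j * d j ≠ 0) : False := by
  have hD : ∀ j l m, j ≠ l → j ≠ m → l ≠ m → x l * y m = x m * y l := by
    intro j l m hjl hjm hlm
    have h1 := h l j hjl.symm
    have h2 := h m j hjm.symm
    have : (x l * y m - x m * y l) * (x j * c j + y j * d j) = 0 := by
      linear_combination (x j * y m - x m * y j) * h1 + (x l * y j - x j * y l) * h2
    rcases mul_eq_zero.1 this with h | h
    · exact sub_eq_zero.1 h
    · exact (h' j h).elim
  have e := hD 2 0 1 (by decide) (by decide) (by decide)
  have h1 := h' 0
  have h2 := h 1 0 (by decide)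
  have h3 := h' 1
  have hx : x 1 * (x 0 * c 0 + y 0 * d 0) = 0 := by linear_combination x 0 * h2 - d 0 * e
  have hy : y 1 * (x 0 * c 0 + y 0 * d 0) = 0 := by linear_combination y 0 * h2 + c 0 * e
  rcases mul_eq_zero.1 hx with hx | hx
  · rcases mul_eq_zero.1 hy with hy | hy
    · exact h3 (by rw [hx, hy]; ring)
    · exact h1 hy
  · exact h1 hx

variable (k : Type) [Field k] {A : Type} [Ring A] [Algebra k A] [FiniteDimensional k A]

/-- A projective cover of a simple module. -/
lemma exists_projective_cover (S : Type) [AddCommGroup S] [Module A S] [IsSimpleModule A S] :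
    ∃ (P : Submodule A A) (r : A →ₗ[A] P), (∀ x : P, r x = x) ∧ dimHom k A P S ≠ 0 ∧
      ∀ (S' : Type) [AddCommGroup S'] [Module A S'], IsSimpleModule A S' →
        IsEmpty (S' ≃ₗ[A] S) → dimHom k A P S' = 0 := by
  have : IsArtinianRing A := IsArtinianRing.of_finite k A
  have : Nontrivial S := IsSimpleModule.nontrivial A S
  obtain ⟨s₀, hs₀⟩ := exists_ne (0 : S)
  set π := LinearMap.toSpanSingleton A S s₀
  have hπ : Function.Surjective π := IsSimpleModule.toSpanSingleton_surjective A hs₀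
  obtain ⟨P, r, hr, hsurj, hend⟩ := exists_min_cover π hπ
  have := projective_of_retract P r hr
  have hP : Module.Finite A P := inferInstance
  let ρ : P →ₗ[A] S := π ∘ₗ P.subtype
  have hρ : Function.Surjective ρ := fun y => hsurj y
  refine ⟨P, r, hr, ?_, fun S' _ _ _ hS' => ?_⟩
  · let _ := kmod k A S
    have := kmod_tower k A S
    let _ := kmod k A P
    have := kmod_tower k A P
    have : FiniteDimensional k S := Module.Finite.trans A S
    have : FiniteDimensional k P := Module.Finite.trans A P
    have := finite_hom (k := k) (A := A) P S
    intro h0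
    have h0' : Subsingleton (P →ₗ[A] S) := Module.finrank_zero_iff.1 h0
    obtain ⟨x, hx⟩ := hρ s₀
    exact hs₀ (by rw [← hx, Subsingleton.elim ρ 0, LinearMap.zero_apply])
  · have h0 : ∀ f : P →ₗ[A] S', f = 0 := by
      intro f
      by_contra hf
      have hf' : Function.Surjective f := (LinearMap.surjective_or_eq_zero f).resolve_right hf
      have hex : ∃ x, f x = 0 ∧ ρ x ≠ 0 := by
        by_contra! hc
        obtain ⟨u, hu⟩ := exists_factor_surj hf' ρ hc
        have hu0 : u ≠ 0 := by
          rintro rfl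
          obtain ⟨x, hx⟩ := hρ s₀
          exact hs₀ (by rw [← hx, ← hu]; rfl)
        exact hS'.false (LinearEquiv.ofBijective u (LinearMap.bijective_of_ne_zero hu0))
      obtain ⟨x, hx, hx'⟩ := hex
      let σ : LinearMap.ker f →ₗ[A] S := ρ ∘ₗ (LinearMap.ker f).subtype
      have hσ : Function.Surjective σ := (LinearMap.surjective_or_eq_zero σ).resolve_right fun h =>
        hx' (LinearMap.congr_fun h ⟨x, hx⟩)
      obtain ⟨g, hg⟩ := Module.projective_lifting_property σ ρ hσ
      obtain ⟨z, hz⟩ : ∃ z, f z ≠ 0 := by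
        by_contra! hc
        exact hf (LinearMap.ext hc)
      obtain ⟨w, rfl⟩ := hend ((LinearMap.ker f).subtype ∘ₗ g) (LinearMap.congr_fun hg) z
      exact hz (g w).2
    have : Subsingleton (P →ₗ[A] S') := ⟨fun f g => by rw [h0 f, h0 g]⟩
    let _ := kmod k A S'
    have := kmod_tower k A S'
    exact Module.finrank_zero_of_subsingleton

include k in
/-- If all projective left ideals have presentations by two modules, then there are at most two
simple modules. -/
lemma exists_two_simples {U₀ U₁ : Type} [AddCommGroup U₀] [Module A U₀] [AddCommGroup U₁]
    [Module A U₁] [Module.Finite A U₀] [Module.Finite A U₁]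
    (h : ∀ (P : Submodule A A) (r : A →ₗ[A] P), (∀ x : P, r x = x) → ∃ (a b n : ℕ)
      (f : P →ₗ[A] ((Fin a → U₀) × (Fin b → U₁)))
      (g : ((Fin a → U₀) × (Fin b → U₁)) →ₗ[A] (Fin n → U₁)), IsSES A f g) :
    ∃ S₁ S₂ : ModuleCat.{0} A, ∀ X : ModuleCat.{0} A, IsSimpleModule A ↥X →
      (Nonempty (↥X ≃ₗ[A] ↥S₁) ∨ Nonempty (↥X ≃ₗ[A] ↥S₂)) := by
  have : IsArtinianRing A := IsArtinianRing.of_finite k A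
  by_contra! hc
  obtain ⟨X₀, hX₀, -⟩ := hc (ModuleCat.of A PUnit) (ModuleCat.of A PUnit)
  obtain ⟨X₁, hX₁, h10, -⟩ := hc X₀ X₀
  obtain ⟨X₂, hX₂, h20, h21⟩ := hc X₀ X₁
  let S : Fin 3 → ModuleCat.{0} A := ![X₀, X₁, X₂]
  have hS : ∀ j, IsSimpleModule A (S j) := by
    intro j
    fin_cases j
    exacts [hX₀, hX₁, hX₂]
  have hne : ∀ j l, j ≠ l → IsEmpty (S l ≃ₗ[A] S j) := by
    intro j l hjl
    fin_cases j <;> fin_cases l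
    exacts [(hjl rfl).elim, h10, h20, ⟨fun e => h10.false e.symm⟩, (hjl rfl).elim, h21,
      ⟨fun e => h20.false e.symm⟩, ⟨fun e => h21.false e.symm⟩, (hjl rfl).elim]
  choose P r hr hP hP' using fun j => exists_projective_cover k (A := A) (S j)
  choose a b n f g hs using fun j => h (P j) (r j) (hr j)
  choose c hc using fun l => exists_hasEuler k (A := A) (S l) U₀
  choose d hd using fun l => exists_hasEuler k (A := A) (S l) U₁
  have key : ∀ j l, (a j : ℤ) * c l + ((b j : ℤ) - n j) * d l = dimHom k A (P j) (S l) := by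
    intro j l
    have := projective_of_retract (P j) (r j) (hr j)
    have h1 := HasEuler.of_isSES (hs j) ((hd l).pi (n j))
    have h2 := (((hc l).pi (a j)).prod ((hd l).pi (b j))).unique h1
    linear_combination h2
  refine false_of_diagonal (x := fun j => (a j : ℤ)) (y := fun j => (b j : ℤ) - n j) (c := c)
    (d := d) (fun j l hjl => ?_) fun j => ?_
  · rw [key, hP' j (S l) (hS l) (hne j l hjl), Nat.cast_zero]
  · rw [key]
    exact_mod_cast hP j

end TwoSimples

section Triangular

variable (k : Type) [Field k] {A B T X : Type} [Ring A] [Ring B] [Algebra k A] [Algebra k B]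
  [FiniteDimensional k A] [AddCommGroup T] [Module A T] [AddCommGroup X] [Module A X]

lemma span_idem_apply {s : A} (hs : s * s = s) (u : Submodule.span A {s}) :
    (u : A) * s = u := by
  obtain ⟨c, hc⟩ := Submodule.mem_span_singleton.1 u.2
  rw [← hc, smul_eq_mul, mul_assoc, hs]

variable {s : A}

/-- The vertex component of a module at an idempotent `s` with `s A s = k s` is generated by
copies of the left ideal `A s`. -/
lemma exists_cover_corner [Module.Finite A X] (hs : s * s = s)
    (hk : ∀ c : A, ∃ r : k, s * c * s = r • s) :
    ∃ (n : ℕ) (f : (Fin n → Submodule.span A {s}) →ₗ[A] X),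
      (∀ x, ∃ u, f u = s • x) ∧ ∀ u, s • f u = 0 → s • u = 0 := by
  let _ := kmod k A X
  have := kmod_tower k A X
  have : FiniteDimensional k X := Module.Finite.trans A X
  let m : X →ₗ[k] X := Module.toModuleEnd k X s
  have hm : ∀ x, m x = s • x := fun _ => rfl
  let β := Module.finBasis k (LinearMap.range m)
  have hβ : ∀ i, s • (β i : X) = β i := by
    intro i
    obtain ⟨x, hx⟩ := (β i).2
    rw [← hx, hm, ← mul_smul, hs]
  let f : (Fin (Module.finrank k (LinearMap.range m)) → Submodule.span A {s}) →ₗ[A] X :=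
    ∑ i, (LinearMap.toSpanSingleton A X (β i)) ∘ₗ (Submodule.span A {s}).subtype ∘ₗ
      LinearMap.proj i
  have hf : ∀ u, f u = ∑ i, (u i : A) • (β i : X) := fun u => by
    simp [f, LinearMap.sum_apply]
  refine ⟨_, f, fun x => ?_, fun u hu => ?_⟩
  · have h1 := β.sum_repr ⟨m x, x, rfl⟩
    refine ⟨fun i => ⟨β.repr ⟨m x, x, rfl⟩ i • s, ?_⟩, ?_⟩
    · exact Submodule.smul_of_tower_mem _ _ (Submodule.mem_span_singleton_self s)
    · rw [hf, ← hm]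
      refine Eq.trans (Finset.sum_congr rfl fun i _ => ?_)
        ((AddSubmonoidClass.coe_finsetSum _ _).symm.trans (congrArg Subtype.val h1))
      rw [smul_assoc, hβ]
      rfl
  · choose r hr using fun i => hk (u i : A)
    have hr' : ∀ i, s * (u i : A) = r i • s := fun i => by
      rw [← hr, mul_assoc, span_idem_apply hs]
    have h0 : ∑ i, r i • β i = 0 := by
      refine Subtype.val_injective ?_
      refine (AddSubmonoidClass.coe_finsetSum _ _).trans ?_
      rw [hf, Finset.smul_sum] at hu
      refine Eq.trans (Finset.sum_congr rfl fun i _ => ?_) hu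
      rw [← mul_smul, hr', smul_assoc, hβ]
      rfl
    have h1 := Fintype.linearIndependent_iff.1 β.linearIndependent r h0
    funext i
    refine Subtype.val_injective ?_
    refine (hr' i).trans ?_
    rw [h1, zero_smul]
    rfl

variable {w : A}

/-- The two-step projective resolution over a triangular algebra with two vertices. -/
lemma exists_resolution [Module.Finite A X] (hs : s * s = s) (hw : w * w = w) (hsw : s + w = 1)
    (h0 : ∀ c : A, s * c * w = 0) (hks : ∀ c : A, ∃ r : k, s * c * s = r • s)
    (hkw : ∀ c : A, ∃ r : k, w * c * w = r • w) :
    ∃ (a b n : ℕ) (i : (Fin n → Submodule.span A {w}) →ₗ[A]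
        ((Fin a → Submodule.span A {s}) × (Fin b → Submodule.span A {w})))
      (g : ((Fin a → Submodule.span A {s}) × (Fin b → Submodule.span A {w})) →ₗ[A] X),
      IsSES A i g := by
  have : IsArtinianRing A := IsArtinianRing.of_finite k A
  have hz : ∀ v : Submodule.span A {w}, s • v = 0 := fun v => Subtype.val_injective (by
    show s * (v : A) = 0
    rw [← span_idem_apply hw v, ← mul_assoc, h0])
  have hz' : ∀ (m : ℕ) (v : Fin m → Submodule.span A {w}), s • v = 0 := fun m v =>
    funext fun j => hz (v j)
  have hone : ∀ {M : Type} [AddCommGroup M] [Module A M] (x : M), s • x + w • x = x := by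
    intro M _ _ x
    rw [← add_smul, hsw, one_smul]
  obtain ⟨a, f, hf, hf'⟩ := exists_cover_corner k (X := X) hs hks
  obtain ⟨b, g, hg, hg'⟩ := exists_cover_corner k (X := X) hw hkw
  have hsurj : Function.Surjective (f.coprod g) := by
    intro x
    obtain ⟨u, hu⟩ := hf x
    obtain ⟨v, hv⟩ := hg x
    exact ⟨(u, v), by simp [hu, hv, hone]⟩
  let K := LinearMap.ker (f.coprod g)
  have hK : ∀ x : K, s • x = 0 := by
    rintro ⟨⟨u, v⟩, hx⟩
    have hx' : f u + g v = 0 := hx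
    refine Subtype.val_injective (Prod.ext (hf' u ?_) (hz' b v))
    have := congrArg (fun y => s • y) hx'
    rwa [smul_add, ← map_smul g, hz', map_zero, add_zero, smul_zero] at this
  obtain ⟨n, q, hq, hq'⟩ := exists_cover_corner k (X := K) hw hkw
  refine ⟨a, b, n, K.subtype ∘ₗ q, f.coprod g, isSES_mk ?_ hsurj (fun x => (q x).2) ?_⟩
  · refine Subtype.val_injective.comp ((injective_iff_map_eq_zero q).2 fun u hu => ?_)
    rw [← hone u, hz', hq' u (by rw [hu, smul_zero]), add_zero]
  · intro y hy
    obtain ⟨u, hu⟩ := hq ⟨y, hy⟩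
    refine ⟨u, ?_⟩
    have h1 := hone (⟨y, hy⟩ : K)
    rw [hK, zero_add] at h1
    rw [LinearMap.comp_apply, hu, h1]
    rfl

variable [Module B T] [SMulCommClass A B T]

/-- `Hom(-, T)` turns a finite direct sum into a finite direct sum. -/
lemma exists_homCod_equiv (B : Type) [Ring B] [Module B T] [SMulCommClass A B T] (n : ℕ) :
    Nonempty (((Fin n → X) →ₗ[A] T) ≃ₗ[B] (Fin n → (X →ₗ[A] T))) :=
  ⟨(LinearMap.lsum A (fun _ : Fin n => X) (M := T) B).symm⟩

variable (A B T) in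
include k in
lemma finite_homCod [Module.Finite A X] [Module k T] [FiniteDimensional k T] [IsScalarTower k A T]
    [IsScalarTower k B T] : Module.Finite B (X →ₗ[A] T) := by
  let _ := kmod k A X
  have := kmod_tower k A X
  have : FiniteDimensional k X := Module.Finite.trans A X
  have := finite_hom (k := k) (A := A) X T
  exact Module.Finite.of_restrictScalars_finite k B _

include k in
/-- Over a triangular algebra with two vertices, the endomorphism algebra of a module without
self-extensions has at most two simple modules. -/
theorem exists_two_simples_of_triangular [FiniteDimensional k B] [Module k T] [FiniteDimensional k T]
    [IsScalarTower k A T] [IsScalarTower k B T] (hs : s * s = s) (hw : w * w = w)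
    (hsw : s + w = 1) (h0 : ∀ c : A, s * c * w = 0) (hks : ∀ c : A, ∃ r : k, s * c * s = r • s)
    (hkw : ∀ c : A, ∃ r : k, w * c * w = r • w) (hT : ExtZ A T T)
    (hB1 : ∀ f : T →ₗ[A] T, ∃ x : B, ∀ t, f t = x • t)
    (hB2 : ∀ x : B, (∀ t : T, x • t = 0) → x = 0) :
    ∃ S₁ S₂ : ModuleCat.{0} B, ∀ X : ModuleCat.{0} B, IsSimpleModule B ↥X →
      (Nonempty (↥X ≃ₗ[B] ↥S₁) ∨ Nonempty (↥X ≃ₗ[B] ↥S₂)) := by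
  have : IsArtinianRing A := IsArtinianRing.of_finite k A
  have : Module.Finite A T := Module.Finite.of_restrictScalars_finite k A T
  have := finite_homCod k A B T (X := Submodule.span A {s})
  have := finite_homCod k A B T (X := Submodule.span A {w})
  refine exists_two_simples k (U₀ := Submodule.span A {s} →ₗ[A] T)
    (U₁ := Submodule.span A {w} →ₗ[A] T) fun P r hr => ?_
  let e : B := r 1
  have he : ∀ b : B, (r b : B) = b * e := fun b => by
    have := congrArg Subtype.val (r.map_smul b 1)
    simpa [e] using this
  have hPe : ∀ p : P, (p : B) * e = p := fun p => by rw [← he, hr]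
  have hee : e * e = e := hPe (r 1)
  have := SMulCommClass.symm A B T
  let ε : T →ₗ[A] T := Module.toModuleEnd A T e
  have hε : ∀ t, ε t = e • t := fun _ => rfl
  let X := LinearMap.range ε
  have hXe : ∀ x : X, e • (x : T) = x := by
    rintro ⟨_, t, rfl⟩
    show e • (e • t) = e • t
    rw [← mul_smul, hee]
  have hX : ExtZ A X T := hT.retract_left X.subtype ε.rangeRestrict fun x =>
    Subtype.val_injective (hXe x)
  obtain ⟨a, b, n, i, g, hsg⟩ := exists_resolution k (X := X) hs hw hsw h0 hks hkw
  obtain ⟨E₀⟩ := exists_homCod_equiv (A := A) (X := Submodule.span A {s}) (T := T) B a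
  obtain ⟨E₁⟩ := exists_homCod_equiv (A := A) (X := Submodule.span A {w}) (T := T) B b
  obtain ⟨E₂⟩ := exists_homCod_equiv (A := A) (X := Submodule.span A {w}) (T := T) B n
  let E := (LinearMap.coprodEquiv (R := A) (M := Fin a → Submodule.span A {s})
    (M₂ := Fin b → Submodule.span A {w}) (M₃ := T) B).symm.trans (E₀.prodCongr E₁)
  let φ : P →ₗ[B] (((Fin a → Submodule.span A {s}) × (Fin b → Submodule.span A {w})) →ₗ[A] T) :=
    LinearMap.toSpanSingleton B _ (X.subtype ∘ₗ g) ∘ₗ P.subtype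
  have hφ : ∀ p u, φ p u = (p : B) • (g u : T) := fun _ _ => rfl
  refine ⟨a, b, n, E.toLinearMap ∘ₗ φ, E₂.toLinearMap ∘ₗ homCodPre B T i ∘ₗ E.symm.toLinearMap,
    isSES_mk ?_ ?_ (fun p => ?_) (fun y hy => ?_)⟩
  · refine E.injective.comp ((injective_iff_map_eq_zero φ).2 fun p hp => ?_)
    refine Subtype.val_injective (hB2 p fun t => ?_)
    obtain ⟨u, hu⟩ := hsg.2.1 (ε.rangeRestrict t)
    have := LinearMap.congr_fun hp u
    rw [hφ, hu] at this
    rw [← hPe p, mul_smul]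
    exact this
  · refine E₂.surjective.comp (Function.Surjective.comp (g := homCodPre B T i) (fun u => ?_) E.symm.surjective)
    obtain ⟨v, hv⟩ := hX.extend hsg u
    exact ⟨v, LinearMap.ext hv⟩
  · have : homCodPre B T i (φ p) = 0 := by
      refine LinearMap.ext fun u => ?_
      show (p : B) • (g (i u) : T) = 0
      rw [hsg.apply_eq_zero]
      exact smul_zero _
    simp [this]
  · have h1 : homCodPre B T i (E.symm y) = 0 := by
      simpa using hy
    obtain ⟨u, hu⟩ := exists_factor_surj hsg.2.1 (E.symm y) fun z hz => by
      obtain ⟨v, rfl⟩ := hsg.exists_of_eq_zero hz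
      exact LinearMap.congr_fun h1 v
    obtain ⟨x, hx⟩ := hB1 (u ∘ₗ ε.rangeRestrict)
    refine ⟨r x, ?_⟩
    have : φ (r x) = E.symm y := by
      refine LinearMap.ext fun z => ?_
      rw [← hu, hφ, he, mul_smul, hXe, ← hx]
      exact congrArg u (Subtype.val_injective (hXe _))
    simp [this]

end Triangular

section Main

variable {k : Type} [Field k] {t : ℕ} {p : Fin t → ℕ} {lam : Fin t → k}

/-- The case of the Kronecker algebra: all weights are one. -/
lemma exists_two_simples_of_weights {Λ T : Type} [Ring Λ] [Algebra k Λ] [FiniteDimensional k Λ]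
    [AddCommGroup T] [Module (CanAlg k t p lam) T] [Module Λ T] [SMulCommClass (CanAlg k t p lam) Λ T]
    [Module k T] [FiniteDimensional k T] [IsScalarTower k (CanAlg k t p lam) T]
    [IsScalarTower k Λ T] (hd : IsCanonicalData k t p lam) (hp : ∀ i, p i = 1)
    (hT : ExtZ (CanAlg k t p lam) T T) (hΛ : IsEndAlg (CanAlg k t p lam) Λ T) :
    ∃ S₁ S₂ : ModuleCat.{0} Λ, ∀ X : ModuleCat.{0} Λ, IsSimpleModule Λ ↥X →
      (Nonempty (↥X ≃ₗ[Λ] ↥S₁) ∨ Nonempty (↥X ≃ₗ[Λ] ↥S₂)) := by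
  have := canAlg_finite (k := k) (lam := lam) hd.pos hd.2.1
  have hsink : ∀ (c : CanAlg k t p lam) (y : CanVert t p),
      canE k lam y * c * canE k lam (canSink t p) = 0 ∨ canSink t p = y ∧ ∃ r : k,
        canE k lam y * c * canE k lam (canSink t p) = r • canE k lam (canSink t p) := by
    intro c y
    have h := corner_internal hd ⟨0, hd.pos⟩ (hd.2.1 _) le_rfl y c
    rw [canPos_last hd.2.1] at h
    refine h.imp id ?_
    rintro ⟨r, n, hn, hx, hr⟩
    obtain rfl : n = 0 := by omega
    rw [add_zero, canPos_last hd.2.1] at hx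
    rw [canPath, canPos_last hd.2.1] at hr
    exact ⟨hx, r, hr⟩
  refine exists_two_simples_of_triangular k (s := canE k lam (canSource t p))
    (w := canE k lam (canSink t p)) (canE_mul_self _) (canE_mul_self _) ?_ (fun c => ?_)
    (source_corner hd) (fun c => ?_) hT hΛ.exists_smul hΛ.faithful
  · rw [← sum_canE (k := k) (p := p) (lam := lam), Fintype.sum_sum_type, Fintype.sum_sum_type]
    have : IsEmpty (Σ i : Fin t, Fin (p i - 1)) :=
      ⟨fun x => by have := x.2.2; have := hp x.1; omega⟩
    simp [canSource, canSink]
  · refine (hsink c _).resolve_right fun h => ?_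
    simp [canSource, canSink] at h
  · rcases hsink c (canSink t p) with h | ⟨-, h⟩
    · exact ⟨0, by rw [h, zero_smul]⟩
    · exact h

variable {Λ : Type} [Ring Λ] [Algebra k Λ] [FiniteDimensional k Λ]

lemma exists_two_simples_or (h : IsConcealedCanonicalOf k Λ t p lam) :
    (∃ S₁ S₂ : ModuleCat.{0} Λ, ∀ X : ModuleCat.{0} Λ, IsSimpleModule Λ ↥X →
      (Nonempty (↥X ≃ₗ[Λ] ↥S₁) ∨ Nonempty (↥X ≃ₗ[Λ] ↥S₂))) ∨
    (¬ IsJoinSemilatticePoset (FTors Λ) ∧ ¬ IsMeetSemilatticePoset (FTors Λ)) := by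
  obtain ⟨hd, T, hT, hpos, φ, hφ⟩ := h
  have := canAlg_finite (k := k) (lam := lam) hd.pos hd.2.1
  have hTilt := isTilt_of_isTiltingModule hT
  have := hTilt.finite
  have hinj := isArmInjective_of_pos hd hpos
  let _ : Module Λ T := Module.compHom T φ.toRingHom
  have hact : ∀ (x : Λ) (m : T), x • m = φ x m := fun _ _ => rfl
  let _ := kmod k (CanAlg k t p lam) T
  have := kmod_tower k (CanAlg k t p lam) T
  have : FiniteDimensional k T := Module.Finite.trans (CanAlg k t p lam) T
  have : SMulCommClass Λ (CanAlg k t p lam) T := ⟨fun x c m => (φ x).map_smul c m⟩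
  have : SMulCommClass (CanAlg k t p lam) Λ T := SMulCommClass.symm _ _ _
  have : SMulCommClass Λ k T := ⟨fun x c m => (φ x).map_smul (algebraMap k _ c) m⟩
  have : IsScalarTower k Λ T := ⟨fun c x m => by
    rw [Algebra.smul_def]
    exact hφ c x m⟩
  have hB : IsEndAlg (CanAlg k t p lam) Λ T := by
    refine ⟨fun f => ⟨φ.symm f, fun m => ?_⟩, fun x hx => ?_⟩
    · rw [hact, RingEquiv.apply_symm_apply]
    · rw [← map_eq_zero_iff φ φ.injective]
      exact LinearMap.ext hx
  by_cases hp : ∀ i, p i = 1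
  · exact .inl (exists_two_simples_of_weights hd hp hTilt.extZ_self hB)
  push Not at hp
  obtain ⟨i, hi⟩ := hp
  have hi2 : 2 ≤ p i := by have := hd.2.1 i; omega
  obtain ⟨j, hij⟩ := exists_arm_ne hd i
  let X := armData hd hinj i
  let X' := armData hd hinj j
  have : Nontrivial X.E := nontrivial_armE hd i
  refine .inr ⟨?_, fun h => ?_⟩
  · exact ArmData.not_isJoinSemilatticePoset (k := k) (canE_mul_self _) (canE_mul_self _) hTilt hB
      X X' (extZ_armE hd hi2) (extZ_armY hd) (hom_armE_armE hd hij.symm)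
      (hom_armY_armE hd hij.symm) (hom_armE_armY hd) (hom_armY_armY hd hij.symm)
  · exact ArmData.not_isJoinSemilatticePoset_op (k := k) (canE_mul_self _) (canE_mul_self _) hTilt
      hB X X' (extZ_armE hd hi2) (extZ_armY hd) (hom_armE_armE hd hij)
      (hom_armE_armY hd) (hom_armY_armE hd hij) (hom_armY_armY hd hij)
      (isJoinSemilatticePoset_op k h)

end Main

/-- **Theorem 0.4.** Let `Λ` be a concealed canonical algebra (in particular a canonical
algebra) or a tubular algebra over an algebraically closed field `k`. The following are
equivalent: (a) `ftors Λ` is a lattice; (b) `ftors Λ` is a join-semilattice;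
(c) `ftors Λ` is a meet-semilattice; (d) `Λ` has at most `2` simple modules up to
isomorphism. -/
theorem concealed_canonical_tfae (k Λ : Type) [Field k] [IsAlgClosed k]
    [Ring Λ] [Algebra k Λ] [FiniteDimensional k Λ]
    (h : IsConcealedCanonical k Λ ∨ IsTubularAlgebra k Λ) :
    List.TFAE
      [IsLatticePoset (FTors Λ),
       IsJoinSemilatticePoset (FTors Λ),
       IsMeetSemilatticePoset (FTors Λ),
       ∃ S₁ S₂ : ModuleCat.{0} Λ, ∀ X : ModuleCat.{0} Λ, IsSimpleModule Λ ↥X →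
         (Nonempty (↥X ≃ₗ[Λ] ↥S₁) ∨ Nonempty (↥X ≃ₗ[Λ] ↥S₂))] := by
  obtain ⟨t, p, lam, h'⟩ : ∃ (t : ℕ) (p : Fin t → ℕ) (lam : Fin t → k),
      IsConcealedCanonicalOf k Λ t p lam := by
    rcases h with h | ⟨t, p, lam, -, h⟩
    exacts [h, ⟨t, p, lam, h⟩]
  have key := exists_two_simples_or h'
  tfae_have 1 → 2 := fun h => h.1
  tfae_have 1 → 3 := fun h => h.2
  tfae_have 2 → 4 := fun h => key.resolve_right fun h' => h'.1 h
  tfae_have 3 → 4 := fun h => key.resolve_right fun h' => h'.2 h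
  tfae_have 4 → 1 := fun ⟨S₁, S₂, hS⟩ => isLatticePoset_of_two_simples k S₁ S₂ hS
  tfae_finish

end TorsionLattice
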